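/- The Euler characteristic of any closed two-dimensional submanifold of (RP^1)^3 is even. -/

import Mathlib

open CategoryTheory

/-! Singular homology with coefficients in a commutative ring, defined via the singular
simplicial set, and Betti numbers with `ℤ/2ℤ` coefficients. -/

noncomputable def singularChainComplex (R : Type) [CommRing R]
    (X : Type) [TopologicalSpace X] : ChainComplex (ModuleCat R) ℕ :=
  (AlgebraicTopology.alternatingFaceMapComplex (ModuleCat R)).obj
    (((SimplicialObject.whiskering _ _).obj (ModuleCat.free R)).obj
      (TopCat.toSSet.obj (TopCat.of X)))

noncomputable def singularHomology (R : Type) [CommRing R]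
    (X : Type) [TopologicalSpace X] (n : ℕ) : ModuleCat R :=
  (singularChainComplex R X).homology n

/-- The `n`-th Betti number with `ℤ/2ℤ` coefficients,
`b_n(X) = dim_{ℤ/2ℤ} H_n(X; ℤ/2ℤ)`. -/
noncomputable def betti (X : Type) [TopologicalSpace X] (n : ℕ) : ℕ :=
  Module.finrank (ZMod 2) (singularHomology (ZMod 2) X n)

/-- A closed surface: a compact Hausdorff space locally homeomorphic to `ℝ²`. -/
def IsClosedSurface (Z : Type) [TopologicalSpace Z] : Prop :=
  CompactSpace Z ∧ T2Space Z ∧ Nonempty (ChartedSpace (EuclideanSpace ℝ (Fin 2)) Z)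

/-- The Euler characteristic of a (two-dimensional) space,
`χ = b₀ - b₁ + b₂` (the higher Betti numbers of a closed surface vanish). -/
noncomputable def eulerCharSurface (Z : Type) [TopologicalSpace Z] : ℤ :=
  (betti Z 0 : ℤ) - (betti Z 1 : ℤ) + (betti Z 2 : ℤ)

/-- The real projective line. -/
abbrev RP1 := Projectivization ℝ (Fin 2 → ℝ)

noncomputable instance : TopologicalSpace RP1 :=
  inferInstanceAs (TopologicalSpace (Quotient _))

namespace SurfT3

/-! ### Singular chains modulo two and cones -/

/-- The standard simplex with `n` vertices. -/
abbrev Simp (n : ℕ) : Type := stdSimplex ℝ (Fin n)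

/-- Singular simplices with `n` vertices. -/
abbrev Sing (n : ℕ) (X : Type) [TopologicalSpace X] : Type := C(Simp n, X)

/-- Singular chains with coefficients in `ZMod 2`, indexed by the number of vertices. -/
abbrev Ch (n : ℕ) (X : Type) [TopologicalSpace X] : Type := Sing n X →₀ ZMod 2

variable {X Y W : Type} [TopologicalSpace X] [TopologicalSpace Y] [TopologicalSpace W]

/-- The coface map. -/
noncomputable def face {n : ℕ} (i : Fin (n + 1)) : C(Simp n, Simp (n + 1)) where
  toFun t := ⟨i.insertNth 0 t.1, by
    refine ⟨fun j => ?_, ?_⟩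
    · refine Fin.succAboveCases i ?_ (fun k => ?_) j
      · simp
      · simpa using t.2.1 k
    · rw [Fin.sum_univ_succAbove _ i]
      simpa using t.2.2⟩
  continuous_toFun := by
    refine Continuous.subtype_mk (continuous_pi fun j => ?_) _
    refine Fin.succAboveCases i ?_ (fun k => ?_) j
    · simpa using continuous_const
    · simp only [Fin.insertNth_apply_succAbove]
      exact (continuous_apply k).comp continuous_subtype_val

@[simp] lemma face_same {n : ℕ} (i : Fin (n + 1)) (t : Simp n) : (face i t) i = 0 :=
  Fin.insertNth_apply_same (α := fun _ => ℝ) i 0 t.1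

@[simp] lemma face_succAbove {n : ℕ} (i : Fin (n + 1)) (t : Simp n) (j : Fin n) :
    (face i t) (i.succAbove j) = t j :=
  Fin.insertNth_apply_succAbove (α := fun _ => ℝ) i 0 t.1 j

lemma simp_ext_succAbove {n : ℕ} (i : Fin (n + 1)) {s t : Simp (n + 1)} (h : s i = t i)
    (h' : ∀ j, s (i.succAbove j) = t (i.succAbove j)) : s = t := by
  refine Subtype.ext (funext fun j => ?_)
  exact Fin.succAboveCases i h h' j

lemma face_face {n : ℕ} (i : Fin (n + 2)) (j : Fin (n + 1)) (t : Simp n) :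
    face (i.succAbove j) (face (j.predAbove i) t) = face i (face j t) := by
  refine simp_ext_succAbove (i.succAbove j) (by simp) fun k => ?_
  refine Fin.succAboveCases (j.predAbove i) ?_ (fun l => ?_) k
  · simp only [face_succAbove, face_same]
    rw [Fin.succAbove_succAbove_predAbove]
    simp
  · rw [face_succAbove, face_succAbove, Fin.succAbove_succAbove_succAbove_predAbove]
    simp

instance : IsEmpty (Simp 0) := ⟨fun t => by simpa using t.2.2⟩

instance : Subsingleton (Sing 0 X) := ⟨fun _ _ => ContinuousMap.ext fun t => isEmptyElim t⟩

/-- The chain of a single simplex. -/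
noncomputable abbrev gen {n : ℕ} (σ : Sing n X) : Ch n X := Finsupp.single σ 1

lemma ch_induction {n : ℕ} {p : Ch n X → Prop} (c : Ch n X) (h0 : p 0)
    (hg : ∀ σ, p (gen σ)) (ha : ∀ a b, p a → p b → p (a + b)) : p c := by
  induction c using Finsupp.induction_linear with
  | zero => exact h0
  | add a b h1 h2 => exact ha a b h1 h2
  | single σ r =>
    have : r = 0 ∨ r = 1 := by revert r; decide
    rcases this with rfl | rfl
    · simpa using h0
    · exact hg σ

lemma ch_hom_ext {n : ℕ} {M : Type} [AddCommMonoid M] [Module (ZMod 2) M]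
    {f g : Ch n X →ₗ[ZMod 2] M} (h : ∀ σ, f (gen σ) = g (gen σ)) : f = g :=
  Finsupp.lhom_ext' fun σ => LinearMap.ext_ring (h σ)

lemma add_self_eq {M : Type*} [AddCommGroup M] [Module (ZMod 2) M] (c : M) : c + c = 0 := by
  have : (2 : ZMod 2) • c = 0 := by rw [show (2 : ZMod 2) = 0 by decide, zero_smul]
  rwa [two_smul] at this

lemma eq_of_add_eq_zero {M : Type*} [AddCommGroup M] [Module (ZMod 2) M] {a b : M}
    (h : a + b = 0) : a = b := by
  calc a = a + (b + b) := by rw [add_self_eq, add_zero]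
    _ = b := by rw [← add_assoc, h, zero_add]

lemma of_one_smul {M : Type*} [AddCommGroup M] [Module (ZMod 2) M] {a b : M}
    (h : (1 : ZMod 2) • a = b) : a = b := by
  rwa [one_smul] at h

lemma neg_eq_self' {M : Type*} [AddCommGroup M] [Module (ZMod 2) M] (a : M) : -a = a :=
  (eq_of_add_eq_zero (by simp : -a + a = 0))

/-- The boundary. -/
noncomputable def d {n : ℕ} : Ch (n + 1) X →ₗ[ZMod 2] Ch n X :=
  Finsupp.linearCombination (ZMod 2) fun σ => ∑ i, gen (σ.comp (face i))

@[simp] lemma d_gen {n : ℕ} (σ : Sing (n + 1) X) : d (gen σ) = ∑ i, gen (σ.comp (face i)) := by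
  simp [d]

lemma d_d {n : ℕ} (c : Ch (n + 2) X) : d (d c) = 0 := by
  suffices h : (d ∘ₗ d : Ch (n + 2) X →ₗ[ZMod 2] Ch n X) = 0 from LinearMap.congr_fun h c
  refine ch_hom_ext fun σ => ?_
  simp only [LinearMap.comp_apply, d_gen, map_sum, LinearMap.zero_apply]
  rw [← Finset.sum_product']
  refine Finset.sum_involution
    (fun p _ => (p.1.succAbove p.2, p.2.predAbove p.1)) ?_ ?_ (by simp) ?_
  · rintro ⟨i, j⟩ -
    have : ((σ.comp (face (i.succAbove j))).comp (face (j.predAbove i))) =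
        (σ.comp (face i)).comp (face j) := by
      ext t
      simp [face_face]
    simp only [this]
    exact add_self_eq _
  · rintro ⟨i, j⟩ - - h
    exact Fin.succAbove_ne i j (congrArg Prod.fst h)
  · rintro ⟨i, j⟩ -
    simp [Fin.succAbove_succAbove_predAbove, Fin.predAbove_predAbove_succAbove]

/-- Pushforward of chains. -/
noncomputable def push {n : ℕ} (f : C(X, Y)) : Ch n X →ₗ[ZMod 2] Ch n Y :=
  Finsupp.lmapDomain (ZMod 2) (ZMod 2) fun σ => f.comp σ

@[simp] lemma push_gen {n : ℕ} (f : C(X, Y)) (σ : Sing n X) :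
    push f (gen σ) = gen (f.comp σ) := by
  simp [push, Finsupp.mapDomain_single]

lemma push_push {n : ℕ} (g : C(Y, W)) (f : C(X, Y)) (c : Ch n X) :
    push g (push f c) = push (g.comp f) c := by
  refine LinearMap.congr_fun (f := push g ∘ₗ push f) (ch_hom_ext fun σ => ?_) c
  simp [ContinuousMap.comp_assoc]

lemma push_id {n : ℕ} (c : Ch n X) : push (ContinuousMap.id X) c = c := by
  refine LinearMap.congr_fun (g := LinearMap.id) (ch_hom_ext fun σ => ?_) c
  simp

lemma d_push {n : ℕ} (f : C(X, Y)) (c : Ch (n + 1) X) : d (push f c) = push f (d c) := by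
  refine LinearMap.congr_fun (f := d ∘ₗ push f) (g := push f ∘ₗ d) (ch_hom_ext fun σ => ?_) c
  simp [ContinuousMap.comp_assoc]

/-- Chains of simplices with image in `U`. -/
def S (n : ℕ) (U : Set X) : Submodule (ZMod 2) (Ch n X) :=
  Finsupp.supported (ZMod 2) (ZMod 2) {σ | ∀ t, σ t ∈ U}

lemma mem_S {n : ℕ} {U : Set X} {c : Ch n X} : c ∈ S n U ↔ ∀ σ ∈ c.support, ∀ t, σ t ∈ U := by
  rw [S, Finsupp.mem_supported]
  rfl

lemma gen_mem_S {n : ℕ} {U : Set X} {σ : Sing n X} (h : ∀ t, σ t ∈ U) : gen σ ∈ S n U :=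
  Finsupp.single_mem_supported _ _ h

lemma S_mono {n : ℕ} {U V : Set X} (h : U ⊆ V) : S n U ≤ S n V :=
  Finsupp.supported_mono fun _ hσ t => h (hσ t)

lemma S_univ {n : ℕ} (c : Ch n X) : c ∈ S n (Set.univ : Set X) := mem_S.2 fun _ _ _ => trivial

lemma S_induction {n : ℕ} {U : Set X} {p : Ch n X → Prop} {c : Ch n X} (hc : c ∈ S n U)
    (h0 : p 0) (hg : ∀ σ, (∀ t, σ t ∈ U) → p (gen σ))
    (ha : ∀ a b, p a → p b → p (a + b)) : p c := by
  have : c = ∑ σ ∈ c.support, gen σ := by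
    conv_lhs => rw [← Finsupp.sum_single c, Finsupp.sum]
    refine Finset.sum_congr rfl fun σ hσ => ?_
    have h : c σ ≠ 0 := by simpa using hσ
    have : c σ = 1 := by revert h; generalize c σ = r; revert r; decide
    rw [this]
  rw [this]
  exact Finset.sum_induction _ _ ha h0 fun σ hσ => hg σ (mem_S.1 hc σ hσ)

lemma S_le_comap {n : ℕ} {U : Set X} {M : Type} [AddCommMonoid M] [Module (ZMod 2) M]
    {f : Ch n X →ₗ[ZMod 2] M} {N : Submodule (ZMod 2) M}
    (h : ∀ σ, (∀ t, σ t ∈ U) → f (gen σ) ∈ N) {c : Ch n X} (hc : c ∈ S n U) : f c ∈ N := by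
  refine S_induction (p := fun c => f c ∈ N) hc (by simp) h fun a b ha hb => ?_
  rw [map_add]
  exact N.add_mem ha hb

lemma S_inter {n : ℕ} {U V : Set X} {c : Ch n X} (h : c ∈ S n U) (h' : c ∈ S n V) :
    c ∈ S n (U ∩ V) :=
  mem_S.2 fun σ hσ t => ⟨mem_S.1 h σ hσ t, mem_S.1 h' σ hσ t⟩

lemma d_mem_S {n : ℕ} {U : Set X} {c : Ch (n + 1) X} (h : c ∈ S (n + 1) U) : d c ∈ S n U := by
  refine S_le_comap (fun σ hσ => ?_) h
  rw [d_gen]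
  exact Submodule.sum_mem _ fun i _ => gen_mem_S fun t => hσ _

lemma push_mem_S {n : ℕ} {U : Set X} {V : Set Y} {f : C(X, Y)} (hf : ∀ x ∈ U, f x ∈ V)
    {c : Ch n X} (h : c ∈ S n U) : push f c ∈ S n V := by
  refine S_le_comap (fun σ hσ => ?_) h
  rw [push_gen]
  exact gen_mem_S fun t => hf _ (hσ t)

/-- A contraction of a space to a point. -/
structure Contr (X : Type) [TopologicalSpace X] where
  /-- the homotopy -/
  H : C(X × unitInterval, X)
  /-- the endpoint -/
  pt : X
  H_zero : ∀ x, H (x, 0) = x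
  H_one : ∀ x, H (x, 1) = pt

/-- The opposite face coordinates, normalized. -/
noncomputable def tailS {n : ℕ} (t : Simp (n + 1)) (h : t 0 < 1) : Simp n :=
  ⟨fun j => t j.succ / (1 - t 0), fun j => div_nonneg (t.2.1 _) (by linarith), by
    rw [← Finset.sum_div, div_eq_one_iff_eq (by linarith)]
    have := t.2.2
    rw [Fin.sum_univ_succ] at this
    exact eq_sub_of_add_eq' this⟩

lemma tailS_apply {n : ℕ} (t : Simp (n + 1)) (h : t 0 < 1) (j : Fin n) :
    tailS t h j = t j.succ / (1 - t 0) := rfl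

/-- The zeroth coordinate as a point of the unit interval. -/
noncomputable def hd {n : ℕ} (t : Simp (n + 1)) : unitInterval :=
  ⟨t 0, t.2.1 0, stdSimplex.le_one t 0⟩

lemma continuous_hd {n : ℕ} : Continuous (hd : Simp (n + 1) → unitInterval) :=
  Continuous.subtype_mk ((continuous_apply (0 : Fin (n + 1))).comp continuous_subtype_val) _

open Classical in
/-- The underlying function of the cone on a singular simplex. -/
noncomputable def coneFun (C : Contr X) {n : ℕ} (σ : Sing n X) (t : Simp (n + 1)) : X :=
  if h : t 0 < 1 then C.H (σ (tailS t h), hd t) else C.pt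

lemma continuous_coneFun (C : Contr X) {n : ℕ} (σ : Sing n X) : Continuous (coneFun C σ) := by
  have hc0 : Continuous fun t : Simp (n + 1) => t 0 :=
    (continuous_apply (0 : Fin (n + 1))).comp continuous_subtype_val
  have ho : IsOpen {t : Simp (n + 1) | t 0 < 1} := isOpen_lt hc0 continuous_const
  rw [continuous_iff_continuousAt]
  intro t
  by_cases ht : t 0 < 1
  · refine ContinuousOn.continuousAt (s := {t : Simp (n + 1) | t 0 < 1}) ?_ (ho.mem_nhds ht)
    rw [continuousOn_iff_continuous_domRestrict]
    have : Set.domRestrict {t : Simp (n + 1) | t 0 < 1} (coneFun C σ) =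
        fun t => C.H (σ (tailS t.1 t.2), hd t.1) := by
      ext t
      have := t.2
      simp only [Set.mem_ofPred_eq] at this
      simp [Set.domRestrict, coneFun, this]
    rw [this]
    refine C.H.continuous.comp (Continuous.prodMk (σ.continuous.comp ?_)
      (continuous_hd.comp continuous_subtype_val))
    refine Continuous.subtype_mk (continuous_pi fun j => ?_) _
    refine Continuous.div ?_ ?_ ?_
    · exact ((continuous_apply j.succ).comp continuous_subtype_val).comp continuous_subtype_val
    · exact continuous_const.sub (hc0.comp continuous_subtype_val)
    · intro t
      have := t.2
      simp only [Set.mem_ofPred_eq] at this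
      linarith
  · have h1 : t 0 = 1 := le_antisymm (stdSimplex.le_one t 0) (not_lt.1 ht)
    have hv : coneFun C σ t = C.pt := by simp [coneFun, ht]
    rw [ContinuousAt, hv]
    refine Filter.tendsto_def.2 fun U hU => ?_
    obtain ⟨O, hOU, hO, hpt⟩ := mem_nhds_iff.1 hU
    have hpre : IsOpen {p : Simp n × unitInterval | C.H (σ p.1, p.2) ∈ O} :=
      hO.preimage (C.H.continuous.comp (by fun_prop))
    obtain ⟨u, v, -, hv, hu1, hv1, huv⟩ := generalized_tube_lemma
      (s := (Set.univ : Set (Simp n))) isCompact_univ (t := {(1 : unitInterval)})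
      isCompact_singleton hpre (by
        rintro ⟨p, s⟩ ⟨-, hs⟩
        obtain rfl : s = 1 := hs
        change C.H (σ p, 1) ∈ O
        rwa [C.H_one])
    have hmem : hd t ∈ v := by
      have : hd t = 1 := Subtype.ext h1
      rw [this]
      exact hv1 rfl
    filter_upwards [continuous_hd.continuousAt.preimage_mem_nhds (hv.mem_nhds hmem)] with s hs
    refine hOU ?_
    by_cases hs1 : s 0 < 1
    · simp only [coneFun, hs1, dite_true]
      exact huv (Set.mk_mem_prod (hu1 trivial) hs)
    · simpa [coneFun, hs1] using hpt

/-- The cone on a singular simplex. -/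
noncomputable def coneS (C : Contr X) {n : ℕ} (σ : Sing n X) : Sing (n + 1) X :=
  ⟨coneFun C σ, continuous_coneFun C σ⟩

lemma coneS_apply (C : Contr X) {n : ℕ} (σ : Sing n X) (t : Simp (n + 1)) (h : t 0 < 1) :
    coneS C σ t = C.H (σ (tailS t h), hd t) := by
  change coneFun C σ t = _
  simp [coneFun, h]

lemma coneS_apply' (C : Contr X) {n : ℕ} (σ : Sing n X) (t : Simp (n + 1)) (h : ¬ t 0 < 1) :
    coneS C σ t = C.pt := by
  change coneFun C σ t = _
  simp [coneFun, h]

lemma coneS_face_zero (C : Contr X) {n : ℕ} (σ : Sing n X) : (coneS C σ).comp (face 0) = σ := by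
  ext t
  have h0 : (face 0 t) 0 = 0 := face_same 0 t
  have h : (face 0 t) 0 < 1 := by rw [h0]; norm_num
  rw [ContinuousMap.comp_apply, coneS_apply C σ _ h]
  have h1 : hd (face 0 t) = 0 := Subtype.ext h0
  have h2 : tailS (face 0 t) h = t := by
    refine Subtype.ext (funext fun j => ?_)
    change face 0 t j.succ / (1 - (face 0 t) 0) = t j
    rw [h0, ← Fin.succAbove_zero, face_succAbove]
    simp
  rw [h1, h2, C.H_zero]

lemma face_succ_zero {n : ℕ} (i : Fin (n + 1)) (t : Simp (n + 1)) :
    (face i.succ t) 0 = t 0 := by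
  have := face_succAbove i.succ t 0
  rwa [Fin.succ_succAbove_zero] at this

lemma coneS_face_succ (C : Contr X) {n : ℕ} (σ : Sing (n + 1) X) (i : Fin (n + 1)) :
    (coneS C σ).comp (face i.succ) = coneS C (σ.comp (face i)) := by
  ext t
  have h0 : (face i.succ t) 0 = t 0 := face_succ_zero i t
  by_cases h : t 0 < 1
  · have h' : (face i.succ t) 0 < 1 := by rwa [h0]
    rw [ContinuousMap.comp_apply, coneS_apply C σ _ h', coneS_apply C _ t h]
    have h1 : hd (face i.succ t) = hd t := Subtype.ext h0
    have h2 : tailS (face i.succ t) h' = face i (tailS t h) := by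
      refine simp_ext_succAbove i ?_ fun j => ?_
      · rw [tailS_apply, face_same, face_same]
        simp
      · rw [tailS_apply, face_succAbove, tailS_apply, h0, ← Fin.succ_succAbove_succ,
          face_succAbove]
    rw [h1, h2, ContinuousMap.comp_apply]
  · have hn : ¬ (face i.succ t) 0 < 1 := by rwa [h0]
    rw [ContinuousMap.comp_apply, coneS_apply' C σ _ hn, coneS_apply' C _ t h]

/-- The cone operator on chains. -/
noncomputable def cone (C : Contr X) {n : ℕ} : Ch n X →ₗ[ZMod 2] Ch (n + 1) X :=
  Finsupp.lmapDomain (ZMod 2) (ZMod 2) (coneS C)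

@[simp] lemma cone_gen (C : Contr X) {n : ℕ} (σ : Sing n X) :
    cone C (gen σ) = gen (coneS C σ) := by
  simp [cone, Finsupp.mapDomain_single]

lemma d_cone_zero (C : Contr X) (c : Ch 0 X) : d (cone C c) = c := by
  refine LinearMap.congr_fun (f := d ∘ₗ cone C) (g := LinearMap.id) (ch_hom_ext fun σ => ?_) c
  simp [coneS_face_zero]

lemma d_cone (C : Contr X) {n : ℕ} (c : Ch (n + 1) X) : d (cone C c) = c + cone C (d c) := by
  refine LinearMap.congr_fun (f := d ∘ₗ cone C) (g := LinearMap.id + cone C ∘ₗ d)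
    (ch_hom_ext fun σ => ?_) c
  simp only [LinearMap.comp_apply, cone_gen, d_gen, LinearMap.add_apply, LinearMap.id_apply,
    map_sum]
  rw [Fin.sum_univ_succ, coneS_face_zero]
  simp_rw [coneS_face_succ]

lemma cone_mem_S (C : Contr X) {n : ℕ} {U : Set X} (hU : ∀ x ∈ U, ∀ s, C.H (x, s) ∈ U)
    (hpt : C.pt ∈ U) {c : Ch n X} (hc : c ∈ S n U) : cone C c ∈ S (n + 1) U := by
  refine S_le_comap (fun σ hσ => ?_) hc
  rw [cone_gen]
  refine gen_mem_S fun t => ?_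
  by_cases h : t 0 < 1
  · rw [coneS_apply C σ t h]
    exact hU _ (hσ _) _
  · rwa [coneS_apply' C σ t h]

end SurfT3

namespace SurfT3

/-! ### Natural operators: barycentric subdivision and homotopies -/

variable {X Y W : Type} [TopologicalSpace X] [TopologicalSpace Y] [TopologicalSpace W]

/-- The natural operator on chains determined by a model chain. -/
noncomputable def act {k n : ℕ} (m : Ch k (Simp n)) : Ch n X →ₗ[ZMod 2] Ch k X :=
  Finsupp.linearCombination (ZMod 2) fun σ => push σ m

@[simp] lemma act_gen {k n : ℕ} (m : Ch k (Simp n)) (σ : Sing n X) :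
    act m (gen σ) = push σ m := by
  simp [act]

/-- The identity simplex. -/
noncomputable abbrev idS (n : ℕ) : Sing n (Simp n) := ContinuousMap.id _

lemma push_act {k n : ℕ} (f : C(X, Y)) (m : Ch k (Simp n)) (c : Ch n X) :
    push f (act m c) = act m (push f c) := by
  refine LinearMap.congr_fun (f := push f ∘ₗ act m) (g := act m ∘ₗ push f)
    (ch_hom_ext fun σ => ?_) c
  simp [push_push]

lemma act_mem_S {k n : ℕ} (m : Ch k (Simp n)) {U : Set X} {c : Ch n X} (h : c ∈ S n U) :
    act m c ∈ S k U := by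
  refine S_le_comap (fun σ hσ => ?_) h
  rw [act_gen]
  exact push_mem_S (U := Set.univ) (fun x _ => hσ x) (S_univ m)

lemma d_act {k n : ℕ} (m : Ch (k + 1) (Simp n)) (c : Ch n X) : d (act m c) = act (d m) c := by
  refine LinearMap.congr_fun (f := d ∘ₗ act m) (g := act (d m)) (ch_hom_ext fun σ => ?_) c
  simp [d_push]

lemma act_d {k n : ℕ} (m : Ch k (Simp n)) (c : Ch (n + 1) X) :
    act m (d c) = act (act m (d (gen (idS (n + 1))))) c := by
  refine LinearMap.congr_fun (f := act m ∘ₗ d) (ch_hom_ext fun σ => ?_) c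
  rw [LinearMap.comp_apply, act_gen, push_act, ← d_push, push_gen, ContinuousMap.comp_id]

lemma act_add {k n : ℕ} (m m' : Ch k (Simp n)) (c : Ch n X) :
    act (m + m') c = act m c + act m' c := by
  refine LinearMap.congr_fun (g := act m + act m') (ch_hom_ext fun σ => ?_) c
  simp

lemma act_id {n : ℕ} (c : Ch n X) : act (gen (idS n)) c = c := by
  refine LinearMap.congr_fun (g := LinearMap.id) (ch_hom_ext fun σ => ?_) c
  simp

/-- The straight-line contraction of a star-convex set. -/
noncomputable def starContr {V : Type} [AddCommGroup V] [Module ℝ V] [TopologicalSpace V]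
    [ContinuousAdd V] [ContinuousSMul ℝ V] {K : Set V} (b : K) (hK : StarConvex ℝ (b : V) K) :
    Contr K where
  H := ⟨fun p => ⟨(p.2 : ℝ) • (b : V) + (1 - (p.2 : ℝ)) • (p.1 : V),
      hK p.1.2 p.2.2.1 (by linarith [p.2.2.2]) (by ring)⟩, by fun_prop⟩
  pt := b
  H_zero x := by simp
  H_one x := by simp

lemma starContr_apply {V : Type} [AddCommGroup V] [Module ℝ V] [TopologicalSpace V]
    [ContinuousAdd V] [ContinuousSMul ℝ V] {K : Set V} (b : K) (hK : StarConvex ℝ (b : V) K)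
    (x : K) (s : unitInterval) :
    ((starContr b hK).H (x, s) : V) = (s : ℝ) • (b : V) + (1 - (s : ℝ)) • (x : V) := rfl

/-- Contraction of the simplex to its barycenter. -/
noncomputable def simpContr (n : ℕ) : Contr (Simp (n + 1)) :=
  starContr stdSimplex.barycenter ((convex_stdSimplex ℝ _).starConvex stdSimplex.barycenter.2)

/-- Model for the barycentric subdivision. -/
noncomputable def sdM : (n : ℕ) → Ch n (Simp n)
  | 0 => gen (idS 0)
  | n + 1 => cone (simpContr n) (act (sdM n) (d (gen (idS (n + 1)))))

lemma sdM_succ (n : ℕ) :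
    sdM (n + 1) = cone (simpContr n) (act (sdM n) (d (gen (idS (n + 1))))) := rfl

/-- Barycentric subdivision. -/
noncomputable def Sd {n : ℕ} : Ch n X →ₗ[ZMod 2] Ch n X := act (sdM n)

lemma push_Sd {n : ℕ} (f : C(X, Y)) (c : Ch n X) : push f (Sd c) = Sd (push f c) :=
  push_act f _ c

lemma Sd_mem_S {n : ℕ} {U : Set X} {c : Ch n X} (h : c ∈ S n U) : Sd c ∈ S n U := act_mem_S _ h

lemma Sd_zero (c : Ch 0 X) : Sd c = c := act_id c

lemma d_Sd {n : ℕ} (c : Ch (n + 1) X) : d (Sd c) = Sd (d c) := by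
  induction n generalizing X with
  | zero =>
    rw [Sd, d_act, Sd, act_d, sdM_succ, d_cone_zero]
  | succ n ih =>
    rw [Sd, d_act, Sd, act_d, sdM, d_cone]
    congr 2
    have h : act (sdM (n + 1)) (d (gen (idS (n + 2)))) = Sd (d (gen (idS (n + 2)))) := rfl
    rw [h, ih, d_d, map_zero, map_zero, add_zero]

/-- Model for the homotopy from the identity to the subdivision. -/
noncomputable def thM : (n : ℕ) → Ch (n + 1) (Simp n)
  | 0 => 0
  | n + 1 => cone (simpContr n)
      (gen (idS (n + 1)) + sdM (n + 1) + act (thM n) (d (gen (idS (n + 1)))))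

/-- Homotopy from the identity to the subdivision. -/
noncomputable def Th {n : ℕ} : Ch n X →ₗ[ZMod 2] Ch (n + 1) X := act (thM n)

lemma Th_mem_S {n : ℕ} {U : Set X} {c : Ch n X} (h : c ∈ S n U) : Th c ∈ S (n + 1) U :=
  act_mem_S _ h

lemma Th_zero (c : Ch 0 X) : Th c = 0 := by
  refine LinearMap.congr_fun (f := Th) (g := 0) (ch_hom_ext fun σ => ?_) c
  rw [Th, act_gen, thM, map_zero, LinearMap.zero_apply]

lemma sdM_eq_Sd (n : ℕ) : sdM n = Sd (gen (idS n)) := by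
  rw [Sd, act_gen, push_id]

lemma d_Th {n : ℕ} (c : Ch (n + 1) X) : d (Th c) = c + Sd c + Th (d c) := by
  induction n generalizing X with
  | zero =>
    have h0 : ∀ c : Ch 0 (Simp 1), act (thM 0) c = 0 := fun c => Th_zero c
    rw [Th_zero, add_zero, Th, d_act, thM, h0, add_zero, d_cone, map_add, sdM_eq_Sd, d_Sd,
      Sd_zero, add_self_eq, map_zero, add_zero, act_add, act_id, ← sdM_eq_Sd]
    rfl
  | succ n ih =>
    have h (c : Ch (n + 1) (Simp (n + 2))) : act (thM (n + 1)) c = Th c := rfl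
    rw [Th, d_act, thM, d_cone, map_add, map_add, map_add, h, ih, sdM_eq_Sd, d_Sd, d_d, map_zero,
      add_zero, ← map_add (cone _), add_self_eq, map_zero, add_zero, act_add, act_add, act_id,
      ← sdM_eq_Sd,
      show Th (d c) = act (thM (n + 1)) (d c) from rfl, act_d]
    rfl

lemma iter_Sd_mem_S {n : ℕ} {U : Set X} {c : Ch n X} (m : ℕ) (h : c ∈ S n U) :
    Sd^[m] c ∈ S n U := by
  induction m with
  | zero => exact h
  | succ m ih => rw [Function.iterate_succ_apply']; exact Sd_mem_S ih

lemma push_iter_Sd {n : ℕ} (f : C(X, Y)) (m : ℕ) (c : Ch n X) :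
    push f (Sd^[m] c) = Sd^[m] (push f c) := by
  induction m with
  | zero => rfl
  | succ m ih => rw [Function.iterate_succ_apply', push_Sd, ih, ← Function.iterate_succ_apply' Sd]

lemma d_iter_Sd {n : ℕ} (m : ℕ) (c : Ch (n + 1) X) : d (Sd^[m] c) = Sd^[m] (d c) := by
  induction m with
  | zero => rfl
  | succ m ih => rw [Function.iterate_succ_apply', d_Sd, ih, ← Function.iterate_succ_apply' Sd]

lemma iter_Sd_add {n : ℕ} (m : ℕ) (c c' : Ch n X) :
    Sd^[m] (c + c') = Sd^[m] c + Sd^[m] c' :=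
  iterate_map_add Sd m c c'

lemma iter_Sd_zero {n : ℕ} (m : ℕ) : Sd^[m] (0 : Ch n X) = 0 :=
  iterate_map_zero Sd m

/-- Homotopy from the identity to an iterated subdivision. -/
noncomputable def ThI {n : ℕ} (m : ℕ) (c : Ch n X) : Ch (n + 1) X :=
  ∑ k ∈ Finset.range m, Th (Sd^[k] c)

lemma ThI_mem_S {n : ℕ} {U : Set X} {c : Ch n X} (m : ℕ) (h : c ∈ S n U) :
    ThI m c ∈ S (n + 1) U :=
  Submodule.sum_mem _ fun k _ => Th_mem_S (iter_Sd_mem_S k h)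

lemma d_ThI {n : ℕ} (m : ℕ) (c : Ch (n + 1) X) :
    d (ThI m c) = c + Sd^[m] c + ThI m (d c) := by
  induction m with
  | zero => simp [ThI, add_self_eq]
  | succ m ih =>
    rw [ThI, Finset.sum_range_succ, map_add, ← ThI, ih, ThI, ThI, Finset.sum_range_succ, d_Th,
      d_iter_Sd, Function.iterate_succ_apply']
    refine of_one_smul ?_
    match_scalars <;> decide

/-- Product of contractions. -/
noncomputable def Contr.prodC (C : Contr X) (D : Contr Y) : Contr (X × Y) where
  H := ⟨fun p => (C.H (p.1.1, p.2), D.H (p.1.2, p.2)), by fun_prop⟩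
  pt := (C.pt, D.pt)
  H_zero x := by simp [C.H_zero, D.H_zero]
  H_one x := by simp [C.H_one, D.H_one]

/-- Contraction of the unit interval. -/
noncomputable def intervalContr : Contr unitInterval :=
  starContr (0 : unitInterval) ((convex_Icc (0 : ℝ) 1).starConvex (0 : unitInterval).2)

/-- Inclusion at a fixed time. -/
def atTime (s : unitInterval) : C(X, X × unitInterval) := ⟨fun x => (x, s), by fun_prop⟩

/-- The product of a map with the unit interval. -/
def timesI (f : C(X, Y)) : C(X × unitInterval, Y × unitInterval) :=
  ⟨fun p => (f p.1, p.2), by fun_prop⟩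

/-- The prism operator determined by a model. -/
noncomputable def actI {k n : ℕ} (m : Ch k (Simp n × unitInterval)) :
    Ch n X →ₗ[ZMod 2] Ch k (X × unitInterval) :=
  Finsupp.linearCombination (ZMod 2) fun σ => push (timesI σ) m

@[simp] lemma actI_gen {k n : ℕ} (m : Ch k (Simp n × unitInterval)) (σ : Sing n X) :
    actI m (gen σ) = push (timesI σ) m := by
  simp [actI]

lemma push_actI {k n : ℕ} (f : C(X, Y)) (m : Ch k (Simp n × unitInterval)) (c : Ch n X) :
    push (timesI f) (actI m c) = actI m (push f c) := by
  refine LinearMap.congr_fun (f := push (timesI f) ∘ₗ actI m) (g := actI m ∘ₗ push f)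
    (ch_hom_ext fun σ => ?_) c
  simp [push_push]
  rfl

lemma actI_d {k n : ℕ} (m : Ch k (Simp n × unitInterval)) (c : Ch (n + 1) X) :
    actI m (d c) = actI (actI m (d (gen (idS (n + 1))))) c := by
  refine LinearMap.congr_fun (f := actI m ∘ₗ d) (ch_hom_ext fun σ => ?_) c
  rw [LinearMap.comp_apply, actI_gen, push_actI, ← d_push, push_gen, ContinuousMap.comp_id]

lemma d_actI {k n : ℕ} (m : Ch (k + 1) (Simp n × unitInterval)) (c : Ch n X) :
    d (actI m c) = actI (d m) c := by
  refine LinearMap.congr_fun (f := d ∘ₗ actI m) (g := actI (d m)) (ch_hom_ext fun σ => ?_) c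
  simp [d_push]

lemma actI_add {k n : ℕ} (m m' : Ch k (Simp n × unitInterval)) (c : Ch n X) :
    actI (m + m') c = actI m c + actI m' c := by
  refine LinearMap.congr_fun (g := actI m + actI m') (ch_hom_ext fun σ => ?_) c
  simp

lemma actI_atTime {n : ℕ} (s : unitInterval) (c : Ch n X) :
    actI (gen (atTime s)) c = push (atTime s) c := by
  refine LinearMap.congr_fun (ch_hom_ext fun σ => ?_) c
  simp only [actI_gen, push_gen]
  rfl

/-- Model prism. -/
noncomputable def prM : (n : ℕ) → Ch (n + 1) (Simp n × unitInterval)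
  | 0 => 0
  | n + 1 => cone ((simpContr n).prodC intervalContr)
      (gen (atTime 0) + gen (atTime 1) + actI (prM n) (d (gen (idS (n + 1)))))

lemma actI_prM_zero (c : Ch 0 X) : actI (prM 0) c = 0 := by
  refine LinearMap.congr_fun (f := actI (prM 0)) (g := 0) (ch_hom_ext fun σ => ?_) c
  rw [actI_gen, prM, map_zero, LinearMap.zero_apply]

lemma push_zero_eq (f g : C(X, Y)) (c : Ch 0 X) : push f c = push g c := by
  refine LinearMap.congr_fun (ch_hom_ext fun σ => ?_) c
  rw [push_gen, push_gen]
  exact congrArg gen (Subsingleton.elim _ _)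

lemma gen_atTime_eq {n : ℕ} (s : unitInterval) :
    gen (atTime s : Sing n (Simp n × unitInterval)) = push (atTime s) (gen (idS n)) := by
  rw [push_gen, ContinuousMap.comp_id]

lemma d_prism {n : ℕ} (c : Ch (n + 1) X) :
    d (actI (prM (n + 1)) c) =
      push (atTime 0) c + push (atTime 1) c + actI (prM n) (d c) := by
  induction n generalizing X with
  | zero =>
    rw [actI_prM_zero, add_zero, d_actI, prM, actI_prM_zero, add_zero, d_cone, map_add,
      gen_atTime_eq, gen_atTime_eq, d_push, d_push, push_zero_eq (atTime 0) (atTime 1),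
      add_self_eq, map_zero, add_zero, actI_add, ← gen_atTime_eq, ← gen_atTime_eq,
      actI_atTime, actI_atTime]
  | succ n ih =>
    rw [d_actI, prM, d_cone, map_add, map_add, map_add, ih, d_d, map_zero, add_zero, gen_atTime_eq,
      gen_atTime_eq, d_push, d_push, ← map_add (cone _), add_self_eq, map_zero, add_zero,
      actI_add, actI_add,
      ← gen_atTime_eq, ← gen_atTime_eq, actI_atTime, actI_atTime, ← actI_d]

/-- The chain homotopy induced by a homotopy. -/
noncomputable def htpy {n : ℕ} (F : C(X × unitInterval, Y)) (c : Ch n X) : Ch (n + 1) Y :=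
  push F (actI (prM n) c)

lemma d_htpy {n : ℕ} (F : C(X × unitInterval, Y)) (c : Ch (n + 1) X) :
    d (htpy F c) = push (F.comp (atTime 0)) c + push (F.comp (atTime 1)) c + htpy F (d c) := by
  rw [htpy, d_push, d_prism, map_add, map_add, push_push, push_push, htpy]

lemma htpy_mem_S {n : ℕ} {F : C(X × unitInterval, Y)} {U : Set X} {V : Set Y}
    (hF : ∀ x ∈ U, ∀ s, F (x, s) ∈ V) {c : Ch n X} (hc : c ∈ S n U) :
    htpy F c ∈ S (n + 1) V := by
  have : actI (prM n) c ∈ S (n + 1) (U ×ˢ (Set.univ : Set unitInterval)) := by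
    refine S_le_comap (fun σ hσ => ?_) hc
    rw [actI_gen]
    exact push_mem_S (U := Set.univ) (fun x _ => (⟨hσ x.1, trivial⟩ : _ ∧ _)) (S_univ _)
  exact push_mem_S (fun x hx => hF x.1 hx.1 x.2) this

end SurfT3

namespace SurfT3

/-! ### Mesh of the barycentric subdivision -/

variable {X Y W : Type} [TopologicalSpace X] [TopologicalSpace Y] [TopologicalSpace W]

/-- Chains all of whose simplices satisfy `P`. -/
abbrev SP (n : ℕ) (P : Set (Sing n X)) : Submodule (ZMod 2) (Ch n X) :=
  Finsupp.supported (ZMod 2) (ZMod 2) P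

lemma SP_induction {n : ℕ} {P : Set (Sing n X)} {p : Ch n X → Prop} {c : Ch n X}
    (hc : c ∈ SP n P) (h0 : p 0) (hg : ∀ σ ∈ P, p (gen σ))
    (ha : ∀ a b, p a → p b → p (a + b)) : p c := by
  have : c = ∑ σ ∈ c.support, gen σ := by
    conv_lhs => rw [← Finsupp.sum_single c, Finsupp.sum]
    refine Finset.sum_congr rfl fun σ hσ => ?_
    have h : c σ ≠ 0 := by simpa using hσ
    have : c σ = 1 := by revert h; generalize c σ = r; revert r; decide
    rw [this]
  rw [this]
  exact Finset.sum_induction _ _ ha h0 fun σ hσ => hg σ ((Finsupp.mem_supported _ _).1 hc hσ)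

lemma SP_le_comap {n : ℕ} {P : Set (Sing n X)} {M : Type} [AddCommMonoid M] [Module (ZMod 2) M]
    {f : Ch n X →ₗ[ZMod 2] M} {N : Submodule (ZMod 2) M}
    (h : ∀ σ ∈ P, f (gen σ) ∈ N) {c : Ch n X} (hc : c ∈ SP n P) : f c ∈ N := by
  refine SP_induction (p := fun c => f c ∈ N) hc (by simp) h fun a b ha hb => ?_
  rw [map_add]
  exact N.add_mem ha hb

lemma gen_mem_SP {n : ℕ} {P : Set (Sing n X)} {σ : Sing n X} (h : σ ∈ P) : gen σ ∈ SP n P :=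
  Finsupp.single_mem_supported _ _ h

section Affine

variable {F : Type} [NormedAddCommGroup F] [NormedSpace ℝ F]

/-- Affine maps on the simplex. -/
def IsAff {n : ℕ} (σ : Simp n → F) : Prop := ∀ t, σ t = ∑ i, t i • σ (stdSimplex.vertex i)

lemma IsAff.norm_sub_le {n : ℕ} {σ : Simp n → F} (h : IsAff σ) {x : F} {r : ℝ}
    (hr : ∀ i, ‖σ (stdSimplex.vertex i) - x‖ ≤ r) (t : Simp n) : ‖σ t - x‖ ≤ r := by
  have h1 : σ t - x = ∑ i, t i • (σ (stdSimplex.vertex i) - x) := by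
    simp_rw [smul_sub]
    rw [Finset.sum_sub_distrib, ← Finset.sum_smul, stdSimplex.sum_eq_one, one_smul, ← h t]
  rw [h1]
  calc ‖∑ i, t i • (σ (stdSimplex.vertex i) - x)‖
      ≤ ∑ i, ‖t i • (σ (stdSimplex.vertex i) - x)‖ := norm_sum_le _ _
    _ ≤ ∑ i, t i * r := by
        refine Finset.sum_le_sum fun i _ => ?_
        rw [norm_smul, Real.norm_of_nonneg (stdSimplex.zero_le t i)]
        exact mul_le_mul_of_nonneg_left (hr i) (stdSimplex.zero_le t i)
    _ = r := by rw [← Finset.sum_mul, stdSimplex.sum_eq_one, one_mul]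

lemma IsAff.diam {n : ℕ} {σ : Simp n → F} (h : IsAff σ) {r : ℝ}
    (hr : ∀ i j, ‖σ (stdSimplex.vertex i) - σ (stdSimplex.vertex j)‖ ≤ r) (s t : Simp n) :
    ‖σ s - σ t‖ ≤ r := by
  refine h.norm_sub_le (fun i => ?_) s
  rw [norm_sub_rev]
  exact h.norm_sub_le (fun j => hr j i) t

lemma isAff_face {n : ℕ} {σ : Simp (n + 1) → F} (h : IsAff σ) (i : Fin (n + 1)) :
    IsAff fun t => σ (face i t) := by
  have hv : ∀ j, face i (stdSimplex.vertex j) = stdSimplex.vertex (S := ℝ) (i.succAbove j) := by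
    intro j
    refine simp_ext_succAbove i ?_ fun k => ?_
    · rw [face_same]
      simp [DFunLike.coe, Fin.ne_succAbove]
    · rw [face_succAbove]
      simp [DFunLike.coe, Pi.single_apply]
  intro t
  change σ (face i t) = _
  rw [h, Fin.sum_univ_succAbove _ i]
  simp [hv]

lemma IsAff.combo {n : ℕ} {σ : Simp n → F} (h : IsAff σ) {x y z : Simp n} {a b : ℝ}
    (hz : ∀ i, z i = a * x i + b * y i) : σ z = a • σ x + b • σ y := by
  rw [h z, h x, h y, Finset.smul_sum, Finset.smul_sum, ← Finset.sum_add_distrib]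
  refine Finset.sum_congr rfl fun i _ => ?_
  rw [hz, add_smul, mul_smul, mul_smul]

/-- The mesh-shrinking property of a model simplex. -/
def Shrinks {n : ℕ} (r : ℝ) (τ : Simp n → Simp n) : Prop :=
  ∀ (F : Type) [NormedAddCommGroup F] [NormedSpace ℝ F] (σ : Simp n → F) (M : ℝ), IsAff σ →
    (∀ s t, ‖σ s - σ t‖ ≤ M) → IsAff (σ ∘ τ) ∧ ∀ s t, ‖σ (τ s) - σ (τ t)‖ ≤ r * M

lemma simpContr_apply {n : ℕ} (x : Simp (n + 1)) (s : unitInterval) (i : Fin (n + 1)) :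
    ((simpContr n).H (x, s)) i =
      (s : ℝ) * (stdSimplex.barycenter (𝕜 := ℝ) (X := Fin (n + 1))) i + (1 - (s : ℝ)) * x i := by
  exact congrFun (starContr_apply _ _ x s) i

lemma bary_bound {n : ℕ} {σ : Simp (n + 1) → F} {M : ℝ} (h : IsAff σ)
    (hM : ∀ s t, ‖σ s - σ t‖ ≤ M) (x : Simp (n + 1)) :
    ‖σ x - σ stdSimplex.barycenter‖ ≤ (n / (n + 1) : ℝ) * M := by
  refine h.norm_sub_le (fun j => ?_) x
  rw [norm_sub_rev]
  have h1 : σ stdSimplex.barycenter - σ (stdSimplex.vertex j) =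
      ∑ i, (1 / (n + 1) : ℝ) • (σ (stdSimplex.vertex i) - σ (stdSimplex.vertex j)) := by
    rw [← Finset.smul_sum, Finset.sum_sub_distrib, h stdSimplex.barycenter]
    have hb (i : Fin (n + 1)) :
        (stdSimplex.barycenter (𝕜 := ℝ) (X := Fin (n + 1))) i = (1 / (n + 1) : ℝ) := by
      refine (stdSimplex.barycenter_apply i).trans ?_
      simp
    simp only [hb, Fintype.card_fin, Finset.sum_const, Finset.card_univ]
    rw [← Finset.smul_sum, smul_sub, ← Nat.cast_smul_eq_nsmul ℝ, smul_smul]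
    have : (1 / (n + 1) : ℝ) * ((n + 1 : ℕ) : ℝ) = 1 := by push_cast; field_simp
    rw [this, one_smul]
  rw [h1, ← Finset.smul_sum, norm_smul, Fin.sum_univ_succAbove _ j, sub_self, zero_add]
  have h2 : ‖∑ i : Fin n, (σ (stdSimplex.vertex (j.succAbove i)) - σ (stdSimplex.vertex j))‖ ≤
      n * M := by
    refine (norm_sum_le _ _).trans ((Finset.sum_le_sum fun i _ => hM _ _).trans ?_)
    simp
  calc ‖(1 / (n + 1) : ℝ)‖ * _ ≤ ‖(1 / (n + 1) : ℝ)‖ * (n * M) :=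
        mul_le_mul_of_nonneg_left h2 (norm_nonneg _)
    _ = _ := by
        rw [Real.norm_of_nonneg (by positivity)]
        ring

lemma sdM_shrinks (n : ℕ) : sdM n ∈ SP n {τ | Shrinks (n / (n + 1)) τ} := by
  induction n with
  | zero =>
    refine gen_mem_SP ?_
    intro F _ _ σ M _ hM
    exact ⟨fun t => isEmptyElim t, fun t => isEmptyElim t⟩
  | succ n ih =>
    rw [sdM_succ, d_gen, map_sum, map_sum]
    refine Submodule.sum_mem _ fun i _ => ?_
    rw [act_gen, ContinuousMap.id_comp]
    refine SP_le_comap (f := cone (simpContr n) ∘ₗ push (face i)) (fun τ hτ => ?_) ih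
    rw [LinearMap.comp_apply, push_gen, cone_gen]
    refine gen_mem_SP ?_
    intro F _ _ σ M hσ hM
    have hM0 : 0 ≤ M := (norm_nonneg _).trans (hM (stdSimplex.vertex 0) (stdSimplex.vertex 0))
    set ρ : Sing n (Simp (n + 1)) := (face i).comp τ with hρ
    obtain ⟨hρ1, hρ2⟩ := hτ F (fun t => σ (face i t)) M (isAff_face hσ i) fun s t => hM _ _
    have hlt {t : Simp (n + 1)} (h : t 0 < 1) :
        σ (coneS (simpContr n) ρ t) =
          t 0 • σ stdSimplex.barycenter + (1 - t 0) • σ (ρ (tailS t h)) := by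
      refine hσ.combo fun j => ?_
      rw [coneS_apply _ _ _ h, simpContr_apply]
      rfl
    have hge {t : Simp (n + 1)} (h : ¬ t 0 < 1) :
        σ (coneS (simpContr n) ρ t) = σ stdSimplex.barycenter := by
      rw [coneS_apply' _ _ _ h]
      rfl
    have hv0 : σ (coneS (simpContr n) ρ (stdSimplex.vertex 0)) = σ stdSimplex.barycenter := by
      refine hge ?_
      simp [DFunLike.coe]
    have hvs (j : Fin n) : σ (coneS (simpContr n) ρ (stdSimplex.vertex j.succ)) =
        σ (ρ (stdSimplex.vertex j)) := by
      have h0 : (stdSimplex.vertex (S := ℝ) j.succ) (0 : Fin (n + 1)) = 0 := by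
        simp [DFunLike.coe]
      have h1 : (stdSimplex.vertex (S := ℝ) j.succ) (0 : Fin (n + 1)) < 1 := by
        rw [h0]; norm_num
      have h2 : tailS (stdSimplex.vertex j.succ) h1 = stdSimplex.vertex j := by
        refine Subtype.ext (funext fun k => ?_)
        change (stdSimplex.vertex (S := ℝ) j.succ) k.succ /
          (1 - (stdSimplex.vertex (S := ℝ) j.succ) 0) = _
        rw [h0]
        simp [DFunLike.coe, Pi.single_apply]
      rw [hlt h1, h0, h2]
      simp
    have hA : IsAff (σ ∘ coneS (simpContr n) ρ) := by
      intro t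
      rw [Fin.sum_univ_succ]
      simp only [Function.comp_apply, hv0, hvs]
      by_cases h : t 0 < 1
      · rw [hlt h]
        congr 1
        have := hρ1 (tailS t h)
        simp only [Function.comp_apply] at this
        rw [hρ]
        simp only [ContinuousMap.comp_apply]
        rw [this, Finset.smul_sum]
        refine Finset.sum_congr rfl fun j _ => ?_
        rw [smul_smul, tailS_apply, mul_div_cancel₀ _ (by linarith)]
      · have h1 : t 0 = 1 := le_antisymm (stdSimplex.le_one t 0) (not_lt.1 h)
        rw [hge h, h1, one_smul]
        have h2 := stdSimplex.sum_eq_one t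
        rw [Fin.sum_univ_succ, h1] at h2
        have h3 : ∑ j : Fin n, t j.succ = 0 := by linarith
        rw [Finset.sum_eq_zero_iff_of_nonneg fun j _ => stdSimplex.zero_le t _] at h3
        rw [Finset.sum_eq_zero, add_zero]
        intro j hj
        rw [h3 j hj, zero_smul]
    refine ⟨hA, hA.diam ?_⟩
    have hn : (n / (n + 1) : ℝ) * M ≤ ((n + 1 : ℕ) / ((n + 1 : ℕ) + 1) : ℝ) * M := by
      refine mul_le_mul_of_nonneg_right ?_ hM0
      push_cast
      rw [div_le_div_iff₀ (by positivity) (by positivity)]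
      nlinarith
    intro a b
    refine Fin.cases ?_ (fun a => ?_) a <;> refine Fin.cases ?_ (fun b => ?_) b <;>
      simp only [Function.comp_apply, hv0, hvs] <;> refine le_trans ?_ hn
    · simp
      positivity
    · rw [norm_sub_rev]
      exact bary_bound hσ hM _
    · exact bary_bound hσ hM _
    · exact hρ2 _ _

end Affine

end SurfT3

namespace SurfT3

/-! ### Small chains -/

variable {X Y W : Type} [TopologicalSpace X] [TopologicalSpace Y] [TopologicalSpace W]

lemma SP_mono {n : ℕ} {P Q : Set (Sing n X)} (h : P ⊆ Q) : SP n P ≤ SP n Q :=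
  Finsupp.supported_mono h

lemma push_mem_SP {n : ℕ} {f : C(X, Y)} {P : Set (Sing n X)} {Q : Set (Sing n Y)}
    (h : ∀ σ ∈ P, f.comp σ ∈ Q) {c : Ch n X} (hc : c ∈ SP n P) : push f c ∈ SP n Q := by
  refine SP_le_comap (fun σ hσ => ?_) hc
  rw [push_gen]
  exact gen_mem_SP (h σ hσ)

lemma mem_SP_of_push {n : ℕ} {f : C(X, Y)} (hf : Function.Injective f) {Q : Set (Sing n Y)}
    {c : Ch n X} (hc : push f c ∈ SP n Q) : c ∈ SP n {σ | f.comp σ ∈ Q} := by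
  rw [Finsupp.mem_supported] at hc ⊢
  intro σ hσ
  refine hc ?_
  have hinj : Function.Injective fun σ : Sing n X => f.comp σ :=
    fun a b hab => ContinuousMap.ext fun t => hf (DFunLike.congr_fun hab t)
  change f.comp σ ∈ ((Finsupp.mapDomain (fun σ : Sing n X => f.comp σ) c).support : Set _)
  rw [Finset.mem_coe, Finsupp.mem_support_iff, Finsupp.mapDomain_apply hinj]
  simpa using hσ

lemma Sd_gen {n : ℕ} (σ : Sing n X) : Sd (gen σ) = push σ (sdM n) := act_gen _ _

lemma iter_Sd_gen {n : ℕ} (m : ℕ) (σ : Sing n X) :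
    Sd^[m] (gen σ) = push σ (Sd^[m] (gen (idS n))) := by
  rw [push_iter_Sd, push_gen, ContinuousMap.comp_id]

lemma iter_small {n : ℕ} {F : Type} [NormedAddCommGroup F] [NormedSpace ℝ F] (σ : Sing n F)
    {M : ℝ} (h : IsAff σ) (hM : ∀ s t, ‖σ s - σ t‖ ≤ M) (m : ℕ) :
    Sd^[m] (gen σ) ∈ SP n {τ | IsAff τ ∧ ∀ s t, ‖τ s - τ t‖ ≤ (n / (n + 1) : ℝ) ^ m * M} := by
  induction m with
  | zero => exact gen_mem_SP ⟨h, by simpa using hM⟩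
  | succ m ih =>
    rw [Function.iterate_succ_apply']
    refine SP_le_comap (fun τ hτ => ?_) ih
    rw [Sd_gen]
    refine push_mem_SP (fun ρ hρ => ?_) (sdM_shrinks n)
    have := hρ F τ _ hτ.1 hτ.2
    refine ⟨this.1, fun s t => ?_⟩
    rw [pow_succ', mul_assoc]
    exact this.2 s t

/-- The inclusion of the simplex in its ambient space. -/
def simpVal (n : ℕ) : C(Simp n, Fin n → ℝ) := ⟨Subtype.val, continuous_subtype_val⟩

lemma model_small (n : ℕ) {ε : ℝ} (hε : 0 < ε) :
    ∃ m₀, ∀ m ≥ m₀, Sd^[m] (gen (idS n)) ∈ SP n {τ | ∀ s t, dist (τ s) (τ t) < ε} := by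
  have h1 : IsAff (simpVal n) := by
    intro t
    ext j
    simp only [Finset.sum_apply, Pi.smul_apply, smul_eq_mul]
    change t j = ∑ i, t i * (Pi.single i (1 : ℝ) : Fin n → ℝ) j
    simp [Pi.single_apply]
  have h2 : ∀ s t, ‖simpVal n s - simpVal n t‖ ≤ 1 := by
    intro s t
    refine (pi_norm_le_iff_of_nonneg zero_le_one).2 fun i => ?_
    change |s i - t i| ≤ 1
    have a1 := stdSimplex.zero_le s i
    have a2 := stdSimplex.zero_le t i
    have a3 := stdSimplex.le_one s i
    have a4 := stdSimplex.le_one t i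
    rw [abs_le]
    constructor <;> linarith
  have hr0 : (0 : ℝ) ≤ n / (n + 1) := by positivity
  have hr1 : (n / (n + 1) : ℝ) < 1 := by rw [div_lt_one (by positivity)]; linarith
  obtain ⟨m₀, hm₀⟩ := exists_pow_lt_of_lt_one hε hr1
  refine ⟨m₀, fun m hm => ?_⟩
  have := iter_small (simpVal n) h1 h2 m
  rw [iter_Sd_gen] at this
  refine SP_mono ?_ (mem_SP_of_push (f := simpVal n) Subtype.val_injective this)
  rintro τ ⟨-, hτ⟩ s t
  have := hτ s t
  rw [mul_one] at this
  rw [Subtype.dist_eq, dist_eq_norm]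
  exact this.trans_lt ((pow_le_pow_of_le_one hr0 hr1.le hm).trans_lt hm₀)

/-- Sufficiently fine subdivisions are subordinate to an open cover. -/
lemma exists_iter_Sd_small {n : ℕ} {ι : Type*} {V : Set X} {𝒰 : ι → Set X}
    (ho : ∀ i, IsOpen (𝒰 i)) (hV : ∀ x ∈ V, ∃ i, x ∈ 𝒰 i) {c : Ch (n + 1) X}
    (hc : c ∈ S (n + 1) V) :
    ∃ m₀, ∀ m ≥ m₀, Sd^[m] c ∈ SP (n + 1) {τ | ∃ i, ∀ t, τ t ∈ 𝒰 i} := by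
  refine S_induction (p := fun c => ∃ m₀, ∀ m ≥ m₀,
    Sd^[m] c ∈ SP (n + 1) {τ | ∃ i, ∀ t, τ t ∈ 𝒰 i}) hc ?_ ?_ ?_
  · exact ⟨0, fun m _ => by rw [iter_Sd_zero]; exact Submodule.zero_mem _⟩
  · intro σ hσ
    obtain ⟨δ, hδ, h⟩ := lebesgue_number_lemma_of_metric (s := (Set.univ : Set (Simp (n + 1))))
      (c := fun i => σ ⁻¹' 𝒰 i) isCompact_univ (fun i => (ho i).preimage σ.continuous)
      (fun t _ => Set.mem_iUnion.2 (hV _ (hσ t)))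
    obtain ⟨m₀, hm₀⟩ := model_small (n + 1) hδ
    refine ⟨m₀, fun m hm => ?_⟩
    rw [iter_Sd_gen]
    refine push_mem_SP (fun τ hτ => ?_) (hm₀ m hm)
    obtain ⟨i, hi⟩ := h (τ (stdSimplex.vertex 0)) trivial
    exact ⟨i, fun t => hi (hτ _ _)⟩
  · rintro a b ⟨m, hm⟩ ⟨m', hm'⟩
    refine ⟨max m m', fun k hk => ?_⟩
    rw [iter_Sd_add]
    exact Submodule.add_mem _ (hm k (le_trans (le_max_left _ _) hk))
      (hm' k (le_trans (le_max_right _ _) hk))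

lemma exists_split {n : ℕ} {P Q : Set (Sing n X)} {c : Ch n X} (hc : c ∈ SP n (P ∪ Q)) :
    ∃ a b, c = a + b ∧ a ∈ SP n P ∧ b ∈ SP n Q := by
  rw [SP, Finsupp.supported_union, Submodule.mem_sup] at hc
  obtain ⟨a, ha, b, hb, h⟩ := hc
  exact ⟨a, b, h.symm, ha, hb⟩

/-- Splitting a fine subdivision along two open sets. -/
lemma exists_iter_Sd_split {n : ℕ} {U V : Set X} (hU : IsOpen U) (hV : IsOpen V)
    {c : Ch (n + 1) X} (hc : c ∈ S (n + 1) (U ∪ V)) :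
    ∃ m₀, ∀ m ≥ m₀, ∃ a b, Sd^[m] c = a + b ∧ a ∈ S (n + 1) U ∧ b ∈ S (n + 1) V := by
  obtain ⟨m₀, h⟩ := exists_iter_Sd_small (𝒰 := fun i : Bool => cond i U V)
    (by rintro (_ | _) <;> assumption)
    (by rintro x (hx | hx); exacts [⟨true, hx⟩, ⟨false, hx⟩]) hc
  refine ⟨m₀, fun m hm => exists_split (SP_mono ?_ (h m hm))⟩
  rintro σ ⟨_ | _, hσ⟩
  exacts [Or.inr hσ, Or.inl hσ]

end SurfT3

namespace SurfT3

/-! ### Mayer–Vietoris and local homology -/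

variable {X Y W : Type} [TopologicalSpace X] [TopologicalSpace Y] [TopologicalSpace W]

/-- Cycles of `X` relative to the complement of `A`. -/
def Rel {n : ℕ} (A : Set X) (c : Ch (n + 1) X) : Prop := d c ∈ S n Aᶜ

/-- Chains that are boundaries relative to the complement of `A`. -/
def Null {n : ℕ} (A : Set X) (c : Ch (n + 1) X) : Prop :=
  ∃ e : Ch (n + 2) X, c + d e ∈ S (n + 1) Aᶜ

variable {n : ℕ} {A B : Set X} {c c' : Ch (n + 1) X}

lemma Rel.add (h : Rel A c) (h' : Rel A c') : Rel A (c + c') := by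
  rw [Rel, map_add]
  exact Submodule.add_mem _ h h'

lemma Null.add (h : Null A c) (h' : Null A c') : Null A (c + c') := by
  obtain ⟨e, he⟩ := h
  obtain ⟨e', he'⟩ := h'
  refine ⟨e + e', ?_⟩
  rw [map_add, add_add_add_comm]
  exact Submodule.add_mem _ he he'

lemma Null.congr (h : Null A (c + c')) (h' : Null A c') : Null A c := by
  have := h.add h'
  rwa [add_assoc, add_self_eq, add_zero] at this

lemma Null.congr' (h : Null A (c + c')) (h' : Null A c) : Null A c' := by
  rw [add_comm] at h
  exact h.congr h'

lemma Null.iff (h : Null A (c + c')) : Null A c ↔ Null A c' := ⟨h.congr', h.congr⟩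

lemma Null.rel (h : Null A c) : Rel A c := by
  obtain ⟨e, he⟩ := h
  have := d_mem_S he
  rwa [map_add, d_d, add_zero] at this

lemma Rel.mono (h : Rel A c) (hAB : B ⊆ A) : Rel B c := S_mono (Set.compl_subset_compl.2 hAB) h

lemma Null.mono (h : Null A c) (hAB : B ⊆ A) : Null B c := by
  obtain ⟨e, he⟩ := h
  exact ⟨e, S_mono (Set.compl_subset_compl.2 hAB) he⟩

lemma null_of_mem (h : c ∈ S (n + 1) Aᶜ) : Null A c := ⟨0, by simpa using h⟩

lemma null_d (e : Ch (n + 2) X) : Null A (d e) :=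
  ⟨e, by rw [add_self_eq]; exact Submodule.zero_mem _⟩

lemma null_zero : Null A (0 : Ch (n + 1) X) := null_of_mem (Submodule.zero_mem _)

lemma rel_zero : Rel A (0 : Ch (n + 1) X) := null_zero.rel

lemma Rel.null_Sd (h : Rel A c) (m : ℕ) : Null A (c + Sd^[m] c) := by
  refine ⟨ThI m c, ?_⟩
  rw [d_ThI, ← add_assoc, add_self_eq, zero_add]
  exact ThI_mem_S m h

lemma Rel.Sd (h : Rel A c) (m : ℕ) : Rel A (Sd^[m] c) := by
  rw [Rel, d_iter_Sd]
  exact iter_Sd_mem_S m h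

lemma Rel.null_htpy {Y : Type} [TopologicalSpace Y] {B : Set Y} (h : Rel A c)
    (F : C(X × unitInterval, Y)) (hF : ∀ x ∉ A, ∀ s, F (x, s) ∉ B) :
    Null B (push (F.comp (atTime 0)) c + push (F.comp (atTime 1)) c) := by
  refine ⟨htpy F c, ?_⟩
  rw [d_htpy, ← add_assoc, add_self_eq, zero_add]
  exact htpy_mem_S (U := Aᶜ) (V := Bᶜ) hF h

lemma Rel.push {f : C(X, Y)} {B : Set Y} (h : Rel A c) (hf : ∀ x ∉ A, f x ∉ B) :
    Rel B (push f c) := by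
  rw [Rel, d_push]
  exact push_mem_S hf h

lemma Null.push {f : C(X, Y)} {B : Set Y} (h : Null A c) (hf : ∀ x ∉ A, f x ∉ B) :
    Null B (push f c) := by
  obtain ⟨e, he⟩ := h
  refine ⟨SurfT3.push f e, ?_⟩
  rw [d_push, ← map_add]
  exact push_mem_S hf he

lemma S_compl_sup {m : ℕ} {a b : Ch m X} (ha : a ∈ S m Aᶜ) (hb : b ∈ S m Bᶜ) :
    a + b ∈ S m (A ∩ B)ᶜ :=
  Submodule.add_mem _ (S_mono (Set.compl_subset_compl.2 Set.inter_subset_left) ha)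
    (S_mono (Set.compl_subset_compl.2 Set.inter_subset_right) hb)

lemma S_compl_inf {m : ℕ} {a : Ch m X} (ha : a ∈ S m Aᶜ) (hb : a ∈ S m Bᶜ) :
    a ∈ S m (A ∪ B)ᶜ := by
  rw [Set.compl_union]
  exact S_inter ha hb

lemma exists_compl_split {m : ℕ} (hA : IsClosed A) (hB : IsClosed B) {c : Ch (m + 1) X}
    (h : c ∈ S (m + 1) (A ∩ B)ᶜ) :
    ∃ k a b, Sd^[k] c = a + b ∧ a ∈ S (m + 1) Aᶜ ∧ b ∈ S (m + 1) Bᶜ := by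
  rw [Set.compl_inter] at h
  obtain ⟨k, hk⟩ := exists_iter_Sd_split hA.isOpen_compl hB.isOpen_compl h
  exact ⟨k, hk k le_rfl⟩

/-- Mayer–Vietoris: injectivity. -/
lemma null_union_of_pair (hA : IsClosed A) (hB : IsClosed B) {a b : Ch (n + 2) X}
    (ha : c + d a ∈ S (n + 1) Aᶜ) (hb : c + d b ∈ S (n + 1) Bᶜ)
    (h : Null (A ∩ B) (a + b)) : Null (A ∪ B) c := by
  obtain ⟨f, hf⟩ := h
  obtain ⟨k, u, v, huv, hu, hv⟩ := exists_compl_split hA hB hf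
  have hc : Rel (A ∪ B) c := by
    have h1 := d_mem_S ha
    have h2 := d_mem_S hb
    rw [map_add, d_d, add_zero] at h1 h2
    exact S_compl_inf h1 h2
  refine (hc.null_Sd k).congr ⟨Sd^[k] a + u, ?_⟩
  rw [iter_Sd_add, iter_Sd_add] at huv
  have h2 : Sd^[k] a + u = Sd^[k] b + v + d (Sd^[k] f) := by
    have : Sd^[k] a = Sd^[k] b + Sd^[k] (d f) + (u + v) := by
      rw [← huv]
      refine of_one_smul ?_
      match_scalars <;> decide
    rw [this, d_iter_Sd]
    refine of_one_smul ?_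
    match_scalars <;> decide
  refine S_compl_inf ?_ ?_
  · rw [map_add, d_iter_Sd, ← add_assoc, ← iter_Sd_add]
    exact Submodule.add_mem _ (iter_Sd_mem_S k ha) (d_mem_S hu)
  · rw [h2, map_add, d_d, add_zero, map_add, d_iter_Sd, ← add_assoc, ← iter_Sd_add]
    exact Submodule.add_mem _ (iter_Sd_mem_S k hb) (d_mem_S hv)

lemma rel_inter_of_pair {a b : Ch (n + 2) X}
    (ha : c + d a ∈ S (n + 1) Aᶜ) (hb : c + d b ∈ S (n + 1) Bᶜ) : Rel (A ∩ B) (a + b) := by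
  have := S_compl_sup ha hb
  rwa [add_add_add_comm, add_self_eq, zero_add, ← map_add] at this

lemma null_union (hA : IsClosed A) (hB : IsClosed B) (h₁ : Null A c) (h₂ : Null B c)
    (h : ∀ e : Ch (n + 2) X, Rel (A ∩ B) e → Null (A ∩ B) e) : Null (A ∪ B) c := by
  obtain ⟨a, ha⟩ := h₁
  obtain ⟨b, hb⟩ := h₂
  exact null_union_of_pair hA hB ha hb (h _ (rel_inter_of_pair ha hb))

/-- Mayer–Vietoris: gluing. -/
lemma exists_glue (hA : IsClosed A) (hB : IsClosed B) (h₁ : Rel A c) (h₂ : Rel B c')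
    (h : Null (A ∩ B) (c + c')) :
    ∃ g : Ch (n + 1) X, Rel (A ∪ B) g ∧ Null A (g + c) ∧ Null B (g + c') := by
  obtain ⟨f, hf⟩ := h
  obtain ⟨k, u, v, huv, hu, hv⟩ := exists_compl_split hA hB hf
  rw [iter_Sd_add, iter_Sd_add, ← d_iter_Sd] at huv
  have h2 : Sd^[k] c + u = Sd^[k] c' + v + d (Sd^[k] f) := by
    have : Sd^[k] c = Sd^[k] c' + d (Sd^[k] f) + (u + v) := by
      rw [← huv]
      refine of_one_smul ?_
      match_scalars <;> decide
    rw [this]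
    refine of_one_smul ?_
    match_scalars <;> decide
  refine ⟨Sd^[k] c + u, S_compl_inf ?_ ?_, ?_, ?_⟩
  · rw [map_add]
    exact Submodule.add_mem _ (h₁.Sd k) (d_mem_S hu)
  · rw [h2, map_add, d_d, add_zero, map_add]
    exact Submodule.add_mem _ (h₂.Sd k) (d_mem_S hv)
  · have := (h₁.null_Sd k).add (null_of_mem hu)
    convert this using 1
    abel
  · have := ((h₂.null_Sd k).add (null_of_mem hv)).add (null_d (Sd^[k] f))
    convert this using 1
    rw [h2]
    abel

/-- The homology of `X` relative to the complement of `A` is one-dimensional in degree `k`. -/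
structure HomSphere (A : Set X) (k : ℕ) : Prop where
  gen : ∃ μ : Ch (k + 1) X, Rel A μ ∧ ¬ Null A μ ∧
    ∀ c : Ch (k + 1) X, Rel A c → Null A c ∨ Null A (c + μ)
  vanish : ∀ i ≠ k, ∀ c : Ch (i + 1) X, Rel A c → Null A c

lemma HomSphere.inter {k : ℕ} (hA : IsClosed A) (hB : IsClosed B)
    (vA : ∀ i, ∀ c : Ch (i + 1) X, Rel A c → Null A c)
    (vB : ∀ i, ∀ c : Ch (i + 1) X, Rel B c → Null B c) (h : HomSphere (A ∪ B) k) :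
    HomSphere (A ∩ B) (k + 1) := by
  have lift : ∀ {i} (c : Ch (i + 1) X), Rel (A ∪ B) c →
      ∃ a b : Ch (i + 2) X, c + d a ∈ S (i + 1) Aᶜ ∧ c + d b ∈ S (i + 1) Bᶜ := by
    intro i c hc
    obtain ⟨a, ha⟩ := vA i c (hc.mono Set.subset_union_left)
    obtain ⟨b, hb⟩ := vB i c (hc.mono Set.subset_union_right)
    exact ⟨a, b, ha, hb⟩
  have null_pair : ∀ {i} {c : Ch (i + 1) X} {a b : Ch (i + 2) X}, c + d a ∈ S (i + 1) Aᶜ →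
      c + d b ∈ S (i + 1) Bᶜ → Null (A ∪ B) c → Null (A ∩ B) (a + b) := by
    rintro i c a b ha hb ⟨w, hw⟩
    have hwA := S_mono (Set.compl_subset_compl.2 Set.subset_union_left) hw
    have hwB := S_mono (Set.compl_subset_compl.2 Set.subset_union_right) hw
    have h1 : Rel A (a + w) := by
      have := Submodule.add_mem _ ha hwA
      rwa [add_add_add_comm, add_self_eq, zero_add, ← map_add] at this
    have h2 : Rel B (b + w) := by
      have := Submodule.add_mem _ hb hwB
      rwa [add_add_add_comm, add_self_eq, zero_add, ← map_add] at this
    have := ((vA _ _ h1).mono Set.inter_subset_left).add ((vB _ _ h2).mono Set.inter_subset_right)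
    rwa [add_add_add_comm, add_self_eq, add_zero] at this
  have desc : ∀ {i} (e : Ch (i + 2) X), Rel (A ∩ B) e → ∃ (c : Ch (i + 1) X) (a b : Ch (i + 2) X),
      Rel (A ∪ B) c ∧ c + d a ∈ S (i + 1) Aᶜ ∧ c + d b ∈ S (i + 1) Bᶜ ∧
        Null (A ∩ B) (e + (a + b)) := by
    intro i e he
    obtain ⟨k, u, v, huv, hu, hv⟩ := exists_compl_split hA hB he
    refine ⟨u, 0, Sd^[k] e, ?_, by simpa using hu, ?_, ?_⟩
    · refine S_compl_inf (d_mem_S hu) ?_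
      have : d u = d v := by
        refine eq_of_add_eq_zero ?_
        rw [← map_add, ← huv, ← d_iter_Sd, d_d]
      rw [this]
      exact d_mem_S hv
    · rw [d_iter_Sd, huv, ← add_assoc, add_self_eq, zero_add]
      exact hv
    · rw [zero_add]
      exact he.null_Sd k
  obtain ⟨⟨μ, hμ, hμ0, hμ1⟩, hv⟩ := h
  obtain ⟨a, b, ha, hb⟩ := lift μ hμ
  refine ⟨⟨a + b, rel_inter_of_pair ha hb, fun h => hμ0 (null_union_of_pair hA hB ha hb h), ?_⟩, ?_⟩
  · intro e he
    obtain ⟨c, a', b', hc, ha', hb', hn⟩ := desc e he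
    rcases hμ1 c hc with h0 | h1
    · exact Or.inl (hn.congr (null_pair ha' hb' h0))
    · right
      have h2 : c + μ + d (a' + a) ∈ S _ Aᶜ := by
        rw [map_add, add_add_add_comm]
        exact Submodule.add_mem _ ha' ha
      have h3 : c + μ + d (b' + b) ∈ S _ Bᶜ := by
        rw [map_add, add_add_add_comm]
        exact Submodule.add_mem _ hb' hb
      have := hn.add (null_pair h2 h3 h1)
      convert this using 1
      refine of_one_smul ?_
      match_scalars <;> decide
  · intro i hi e he
    cases i with
    | zero =>
      have h0 : Rel A e := (mem_S.2 fun _ _ t => isEmptyElim t : d e ∈ S 0 Aᶜ)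
      exact (vA 0 e h0).mono Set.inter_subset_left
    | succ i =>
      obtain ⟨c, a', b', hc, ha', hb', hn⟩ := desc e he
      exact hn.congr (null_pair ha' hb' (hv i (by omega) c hc))

/-- Local homology of `X` in degree `n` at each point is at most one-dimensional. -/
def UniqPt (X : Type) [TopologicalSpace X] (n : ℕ) : Prop :=
  ∀ (x : X) (a b : Ch (n + 1) X), Rel {x} a → Rel {x} b →
    ¬ Null {x} a → ¬ Null {x} b → Null {x} (a + b)

/-- Homology relative to the complement of `A` behaves as for compact subsets of manifolds. -/
structure Loc (n : ℕ) (A : Set X) : Prop where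
  vanish : ∀ i > n, ∀ c : Ch (i + 1) X, Rel A c → Null A c
  uniq : ∀ c : Ch (n + 1) X, Rel A c → (∀ a ∈ A, Null {a} c) → Null A c
  exist : ∀ f : X → ZMod 2, IsLocallyConstant f →
    ∃ c : Ch (n + 1) X, Rel A c ∧ ∀ a ∈ A, (Null {a} c ↔ f a = 0)

lemma loc_empty (n : ℕ) : Loc n (∅ : Set X) := by
  have h : ∀ {i} (c : Ch (i + 1) X), Null (∅ : Set X) c := fun c =>
    null_of_mem (by rw [Set.compl_empty]; exact S_univ c)
  exact ⟨fun _ _ c _ => h c, fun c _ _ => h c, fun f _ => ⟨0, (h _).rel, fun a ha => ha.elim⟩⟩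

lemma Loc.union (hX : UniqPt X n) (hA : IsClosed A) (hB : IsClosed B) (lA : Loc n A)
    (lB : Loc n B) (lI : Loc n (A ∩ B)) : Loc n (A ∪ B) where
  vanish i hi c hc := null_union hA hB (lA.vanish i hi c (hc.mono Set.subset_union_left))
    (lB.vanish i hi c (hc.mono Set.subset_union_right)) (lI.vanish (i + 1) (by omega))
  uniq c hc h := null_union hA hB
    (lA.uniq c (hc.mono Set.subset_union_left) fun a ha => h a (Or.inl ha))
    (lB.uniq c (hc.mono Set.subset_union_right) fun a ha => h a (Or.inr ha))
    (lI.vanish (n + 1) (by omega))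
  exist f hf := by
    obtain ⟨a, ha, ha'⟩ := lA.exist f hf
    obtain ⟨b, hb, hb'⟩ := lB.exist f hf
    have hI : Null (A ∩ B) (a + b) := by
      refine lI.uniq _ ((ha.mono Set.inter_subset_left).add (hb.mono Set.inter_subset_right)) ?_
      rintro x ⟨hxA, hxB⟩
      by_cases h0 : f x = 0
      · exact ((ha' x hxA).2 h0).add ((hb' x hxB).2 h0)
      · exact hX x a b (ha.mono (by simpa using hxA)) (hb.mono (by simpa using hxB))
          (fun h => h0 ((ha' x hxA).1 h)) (fun h => h0 ((hb' x hxB).1 h))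
    obtain ⟨g, hg, hgA, hgB⟩ := exists_glue hA hB ha hb hI
    refine ⟨g, hg, ?_⟩
    rintro x (hx | hx)
    · rw [(hgA.mono (by simpa using hx) : Null {x} _).iff, ha' x hx]
    · rw [(hgB.mono (by simpa using hx) : Null {x} _).iff, hb' x hx]

/-- Finite unions of members of an intersection-stable family. -/
lemma loc_list (hX : UniqPt X n) {𝒞 : Set (Set X)} (hcl : ∀ A ∈ 𝒞, IsClosed A)
    (hL : ∀ A ∈ 𝒞, Loc n A) (hI : ∀ A ∈ 𝒞, ∀ B ∈ 𝒞, A ∩ B ∈ 𝒞) (k : ℕ) :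
    ∀ l : List (Set X), l.length = k → (∀ A ∈ l, A ∈ 𝒞) → Loc n {x | ∃ A ∈ l, x ∈ A} := by
  induction k with
  | zero =>
    intro l hl _
    rw [List.length_eq_zero_iff] at hl
    subst hl
    simpa using loc_empty n
  | succ k ih =>
    intro l hl hm
    obtain ⟨B, l, rfl⟩ := List.exists_cons_of_length_eq_add_one hl
    have hl' : l.length = k := by simpa using hl
    have hm' : ∀ A ∈ l, A ∈ 𝒞 := fun A hA => hm A (List.mem_cons_of_mem _ hA)
    have hB : B ∈ 𝒞 := hm B (by simp)
    have h1 : {x | ∃ A ∈ B :: l, x ∈ A} = B ∪ {x | ∃ A ∈ l, x ∈ A} := by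
      ext x; simp
    have h2 : B ∩ {x | ∃ A ∈ l, x ∈ A} = {x | ∃ A ∈ l.map (B ∩ ·), x ∈ A} := by
      ext x
      simp only [Set.mem_inter_iff, Set.mem_ofPred_eq, List.mem_map, exists_exists_and_eq_and]
      constructor
      · rintro ⟨hx, A, hA, hxA⟩
        exact ⟨A, hA, hx, hxA⟩
      · rintro ⟨A, hA, hx, hxA⟩
        exact ⟨hx, A, hA, hxA⟩
    have h3 : IsClosed {x | ∃ A ∈ l, x ∈ A} := by
      have : {x | ∃ A ∈ l, x ∈ A} = ⋃ A ∈ {A | A ∈ l}, A := by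
        ext x; simp
      rw [this]
      exact (List.finite_toSet l).isClosed_biUnion fun A hA => hcl A (hm' A hA)
    rw [h1]
    refine Loc.union hX (hcl B hB) h3 (hL B hB) (ih l hl' hm') ?_
    rw [h2]
    refine ih _ (by simpa using hl') fun A hA => ?_
    obtain ⟨A', hA', rfl⟩ := List.mem_map.1 hA
    exact hI B hB A' (hm' A' hA')

lemma loc_finite (hX : UniqPt X n) {𝒞 : Set (Set X)} (hcl : ∀ A ∈ 𝒞, IsClosed A)
    (hL : ∀ A ∈ 𝒞, Loc n A) (hI : ∀ A ∈ 𝒞, ∀ B ∈ 𝒞, A ∩ B ∈ 𝒞) {ι : Type*} (s : Finset ι)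
    (K : ι → Set X) (hK : ∀ i ∈ s, K i ∈ 𝒞) : Loc n (⋃ i ∈ s, K i) := by
  have := loc_list hX hcl hL hI _ (s.toList.map K) rfl (by
    intro A hA
    obtain ⟨i, hi, rfl⟩ := List.mem_map.1 hA
    exact hK i (by simpa using hi))
  convert this using 1
  ext x
  simp

end SurfT3

namespace SurfT3

/-! ### Excision and Euclidean spaces -/

variable {X Y W : Type} [TopologicalSpace X] [TopologicalSpace Y] [TopologicalSpace W]

/-- The union of the images of the simplices of a chain. -/
def carrier {n : ℕ} (c : Ch n X) : Set X := ⋃ σ ∈ c.support, Set.range σ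

lemma isCompact_carrier {n : ℕ} (c : Ch n X) : IsCompact (carrier c) :=
  c.support.isCompact_biUnion fun σ _ => isCompact_range σ.continuous

lemma mem_S_iff_carrier {n : ℕ} {c : Ch n X} {U : Set X} : c ∈ S n U ↔ carrier c ⊆ U := by
  simp only [mem_S, carrier, Set.iUnion_subset_iff, Set.range_subset_iff]

lemma mem_S_carrier {n : ℕ} (c : Ch n X) : c ∈ S n (carrier c) := mem_S_iff_carrier.2 subset_rfl

lemma rel_iff_carrier {n : ℕ} {c : Ch (n + 1) X} {A : Set X} :
    Rel A c ↔ Disjoint (carrier (d c)) A := by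
  rw [Rel, mem_S_iff_carrier, Set.disjoint_left]
  rfl

lemma Rel.nhds [T2Space X] {n : ℕ} {c : Ch (n + 1) X} {a : X} (h : Rel {a} c) :
    ∃ U ∈ nhds a, Rel U c := by
  refine ⟨(carrier (d c))ᶜ, (isCompact_carrier _).isClosed.isOpen_compl.mem_nhds ?_, ?_⟩
  · intro ha
    exact Set.disjoint_left.1 (rel_iff_carrier.1 h) ha rfl
  · rw [Rel, compl_compl]
    exact mem_S_carrier _

lemma Null.nhds [T2Space X] {n : ℕ} {c : Ch (n + 1) X} {a : X} (h : Null {a} c) :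
    ∃ U ∈ nhds a, Null U c := by
  obtain ⟨e, he⟩ := h
  refine ⟨(carrier (c + d e))ᶜ, (isCompact_carrier _).isClosed.isOpen_compl.mem_nhds ?_, e, ?_⟩
  · intro ha
    exact mem_S_iff_carrier.1 he ha rfl
  · rw [compl_compl]
    exact mem_S_carrier _

/-- The straight-line contraction of a vector space. -/
noncomputable def vecContr {V : Type} [AddCommGroup V] [Module ℝ V] [TopologicalSpace V]
    [ContinuousAdd V] [ContinuousSMul ℝ V] (b : V) : Contr V where
  H := ⟨fun p => (p.2 : ℝ) • b + (1 - (p.2 : ℝ)) • p.1, by fun_prop⟩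
  pt := b
  H_zero x := by simp
  H_one x := by simp

lemma null_of_starConvex_compl {V : Type} [AddCommGroup V] [Module ℝ V] [TopologicalSpace V]
    [ContinuousAdd V] [ContinuousSMul ℝ V] {A : Set V} {b : V} (hb : b ∈ Aᶜ)
    (hA : StarConvex ℝ b Aᶜ) {n : ℕ} {c : Ch (n + 1) V} (hc : Rel A c) : Null A c := by
  refine ⟨cone (vecContr b) c, ?_⟩
  rw [d_cone, ← add_assoc, add_self_eq, zero_add]
  refine cone_mem_S _ (fun x hx s => ?_) hb hc
  exact hA hx s.2.1 (by linarith [s.2.2]) (by ring)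

lemma S_empty {n : ℕ} {c : Ch (n + 1) X} (h : c ∈ S (n + 1) (∅ : Set X)) : c = 0 := by
  rw [← Finsupp.support_eq_empty, Finset.eq_empty_iff_forall_notMem]
  intro σ hσ
  exact mem_S.1 h σ hσ (stdSimplex.vertex 0)

lemma ch_zero_eq (c c' : Ch 0 X) : c = 0 ∨ c' = 0 ∨ c = c' := by
  by_contra! h
  obtain ⟨h1, h2, h3⟩ := h
  refine h3 (Finsupp.ext fun σ => ?_)
  have key : ∀ c : Ch 0 X, c ≠ 0 → c σ ≠ 0 := by
    intro c hc h
    refine hc (Finsupp.ext fun τ => ?_)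
    rw [Subsingleton.elim τ σ, h, Finsupp.zero_apply]
  have e1 := key _ h1
  have e2 := key _ h2
  revert e1 e2
  generalize c σ = x
  generalize c' σ = y
  revert x y
  decide

lemma homSphere_univ (C : Contr X) : HomSphere (Set.univ : Set X) 0 where
  gen := by
    have hd : d (gen (ContinuousMap.const _ C.pt) : Ch 1 X) ≠ 0 := by
      rw [d_gen]
      simp
    refine ⟨gen (ContinuousMap.const _ C.pt), ?_, ?_, fun c _ => ?_⟩
    · exact (mem_S.2 fun _ _ t => isEmptyElim t :
        d (gen (ContinuousMap.const _ C.pt)) ∈ S 0 (Set.univ : Set X)ᶜ)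
    · rintro ⟨e, he⟩
      rw [Set.compl_univ] at he
      have := congrArg d (S_empty he)
      rw [map_add, d_d, add_zero, map_zero] at this
      exact hd this
    · have key : ∀ c : Ch 1 X, d c = 0 → Null Set.univ c := by
        intro c hc
        have := d_cone C c
        rw [hc, map_zero, add_zero] at this
        rw [← this]
        exact null_d _
      rcases ch_zero_eq (d c) (d (gen (ContinuousMap.const _ C.pt))) with h | h | h
      · exact Or.inl (key _ h)
      · exact (hd h).elim
      · exact Or.inr (key _ (by rw [map_add, h, add_self_eq]))
  vanish i hi c hc := by
    obtain ⟨i, rfl⟩ := Nat.exists_eq_succ_of_ne_zero hi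
    rw [Rel, Set.compl_univ] at hc
    have := d_cone C c
    rw [S_empty hc, map_zero, add_zero] at this
    rw [← this]
    exact null_d _

/-- Real coordinate space. -/
abbrev E (n : ℕ) : Type := Fin n → ℝ

lemma homSphere_coord {n : ℕ} (a : E n) (J : Finset (Fin n)) :
    HomSphere {x : E n | ∀ j ∈ J, x j = a j} J.card := by
  induction J using Finset.induction_on with
  | empty => simpa using homSphere_univ (vecContr a)
  | insert k J hk ih =>
    rw [Finset.card_insert_of_notMem hk]
    have hcl : ∀ j, IsClosed {x : E n | x j = a j} := fun j =>
      isClosed_eq (continuous_apply j) continuous_const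
    have hclJ : IsClosed {x : E n | ∀ j ∈ J, x j = a j} := by
      have : {x : E n | ∀ j ∈ J, x j = a j} = ⋂ j ∈ J, {x | x j = a j} := by ext x; simp
      rw [this]
      exact isClosed_biInter fun j _ => hcl j
    have v : ∀ s : ℝ, s ≠ 0 → ∀ i,
        ∀ c : Ch (i + 1) (E n), Rel {x : E n | (∀ j ∈ J, x j = a j) ∧ 0 ≤ s * (x k - a k)} c →
        Null {x : E n | (∀ j ∈ J, x j = a j) ∧ 0 ≤ s * (x k - a k)} c := by
      intro s hs i c hc
      refine null_of_starConvex_compl (b := a - s • Pi.single k 1) ?_ ?_ hc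
      · rintro ⟨-, h⟩
        have : 0 < s * s := mul_self_pos.2 hs
        simp at h
        linarith
      · intro x hx p q hp hq hpq
        rintro ⟨h1, h2⟩
        have hq1 : p = 1 - q := by linarith
        subst hq1
        have hss : 0 < s * s := mul_self_pos.2 hs
        simp only [Pi.add_apply, Pi.smul_apply, Pi.sub_apply, Pi.single_eq_same, smul_eq_mul,
          mul_one] at h2
        rcases hq.eq_or_lt with rfl | hq0
        · ring_nf at h2
          nlinarith
        refine hx ⟨fun j hj => ?_, ?_⟩
        · have hjk : j ≠ k := fun h => hk (h ▸ hj)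
          have := h1 j hj
          simp only [Pi.add_apply, Pi.smul_apply, Pi.sub_apply, smul_eq_mul, ne_eq, hjk,
            not_false_eq_true, Pi.single_eq_of_ne, mul_zero, sub_zero] at this
          have h3 : q * (x j - a j) = 0 := by linarith
          rcases mul_eq_zero.1 h3 with h | h <;> linarith
        · have h3 : 0 ≤ q * (s * (x k - a k)) := by nlinarith
          exact nonneg_of_mul_nonneg_right h3 hq0
    have hle : ∀ s : ℝ, IsClosed {x : E n | (∀ j ∈ J, x j = a j) ∧ 0 ≤ s * (x k - a k)} := by
      intro s
      exact hclJ.inter (isClosed_le continuous_const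
        (continuous_const.mul ((continuous_apply k).sub continuous_const)))
    have hU : {x : E n | (∀ j ∈ J, x j = a j) ∧ 0 ≤ (1 : ℝ) * (x k - a k)} ∪
        {x : E n | (∀ j ∈ J, x j = a j) ∧ 0 ≤ (-1 : ℝ) * (x k - a k)} =
        {x : E n | ∀ j ∈ J, x j = a j} := by
      ext x
      simp only [Set.mem_union, Set.mem_ofPred_eq]
      constructor
      · rintro (h | h) <;> exact h.1
      · intro h
        rcases le_total 0 (x k - a k) with h' | h'
        · exact Or.inl ⟨h, by linarith⟩
        · exact Or.inr ⟨h, by linarith⟩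
    have hI : {x : E n | (∀ j ∈ J, x j = a j) ∧ 0 ≤ (1 : ℝ) * (x k - a k)} ∩
        {x : E n | (∀ j ∈ J, x j = a j) ∧ 0 ≤ (-1 : ℝ) * (x k - a k)} =
        {x : E n | ∀ j ∈ insert k J, x j = a j} := by
      ext x
      simp only [Set.mem_inter_iff, Set.mem_ofPred_eq, Finset.mem_insert, forall_eq_or_imp]
      constructor
      · rintro ⟨h, h'⟩
        exact ⟨by linarith [h.2, h'.2], h.1⟩
      · rintro ⟨h, h'⟩
        exact ⟨⟨h', by linarith⟩, ⟨h', by linarith⟩⟩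
    rw [← hI]
    exact HomSphere.inter (hle 1) (hle _) (v 1 one_ne_zero) (v (-1) (by norm_num)) (hU ▸ ih)

lemma homSphere_point {n : ℕ} (a : E n) : HomSphere {a} n := by
  have := homSphere_coord a Finset.univ
  rw [Finset.card_univ, Fintype.card_fin] at this
  convert this using 1
  ext x
  simp [funext_iff]

lemma HomSphere.uniq {A : Set X} {k : ℕ} (h : HomSphere A k) {c c' : Ch (k + 1) X} (hc : Rel A c)
    (hc' : Rel A c') (hn : ¬ Null A c) (hn' : ¬ Null A c') : Null A (c + c') := by
  obtain ⟨μ, -, -, hμ⟩ := h.gen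
  have := ((hμ c hc).resolve_left hn).add ((hμ c' hc').resolve_left hn')
  rwa [add_add_add_comm, add_self_eq, add_zero] at this

lemma uniqPt_E (n : ℕ) : UniqPt (E n) n := fun x _ _ h h' hn hn' =>
  (homSphere_point x).uniq h h' hn hn'

/-- Rescaling about `a`, from factor `1` to factor `l`. -/
noncomputable def scaleH {n : ℕ} (a : E n) (l : ℝ) : C(E n × unitInterval, E n) :=
  ⟨fun p => a + (1 + (p.2 : ℝ) * (l - 1)) • (p.1 - a), by fun_prop⟩

lemma scaleH_zero {n : ℕ} (a : E n) (l : ℝ) :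
    (scaleH a l).comp (atTime 0) = ContinuousMap.id _ := by
  ext x : 1
  simp [scaleH, atTime]

lemma scaleH_one {n : ℕ} (a : E n) (l : ℝ) (x : E n) :
    ((scaleH a l).comp (atTime 1)) x = a + l • (x - a) := by
  simp [scaleH, atTime]

lemma scaleH_notMem {n : ℕ} {a : E n} {l : ℝ} (hl : 1 ≤ l) {K : Set (E n)} (hK : StarConvex ℝ a K)
    {x : E n} (hx : x ∉ K) (s : unitInterval) : scaleH a l (x, s) ∉ K := by
  intro h
  apply hx
  have h1 : 1 ≤ 1 + (s : ℝ) * (l - 1) := by nlinarith [s.2.1]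
  set r := 1 + (s : ℝ) * (l - 1) with hr
  have := hK h (a := 1 - r⁻¹) (b := r⁻¹) (by linarith [inv_le_one_of_one_le₀ h1]) (by positivity)
    (by ring)
  convert this using 1
  have : scaleH a l (x, s) = a + r • (x - a) := rfl
  rw [this, smul_add, smul_smul, inv_mul_cancel₀ (by positivity), one_smul, sub_smul, one_smul]
  abel

lemma Rel.null_scale {n k : ℕ} {a : E n} {l : ℝ} (hl : 1 ≤ l) {K : Set (E n)}
    (hK : StarConvex ℝ a K) {c : Ch (k + 1) (E n)} (hc : Rel K c) :
    Null K (c + SurfT3.push ((scaleH a l).comp (atTime 1)) c) := by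
  have := hc.null_htpy (scaleH a l) (B := K) fun x hx s => scaleH_notMem hl hK hx s
  rwa [scaleH_zero, push_id] at this

lemma exists_scale {n : ℕ} {a : E n} {U K : Set (E n)} (hU : U ∈ nhds a)
    (hK : Bornology.IsBounded K) :
    ∃ l : ℝ, 1 ≤ l ∧ ∀ x ∉ U, ((scaleH a l).comp (atTime 1)) x ∉ K := by
  obtain ⟨ε, hε, hεU⟩ := Metric.mem_nhds_iff.1 hU
  obtain ⟨R, hR⟩ := hK.subset_closedBall a
  refine ⟨max 1 ((|R| + 1) / ε), le_max_left _ _, fun x hx h => ?_⟩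
  have h1 := hR h
  rw [scaleH_one, Metric.mem_closedBall, dist_eq_norm, add_sub_cancel_left, norm_smul] at h1
  have h2 : ε ≤ ‖x - a‖ := by
    by_contra! h
    exact hx (hεU (by rwa [Metric.mem_ball, dist_eq_norm]))
  have h3 : (|R| + 1) / ε * ε ≤ ‖max 1 ((|R| + 1) / ε)‖ * ‖x - a‖ := by
    refine mul_le_mul ((le_max_right _ _).trans (le_abs_self _)) h2 hε.le (abs_nonneg _)
  rw [div_mul_cancel₀ _ hε.ne'] at h3
  linarith [le_abs_self R]

lemma Null.of_point {n k : ℕ} {a : E n} {K : Set (E n)} (hK : StarConvex ℝ a K)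
    (hb : Bornology.IsBounded K) {c : Ch (k + 1) (E n)} (hc : Rel K c) (h : Null {a} c) :
    Null K c := by
  obtain ⟨U, hU, hN⟩ := h.nhds
  obtain ⟨l, hl, h⟩ := exists_scale hU hb
  exact (hc.null_scale hl hK).congr (hN.push h)

lemma loc_convex {n : ℕ} {K : Set (E n)} (hK : Convex ℝ K) (hb : Bornology.IsBounded K) :
    Loc n K := by
  rcases K.eq_empty_or_nonempty with rfl | ⟨a, ha⟩
  · exact loc_empty n
  have haK : ({a} : Set (E n)) ⊆ K := by simpa using ha
  refine ⟨fun i hi c hc => ?_, fun c hc h => (h a ha).of_point (hK.starConvex ha) hb hc,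
    fun f hf => ?_⟩
  · exact ((homSphere_point a).vanish i hi.ne' c (hc.mono haK)).of_point (hK.starConvex ha) hb hc
  · have hconst : ∀ b, f b = f a := fun b => hf.apply_eq_of_preconnectedSpace b a
    by_cases h0 : f a = 0
    · exact ⟨0, rel_zero, fun b _ => iff_of_true null_zero (by rw [hconst, h0])⟩
    · obtain ⟨μ, hμ, hμ', -⟩ := (homSphere_point a).gen
      obtain ⟨U, hU, hN⟩ := hμ.nhds
      obtain ⟨l, hl, h⟩ := exists_scale hU hb
      have h1 : Rel K (push ((scaleH a l).comp (atTime 1)) μ) := hN.push h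
      refine ⟨_, h1, fun b hbK => iff_of_false (fun h => ?_) (by rwa [hconst])⟩
      exact hμ' ((hμ.null_scale hl (starConvex_singleton a)).congr
        ((h.of_point (hK.starConvex hbK) hb h1).mono haK))

lemma loc_finite_convex {n : ℕ} {ι : Type*} (s : Finset ι) (K : ι → Set (E n))
    (hK : ∀ i ∈ s, Convex ℝ (K i) ∧ IsCompact (K i)) : Loc n (⋃ i ∈ s, K i) :=
  loc_finite (𝒞 := {K | Convex ℝ K ∧ IsCompact K}) (uniqPt_E n) (fun _ h => h.2.isClosed)
    (fun _ h => loc_convex h.1 h.2.isBounded)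
    (fun _ h _ h' => ⟨h.1.inter h'.1, h.2.inter h'.2⟩) s K hK

lemma exists_cover {n : ℕ} {K C : Set (E n)} (hK : IsCompact K) (hC : IsClosed C)
    (hKC : Disjoint C K) : ∃ (s : Finset (E n)) (r : E n → ℝ), (∀ a ∈ s, a ∈ K) ∧
      K ⊆ (⋃ a ∈ s, Metric.closedBall a (r a)) ∧
      ∀ a ∈ s, Disjoint C (Metric.closedBall a (r a)) := by
  have h : ∀ a ∈ K, ∃ r > 0, Metric.closedBall a r ⊆ Cᶜ := fun a ha =>
    Metric.nhds_basis_closedBall.mem_iff.1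
      (hC.isOpen_compl.mem_nhds (Set.disjoint_right.1 hKC ha))
  choose! r hr h using h
  obtain ⟨s, hs, hs'⟩ := hK.elim_nhds_subcover (fun a => Metric.closedBall a (r a))
    fun a ha => Metric.closedBall_mem_nhds a (hr a ha)
  exact ⟨s, r, hs, hs', fun a ha => Set.disjoint_left.2 fun x hx hx' => h a (hs a ha) hx' hx⟩

lemma loc_compact_E {n : ℕ} {K : Set (E n)} (hK : IsCompact K) : Loc n K := by
  have key : ∀ {i} (c : Ch (i + 1) (E n)), Rel K c → ∃ (s : Finset (E n)) (r : E n → ℝ),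
      (∀ a ∈ s, a ∈ K) ∧ K ⊆ (⋃ a ∈ s, Metric.closedBall a (r a)) ∧
      (∀ a ∈ s, Rel (Metric.closedBall a (r a)) c) ∧
      Loc n (⋃ a ∈ s, Metric.closedBall a (r a)) ∧ Rel (⋃ a ∈ s, Metric.closedBall a (r a)) c := by
    intro i c hc
    obtain ⟨s, r, hs, hs', h⟩ := exists_cover hK (isCompact_carrier (d c)).isClosed
      (rel_iff_carrier.1 hc)
    refine ⟨s, r, hs, hs', fun a ha => rel_iff_carrier.2 (h a ha), ?_, ?_⟩
    · exact loc_finite_convex s _ fun a _ => ⟨convex_closedBall _ _, isCompact_closedBall _ _⟩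
    · rw [rel_iff_carrier]
      simpa using h
  refine ⟨fun i hi c hc => ?_, fun c hc h => ?_, fun f hf => ?_⟩
  · obtain ⟨s, r, -, hK', -, hL, hc'⟩ := key c hc
    exact (hL.vanish i hi c hc').mono hK'
  · obtain ⟨s, r, hs, hK', hc'', hL, hc'⟩ := key c hc
    refine (hL.uniq c hc' fun b hb => ?_).mono hK'
    simp only [Set.mem_iUnion] at hb
    obtain ⟨a, ha, hb⟩ := hb
    have h0 : a ∈ Metric.closedBall a (r a) :=
      Metric.mem_closedBall_self (dist_nonneg.trans hb)
    exact ((h a (hs a ha)).of_point ((convex_closedBall a (r a)).starConvex h0)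
      Metric.isBounded_closedBall (hc'' a ha)).mono (by simpa using hb)
  · obtain ⟨R, hR⟩ := hK.isBounded.subset_closedBall 0
    obtain ⟨c, hc, h⟩ := (loc_convex (convex_closedBall (0 : E n) R)
      Metric.isBounded_closedBall).exist f hf
    exact ⟨c, hc.mono hR, fun a ha => h a (hR ha)⟩

end SurfT3

namespace SurfT3

/-! ### Locally Euclidean spaces: local degrees of relative cycles -/

variable {X Y W : Type} [TopologicalSpace X] [TopologicalSpace Y] [TopologicalSpace W]

/-- Locally Euclidean spaces of dimension `n`. -/
def LocEuc (n : ℕ) (X : Type) [TopologicalSpace X] : Prop :=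
  ∀ x : X, ∃ j : C(E n, X), Topology.IsOpenEmbedding j ∧ x ∈ Set.range j

lemma exists_push_eq {j : C(X, Y)} (hj : Topology.IsEmbedding j) {n : ℕ} {c : Ch n Y} {U : Set X}
    (hc : c ∈ S n (j '' U)) : ∃ c' ∈ S n U, push j c' = c := by
  refine S_induction (p := fun c => ∃ c' ∈ S n U, push j c' = c) hc ⟨0, Submodule.zero_mem _,
    map_zero _⟩ (fun σ hσ => ?_) ?_
  · choose f hfU hf using hσ
    refine ⟨gen ⟨f, hj.continuous_iff.2 ?_⟩, gen_mem_S hfU, ?_⟩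
    · convert σ.continuous
      ext t
      exact hf t
    · rw [push_gen]
      congr 1
      ext t
      exact hf t
  · rintro a b ⟨a', ha, rfl⟩ ⟨b', hb, rfl⟩
    exact ⟨a' + b', Submodule.add_mem _ ha hb, map_add _ _ _⟩

lemma mem_S_of_push {j : C(X, Y)} (hj : Function.Injective j) {n : ℕ} {c : Ch n X} {V : Set Y}
    (hc : push j c ∈ S n V) : c ∈ S n (j ⁻¹' V) :=
  mem_SP_of_push hj hc

lemma push_mem_S_compl {j : C(X, Y)} (hj : Function.Injective j) {n : ℕ} {c : Ch n X} {K : Set X}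
    (hc : push j c ∈ S n (j '' K)ᶜ) : c ∈ S n Kᶜ := by
  have := mem_S_of_push hj hc
  rwa [Set.preimage_compl, Set.preimage_image_eq _ hj] at this

section excision

variable {j : C(X, Y)} (hj : Topology.IsOpenEmbedding j) {n : ℕ} {K : Set X}
include hj

lemma null_of_push (hK : IsClosed (j '' K)) {c : Ch (n + 1) X} (h : Null (j '' K) (push j c)) :
    Null K c := by
  have hr : Rel K c := by
    have := h.rel
    rw [Rel, d_push] at this
    exact push_mem_S_compl hj.injective this
  obtain ⟨e, he⟩ := h
  obtain ⟨m, e1, e2, h12, h1, h2⟩ := exists_compl_split (m := n + 1) (A := (Set.range j)ᶜ)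
    hj.isOpen_range.isClosed_compl hK (c := e) (by
      convert S_univ e
      rw [Set.eq_univ_iff_forall]
      rintro x ⟨hx, ⟨y, -, rfl⟩⟩
      exact hx ⟨y, rfl⟩)
  rw [compl_compl, ← Set.image_univ] at h1
  obtain ⟨e1, -, rfl⟩ := exists_push_eq hj.isEmbedding h1
  refine (hr.null_Sd m).congr ⟨e1, push_mem_S_compl hj.injective ?_⟩
  have := Submodule.add_mem _ (iter_Sd_mem_S m he) (d_mem_S h2)
  rw [iter_Sd_add, ← d_iter_Sd, h12] at this
  convert this using 1
  rw [map_add, push_iter_Sd, ← d_push, map_add, ← add_assoc, add_assoc _ (d e2), add_self_eq,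
    add_zero]

lemma exists_push_of_rel (hK : IsClosed (j '' K)) {c : Ch (n + 1) Y} (h : Rel (j '' K) c) :
    ∃ c' : Ch (n + 1) X, Rel K c' ∧ Null (j '' K) (c + SurfT3.push j c') := by
  obtain ⟨m, e1, e2, h12, h1, h2⟩ := exists_compl_split (m := n) (A := (Set.range j)ᶜ)
    hj.isOpen_range.isClosed_compl hK (c := c) (by
      convert S_univ c
      rw [Set.eq_univ_iff_forall]
      rintro x ⟨hx, ⟨y, -, rfl⟩⟩
      exact hx ⟨y, rfl⟩)
  rw [compl_compl, ← Set.image_univ] at h1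
  obtain ⟨e1, -, rfl⟩ := exists_push_eq hj.isEmbedding h1
  refine ⟨e1, push_mem_S_compl hj.injective ?_, ?_⟩
  · rw [← d_push]
    have : SurfT3.push j e1 = Sd^[m] c + e2 := by rw [h12, add_assoc, add_self_eq, add_zero]
    rw [this, map_add]
    exact Submodule.add_mem _ (h.Sd m) (d_mem_S h2)
  · have := (h.null_Sd m).add (null_of_mem h2)
    rwa [h12, add_assoc, add_assoc, add_self_eq, add_zero] at this

lemma Rel.push_emb {c : Ch (n + 1) X} (h : Rel K c) : Rel (j '' K) (SurfT3.push j c) :=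
  h.push (by rintro x hx ⟨y, hy, hyx⟩; exact hx (hj.injective hyx ▸ hy))

lemma Null.push_emb {c : Ch (n + 1) X} (h : Null K c) : Null (j '' K) (SurfT3.push j c) :=
  h.push (by rintro x hx ⟨y, hy, hyx⟩; exact hx (hj.injective hyx ▸ hy))

lemma null_push_iff [T1Space Y] {a : X} {c : Ch (n + 1) X} :
    Null {j a} (push j c) ↔ Null {a} c := by
  rw [← Set.image_singleton]
  exact ⟨null_of_push hj (by simp), fun h => h.push_emb hj⟩

lemma Loc.image [T2Space Y] (hK : IsCompact K) (hL : Loc n K) : Loc n (j '' K) where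
  vanish i hi c hc := by
    have hcl := (hK.image j.continuous).isClosed
    obtain ⟨c', hc', h⟩ := exists_push_of_rel hj hcl hc
    exact h.congr ((hL.vanish i hi c' hc').push_emb hj)
  uniq c hc h := by
    have hcl := (hK.image j.continuous).isClosed
    obtain ⟨c', hc', h'⟩ := exists_push_of_rel hj hcl hc
    refine h'.congr ((hL.uniq c' hc' fun a ha => ?_).push_emb hj)
    rw [← null_push_iff hj]
    exact (h'.mono (by simpa using ⟨a, ha, rfl⟩ : {j a} ⊆ j '' K)).congr' (h _ ⟨a, ha, rfl⟩)
  exist f hf := by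
    obtain ⟨c, hc, h⟩ := hL.exist (f ∘ j) (hf.comp_continuous j.continuous)
    refine ⟨push j c, hc.push_emb hj, ?_⟩
    rintro _ ⟨a, ha, rfl⟩
    rw [null_push_iff hj]
    exact h a ha

end excision

section manifold

variable {n : ℕ} (hX : LocEuc n X)
include hX

lemma LocEuc.uniqPt [T1Space X] : UniqPt X n := by
  intro x c c' hc hc' hn hn'
  obtain ⟨j, hj, a, rfl⟩ := hX x
  rw [← Set.image_singleton] at *
  have hcl : IsClosed (j '' {a}) := by simp
  obtain ⟨b, hb, h⟩ := exists_push_of_rel hj hcl hc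
  obtain ⟨b', hb', h'⟩ := exists_push_of_rel hj hcl hc'
  have := (uniqPt_E n a b b' hb hb' (fun hh => hn (h.congr (hh.push_emb hj)))
    (fun hh => hn' (h'.congr (hh.push_emb hj)))).push_emb hj
  have := (h.add h').add this
  rw [map_add, add_assoc, add_add_add_comm] at this
  convert this using 1
  refine of_one_smul ?_
  match_scalars <;> decide

lemma LocEuc.loc [T2Space X] {A : Set X} (hA : IsCompact A) : Loc n A := by
  have h : ∀ x : X, ∃ K ∈ nhds x, ∃ j : C(E n, X), Topology.IsOpenEmbedding j ∧
      ∃ K', IsCompact K' ∧ K = j '' K' := by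
    intro x
    obtain ⟨j, hj, a, rfl⟩ := hX x
    exact ⟨_, hj.isOpenMap.image_mem_nhds (Metric.closedBall_mem_nhds a one_pos), j, hj, _,
      isCompact_closedBall a 1, rfl⟩
  choose K hK j hj K' hK' hKK' using h
  obtain ⟨s, -, hs⟩ := hA.elim_nhds_subcover K fun x _ => hK x
  have hI : ∀ (j : C(E n, X)), Topology.IsOpenEmbedding j → ∀ K', IsCompact K' → ∀ B, IsClosed B →
      j '' K' ∩ B = j '' (K' ∩ j ⁻¹' B) ∧ IsCompact (K' ∩ j ⁻¹' B) := by
    intro j hj K' hK' B hB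
    exact ⟨(Set.image_inter_preimage _ _ _).symm, hK'.inter_right (hB.preimage j.continuous)⟩
  have := loc_finite (n := n) (𝒞 := {K | ∃ j : C(E n, X), Topology.IsOpenEmbedding j ∧
      ∃ K', IsCompact K' ∧ K = j '' K'}) hX.uniqPt ?_ ?_ ?_ s (fun x => K x ∩ A) ?_
  · convert this using 1
    rw [← Set.iUnion₂_inter, Set.inter_eq_right.2 hs]
  · rintro _ ⟨j, hj, K', hK', rfl⟩
    exact (hK'.image j.continuous).isClosed
  · rintro _ ⟨j, hj, K', hK', rfl⟩
    exact (loc_compact_E hK').image hj hK'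
  · rintro _ ⟨j, hj, K', hK', rfl⟩ _ ⟨j₂, hj₂, K₂', hK₂', rfl⟩
    obtain ⟨h1, h2⟩ := hI j hj K' hK' _ (hK₂'.image j₂.continuous).isClosed
    exact ⟨j, hj, _, h2, h1⟩
  · intro x _
    obtain ⟨h1, h2⟩ := hI (j x) (hj x) (K' x) (hK' x) A hA.isClosed
    exact ⟨j x, hj x, _, h2, by rw [hKK', h1]⟩

end manifold

open Classical in
/-- The local degree of a relative cycle at a point. -/
noncomputable def val {n : ℕ} (a : X) (c : Ch (n + 1) X) : ZMod 2 := if Null {a} c then 0 else 1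

lemma val_eq_zero {n : ℕ} {a : X} {c : Ch (n + 1) X} : val a c = 0 ↔ Null {a} c := by
  by_cases h : Null {a} c <;> simp [val, h]

lemma val_congr {n : ℕ} {a : X} {c c' : Ch (n + 1) X} (h : Null {a} (c + c')) :
    val a c = val a c' := by
  rw [val, val]
  congr 1
  exact propext h.iff

lemma val_congr_iff {n : ℕ} {a : X} {b : Y} {c : Ch (n + 1) X} {c' : Ch (n + 1) Y}
    (h : Null {a} c ↔ Null {b} c') : val a c = val b c' := by
  rw [val, val]
  congr 1
  exact propext h

lemma val_add {n : ℕ} (hX : UniqPt X n) {a : X} {c c' : Ch (n + 1) X} (h : Rel {a} c)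
    (h' : Rel {a} c') : val a (c + c') = val a c + val a c' := by
  by_cases h1 : Null {a} c
  · rw [val_eq_zero.2 h1, zero_add]
    refine val_congr ?_
    rwa [add_assoc, add_self_eq, add_zero]
  · by_cases h2 : Null {a} c'
    · rw [val_eq_zero.2 h2, add_zero]
      refine val_congr ?_
      rwa [add_right_comm, add_self_eq, zero_add]
    · rw [val_eq_zero.2 (hX a c c' h h' h1 h2)]
      simp only [val, h1, h2, if_false]
      decide

lemma val_const_E {n : ℕ} {K : Set (E n)} (hK : Convex ℝ K) (hb : Bornology.IsBounded K)
    {k : ℕ} {c : Ch (k + 1) (E n)} (hc : Rel K c) {a b : E n} (ha : a ∈ K) (hb' : b ∈ K) :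
    val a c = val b c := by
  have key : ∀ a ∈ K, Null {a} c ↔ Null K c := fun a ha =>
    ⟨Null.of_point (hK.starConvex ha) hb hc, fun h => h.mono (by simpa using ha)⟩
  exact val_congr_iff (by rw [key a ha, key b hb'])

lemma val_push {j : C(X, Y)} (hj : Topology.IsOpenEmbedding j) [T1Space Y] {n : ℕ} (a : X)
    (c : Ch (n + 1) X) : val (j a) (push j c) = val a c :=
  val_congr_iff (null_push_iff hj)

lemma LocEuc.eventually_val [T2Space X] {n : ℕ} (hX : LocEuc n X) {k : ℕ} {c : Ch (k + 1) X}
    {x : X} (hc : Rel {x} c) : ∀ᶠ y in nhds x, Rel {y} c ∧ val y c = val x c := by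
  obtain ⟨j, hj, a, rfl⟩ := hX x
  obtain ⟨U, hU, hc⟩ := hc.nhds
  obtain ⟨r, hr, hrU⟩ := Metric.nhds_basis_closedBall.mem_iff.1
    (j.continuous.continuousAt.preimage_mem_nhds hU)
  have hc' : Rel (j '' Metric.closedBall a r) c := hc.mono (Set.image_subset_iff.2 hrU)
  have hcl : IsClosed (j '' Metric.closedBall a r) :=
    ((isCompact_closedBall a r).image j.continuous).isClosed
  obtain ⟨c', hcc, h⟩ := exists_push_of_rel hj hcl hc'
  filter_upwards [hj.isOpenMap.image_mem_nhds (Metric.closedBall_mem_nhds a hr)]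
  rintro _ ⟨b, hb, rfl⟩
  refine ⟨hc'.mono (by simpa using ⟨b, hb, rfl⟩), ?_⟩
  have key : ∀ b ∈ Metric.closedBall a r, val (j b) c = val b c' := fun b hb =>
    (val_congr (h.mono (by simpa using ⟨b, hb, rfl⟩))).trans (val_push hj b c')
  rw [key b hb, key a (Metric.mem_closedBall_self hr.le)]
  exact val_const_E (convex_closedBall _ _) Metric.isBounded_closedBall hcc hb
    (Metric.mem_closedBall_self hr.le)

end SurfT3

namespace SurfT3

/-! ### Homology of closed manifolds in top degree and in degree zero -/

variable {X Y W : Type} [TopologicalSpace X] [TopologicalSpace Y] [TopologicalSpace W]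

instance : Subsingleton (Simp 1) := ⟨fun s t => by
  have hs := stdSimplex.sum_eq_one s
  have ht := stdSimplex.sum_eq_one t
  rw [Fin.sum_univ_one] at hs ht
  refine Subtype.ext (funext fun i => ?_)
  rw [Subsingleton.elim i 0]
  exact hs.trans ht.symm⟩

/-- The degenerate chain at a point. -/
noncomputable def pnt (x : X) : Ch 1 X := gen (ContinuousMap.const _ x)

lemma gen_one_eq (σ : Sing 1 X) (t : Simp 1) : gen σ = pnt (σ t) := by
  rw [pnt]
  congr 1
  ext s
  rw [Subsingleton.elim s t]
  rfl

lemma push_pnt (f : C(X, Y)) (x : X) : push f (pnt x) = pnt (f x) := by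
  rw [pnt, push_gen]
  rfl

/-- The vertices of a singular simplex. -/
noncomputable def vtx {n : ℕ} (σ : Sing n X) (i : Fin n) : X := σ (stdSimplex.vertex i)

lemma face_vertex {n : ℕ} (i : Fin (n + 1)) (k : Fin n) :
    face i (stdSimplex.vertex k) = stdSimplex.vertex (i.succAbove k) := by
  refine simp_ext_succAbove i ?_ fun j => ?_
  · rw [face_same, stdSimplex.vertex_coe, Pi.single_eq_of_ne (Fin.succAbove_ne i k).symm]
  · rw [face_succAbove, stdSimplex.vertex_coe, stdSimplex.vertex_coe]
    simp only [Pi.single_apply, (Fin.succAbove_right_injective (p := i)).eq_iff]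

lemma vtx_face {n : ℕ} (σ : Sing (n + 1) X) (i : Fin (n + 1)) (k : Fin n) :
    vtx (σ.comp (face i)) k = vtx σ (i.succAbove k) := by
  rw [vtx, ContinuousMap.comp_apply, face_vertex, vtx]

lemma gen_one_eq_vtx (σ : Sing 1 X) : gen σ = pnt (vtx σ 0) := gen_one_eq σ _

lemma d_gen_two (σ : Sing 2 X) : d (gen σ) = pnt (vtx σ 0) + pnt (vtx σ 1) := by
  rw [d_gen, Fin.sum_univ_two, gen_one_eq_vtx, gen_one_eq_vtx, vtx_face, vtx_face, add_comm]
  rfl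

/-- Cycles. -/
noncomputable abbrev Zc (n : ℕ) (X : Type) [TopologicalSpace X] :
    Submodule (ZMod 2) (Ch (n + 1) X) := LinearMap.ker d

/-- Boundaries, inside the cycles. -/
noncomputable abbrev Bc (n : ℕ) (X : Type) [TopologicalSpace X] : Submodule (ZMod 2) (Zc n X) :=
  (LinearMap.range (d : Ch (n + 2) X →ₗ[ZMod 2] Ch (n + 1) X)).submoduleOf (Zc n X)

/-- Homology in positive degrees. -/
abbrev HH (n : ℕ) (X : Type) [TopologicalSpace X] : Type := Zc n X ⧸ Bc n X

/-- Homology in degree zero. -/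
abbrev H0 (X : Type) [TopologicalSpace X] : Type :=
  Ch 1 X ⧸ LinearMap.range (d : Ch 2 X →ₗ[ZMod 2] Ch 1 X)

lemma null_univ_iff {n : ℕ} {c : Ch (n + 1) X} : Null Set.univ c ↔ ∃ e, d e = c := by
  constructor
  · rintro ⟨e, he⟩
    rw [Set.compl_univ] at he
    exact ⟨e, (eq_of_add_eq_zero (S_empty he)).symm⟩
  · rintro ⟨e, rfl⟩
    exact null_d e

lemma rel_univ_iff {n : ℕ} {c : Ch (n + 2) X} : Rel Set.univ c ↔ d c = 0 := by
  constructor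
  · intro h
    rw [Rel, Set.compl_univ] at h
    exact S_empty h
  · intro h
    rw [Rel, h]
    exact Submodule.zero_mem _

lemma rel_of_d_eq_zero {n : ℕ} {c : Ch (n + 1) X} (h : d c = 0) (A : Set X) : Rel A c := by
  rw [Rel, h]
  exact Submodule.zero_mem _

section manifold

variable {n : ℕ} (hX : LocEuc n X)
include hX

lemma LocEuc.isLocallyConstant_val [T2Space X] {k : ℕ} {c : Ch (k + 1) X} (hc : d c = 0) :
    IsLocallyConstant fun x => val x c :=
  (IsLocallyConstant.iff_eventually_eq _).2 fun _ =>
    (hX.eventually_val (rel_of_d_eq_zero hc _)).mono fun _ h => h.2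

/-- The local degree of a cycle, as a locally constant function. -/
noncomputable def valLC [T2Space X] :
    Zc n X →ₗ[ZMod 2] LocallyConstant X (ZMod 2) :=
  AddMonoidHom.toZModLinearMap 2
    { toFun := fun c => ⟨fun x => val x c.1, hX.isLocallyConstant_val c.2⟩
      map_zero' := by
        ext x
        exact val_eq_zero.2 null_zero
      map_add' := fun c c' => by
        ext x
        exact val_add hX.uniqPt (rel_of_d_eq_zero c.2 _) (rel_of_d_eq_zero c'.2 _) }

lemma valLC_apply [T2Space X] (c : Zc n X) (x : X) :
    valLC hX c x = val x c.1 := rfl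

lemma LocEuc.isLocallyConstant_of_path {M : Type*} (f : X → M)
    (h : ∀ σ : Sing 2 X, f (vtx σ 0) = f (vtx σ 1)) : IsLocallyConstant f := by
  rw [IsLocallyConstant.iff_eventually_eq]
  intro x
  obtain ⟨j, hj, a, rfl⟩ := hX x
  filter_upwards [hj.isOpen_range.mem_nhds ⟨a, rfl⟩]
  rintro _ ⟨b, rfl⟩
  have hc : ∀ i, Continuous fun t : Simp 2 => t i := fun i =>
    (continuous_apply i).comp continuous_subtype_val
  have := h (j.comp ⟨fun t => t 0 • b + t 1 • a,
    ((hc 0).smul continuous_const).add ((hc 1).smul continuous_const)⟩)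
  simpa [vtx] using this

end manifold

/-- Locally constant functions are dual to `H0`. -/
noncomputable def lcToDual : LocallyConstant X (ZMod 2) →ₗ[ZMod 2] Module.Dual (ZMod 2) (H0 X) where
  toFun f := Submodule.liftQ _ (Finsupp.linearCombination (ZMod 2) fun σ : Sing 1 X => f (vtx σ 0))
    (by
      rintro _ ⟨c, rfl⟩
      induction c using ch_induction with
      | h0 => simp
      | hg σ =>
        rw [LinearMap.mem_ker, d_gen_two, map_add, pnt, pnt, Finsupp.linearCombination_single,
          Finsupp.linearCombination_single]
        have : f (vtx σ 0) = f (vtx σ 1) :=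
          (f.isLocallyConstant.comp_continuous σ.continuous).apply_eq_of_preconnectedSpace _ _
        simp only [vtx, ContinuousMap.const_apply, one_smul] at this ⊢
        rw [this]
        exact add_self_eq _
      | ha a b h1 h2 =>
        rw [LinearMap.mem_ker] at h1 h2 ⊢
        rw [map_add, map_add, h1, h2, add_zero])
  map_add' f g := by
    refine Submodule.linearMap_qext _ (ch_hom_ext fun σ => ?_)
    simp
  map_smul' r f := by
    refine Submodule.linearMap_qext _ (ch_hom_ext fun σ => ?_)
    simp

lemma lcToDual_apply (f : LocallyConstant X (ZMod 2)) (x : X) :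
    lcToDual f (Submodule.Quotient.mk (pnt x)) = f x := by
  change Submodule.liftQ _ (Finsupp.linearCombination _ _) _ (Submodule.Quotient.mk (pnt x)) = _
  rw [Submodule.liftQ_apply, pnt, Finsupp.linearCombination_single]
  simp [vtx]

lemma LocEuc.lcToDual_bijective {n : ℕ} (hX : LocEuc n X) :
    Function.Bijective (lcToDual : LocallyConstant X (ZMod 2) →ₗ[ZMod 2] _) := by
  constructor
  · intro f g h
    ext x
    rw [← lcToDual_apply f, h, lcToDual_apply]
  · intro φ
    have hf : IsLocallyConstant fun x => φ (Submodule.Quotient.mk (pnt x)) := by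
      refine hX.isLocallyConstant_of_path _ fun σ => ?_
      refine eq_of_add_eq_zero ?_
      rw [← map_add, ← Submodule.Quotient.mk_add, ← d_gen_two,
        (Submodule.Quotient.mk_eq_zero _).2 (LinearMap.mem_range_self _ _), map_zero]
    refine ⟨⟨_, hf⟩, ?_⟩
    refine Submodule.linearMap_qext _ (ch_hom_ext fun σ => ?_)
    rw [gen_one_eq_vtx]
    exact lcToDual_apply _ _

lemma LocEuc.valLC_ker [T2Space X] [CompactSpace X] {n : ℕ} (hX : LocEuc n X) :
    LinearMap.ker (valLC hX) = Bc n X := by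
  ext ⟨c, hc⟩
  rw [LinearMap.mem_ker]
  constructor
  · intro h
    obtain ⟨e, he⟩ := null_univ_iff.1 ((hX.loc isCompact_univ).uniq c (rel_of_d_eq_zero hc _)
      fun a _ => val_eq_zero.1 (DFunLike.congr_fun h a))
    exact ⟨e, he⟩
  · rintro ⟨e, he⟩
    ext a
    rw [valLC_apply]
    refine val_eq_zero.2 ?_
    change Null {a} c
    have he : d e = c := he
    rw [← he]
    exact null_d e

lemma LocEuc.valLC_surjective [T2Space X] [CompactSpace X] {n : ℕ} (hX : LocEuc (n + 1) X) :
    Function.Surjective (valLC hX) := by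
  intro f
  obtain ⟨c, hc, h⟩ := (hX.loc isCompact_univ).exist f f.isLocallyConstant
  refine ⟨⟨c, rel_univ_iff.1 hc⟩, ?_⟩
  ext a
  rw [valLC_apply]
  have := h a trivial
  by_cases h0 : f a = 0
  · rw [h0, val_eq_zero]
    exact this.2 h0
  · have h1 : val a c ≠ 0 := fun h => h0 (this.1 (val_eq_zero.1 h))
    change val a c = f a
    revert h0 h1
    generalize val a c = x
    generalize f a = y
    revert x y
    decide

/-- Poincaré duality between degrees `0` and `n` on the level of dimensions. -/
theorem LocEuc.finrank_HH [T2Space X] [CompactSpace X] {n : ℕ} (hX : LocEuc (n + 1) X) :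
    Module.finrank (ZMod 2) (HH (n + 1) X) = Module.finrank (ZMod 2) (H0 X) := by
  rw [← Subspace.dual_finrank_eq (V := H0 X),
    ← (LinearEquiv.ofBijective _ hX.lcToDual_bijective).finrank_eq]
  exact ((Submodule.quotEquivOfEq _ _ hX.valLC_ker.symm).trans
    ((valLC hX).quotKerEquivOfSurjective hX.valLC_surjective)).finrank_eq

end SurfT3

namespace SurfT3

/-! ### Comparison with the homology of the singular chain complex -/

variable {X Y W : Type} [TopologicalSpace X] [TopologicalSpace Y] [TopologicalSpace W]

open Simplicial in
lemma toSSetObjEquiv_δ {n : ℕ} (i : Fin (n + 2))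
    (s : (TopCat.toSSet.obj (TopCat.of X)).obj (Opposite.op ⦋n + 1⦌)) :
    (TopCat.toSSetObjEquiv (TopCat.of X) _ ((TopCat.toSSet.obj (TopCat.of X)).δ i s) :
      Sing (n + 1) X) =
    ContinuousMap.comp (TopCat.toSSetObjEquiv (TopCat.of X) _ s : Sing (n + 2) X) (face i) := by
  have h : ∀ t : Simp (n + 1), stdSimplex.map (i.succAbove) t = face i t := by
    intro t
    refine simp_ext_succAbove i ?_ fun j => ?_
    · rw [face_same, stdSimplex.map_coe, FunOnFinite.linearMap_apply_apply]
      refine Finset.sum_eq_zero fun j hj => ?_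
      exact absurd (Finset.mem_filter.1 hj).2 (Fin.succAbove_ne i j)
    · rw [face_succAbove, stdSimplex.map_coe, FunOnFinite.linearMap_apply_apply]
      rw [Finset.sum_eq_single_of_mem j (by simp)]
      intro k hk hkj
      exact absurd (Fin.succAbove_right_injective (Finset.mem_filter.1 hk).2) hkj
  ext t
  rw [ContinuousMap.comp_apply, ← h]
  rfl

open Simplicial in
lemma alternating_d_apply (A : SimplicialObject (ModuleCat (ZMod 2))) (n : ℕ)
    (c : A.obj (Opposite.op ⦋n + 1⦌)) :
    (ModuleCat.Hom.hom (((AlgebraicTopology.alternatingFaceMapComplex _).obj A).d (n + 1) n) c :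
      A.obj (Opposite.op ⦋n⦌)) = ∑ i : Fin (n + 2), (A.δ i).hom c := by
  have h := AlgebraicTopology.AlternatingFaceMapComplex.obj_d_eq A n
  refine (congrArg (fun f => ModuleCat.Hom.hom f c) h).trans ?_
  rw [ModuleCat.hom_sum, LinearMap.sum_apply]
  refine Finset.sum_congr rfl fun i _ => ?_
  rw [ModuleCat.hom_zsmul, LinearMap.smul_apply]
  rcases neg_one_pow_eq_or ℤ (i : ℕ) with h | h <;> rw [h]
  · exact one_zsmul _
  · rw [neg_one_zsmul, neg_eq_self']

/-- The singular chains in the sense of Mathlib are finitely supported functions on singular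
simplices. -/
noncomputable def chainEquiv (X : Type) [TopologicalSpace X] (n : ℕ) :
    (singularChainComplex (ZMod 2) X).X n ≃ₗ[ZMod 2] Ch (n + 1) X :=
  Finsupp.domLCongr (TopCat.toSSetObjEquiv (TopCat.of X) (Opposite.op (SimplexCategory.mk n)))

lemma chainEquiv_d (n : ℕ) (c : (singularChainComplex (ZMod 2) X).X (n + 1)) :
    chainEquiv X n (((singularChainComplex (ZMod 2) X).d (n + 1) n).hom c) =
      d (chainEquiv X (n + 1) c) := by
  suffices h : (chainEquiv X n).toLinearMap ∘ₗ
      ((singularChainComplex (ZMod 2) X).d (n + 1) n).hom =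
      d ∘ₗ (chainEquiv X (n + 1)).toLinearMap from LinearMap.congr_fun h c
  refine Finsupp.lhom_ext' fun s => LinearMap.ext_ring ?_
  refine (congrArg (chainEquiv X n) (alternating_d_apply _ n _)).trans ?_
  refine (map_sum (chainEquiv X n) _ _).trans ?_
  have h2 : chainEquiv X (n + 1) (Finsupp.lsingle (R := ZMod 2) s 1) =
    gen (TopCat.toSSetObjEquiv (TopCat.of X) _ s) := Finsupp.domLCongr_single _ _ _
  refine Eq.trans ?_ (congrArg d h2).symm
  rw [d_gen]
  refine Finset.sum_congr rfl fun i _ => ?_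
  rw [← toSSetObjEquiv_δ]
  have h3 : (ModuleCat.Hom.hom
    ((((SimplicialObject.whiskering _ _).obj (ModuleCat.free (ZMod 2))).obj
      (TopCat.toSSet.obj (TopCat.of X))).δ i)) (Finsupp.lsingle (R := ZMod 2) s 1) =
      (Finsupp.single ((TopCat.toSSet.obj (TopCat.of X)).δ i s) (1 : ZMod 2)) :=
    Finsupp.mapDomain_single
  refine (congrArg (chainEquiv X n) h3).trans ?_
  exact Finsupp.domLCongr_single _ _ _

lemma finrank_homology_eq (T : ShortComplex (ModuleCat (ZMod 2))) {Q : Type} [AddCommGroup Q]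
    [Module (ZMod 2) Q] (ψ : LinearMap.ker T.g.hom →ₗ[ZMod 2] Q) (hψ : Function.Surjective ψ)
    (h : ∀ x : LinearMap.ker T.g.hom, ψ x = 0 ↔ ∃ y, T.f.hom y = x.1) :
    Module.finrank (ZMod 2) T.homology = Module.finrank (ZMod 2) Q := by
  rw [(T.moduleCatHomologyIso).toLinearEquiv.finrank_eq]
  have h2 : LinearMap.range T.moduleCatToCycles = LinearMap.ker ψ := by
    ext x
    rw [LinearMap.mem_ker, h, LinearMap.mem_range]
    exact exists_congr fun y => Subtype.ext_iff
  exact ((Submodule.quotEquivOfEq _ _ h2).trans (ψ.quotKerEquivOfSurjective hψ)).finrank_eq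

lemma betti_succ (n : ℕ) : betti X (n + 1) = Module.finrank (ZMod 2) (HH (n + 1) X) := by
  let K := singularChainComplex (ZMod 2) X
  let T := K.sc' (n + 2) (n + 1) n
  have hT : betti X (n + 1) = Module.finrank (ZMod 2) T.homology :=
    ((ShortComplex.homologyMapIso
      (K.isoSc' (n + 2) (n + 1) n (by simp) (by simp))).toLinearEquiv).finrank_eq
  rw [hT]
  let ψ0 : LinearMap.ker T.g.hom →ₗ[ZMod 2] Zc (n + 1) X :=
    ((chainEquiv X (n + 1)).toLinearMap ∘ₗ
      (LinearMap.ker T.g.hom).subtype).codRestrict _ fun x => by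
      refine (chainEquiv_d n _).symm.trans ?_
      exact (congrArg _ x.2).trans (map_zero _)
  refine finrank_homology_eq T ((Bc (n + 1) X).mkQ ∘ₗ ψ0) ?_ ?_
  · refine (Submodule.mkQ_surjective _).comp fun c => ?_
    refine ⟨⟨(chainEquiv X (n + 1)).symm c.1, ?_⟩,
      Subtype.ext ((chainEquiv X (n + 1)).apply_symm_apply _)⟩
    refine (chainEquiv X n).injective ((chainEquiv_d n _).trans ?_)
    rw [LinearEquiv.apply_symm_apply]
    exact (show d c.1 = 0 from c.2).trans (map_zero (chainEquiv X n)).symm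
  · intro x
    rw [LinearMap.comp_apply, Submodule.mkQ_apply, Submodule.Quotient.mk_eq_zero]
    change (ψ0 x).1 ∈ LinearMap.range d ↔ _
    constructor
    · rintro ⟨e, he⟩
      refine ⟨(chainEquiv X (n + 2)).symm e, (chainEquiv X (n + 1)).injective ?_⟩
      refine (chainEquiv_d (n + 1) _).trans ?_
      rw [LinearEquiv.apply_symm_apply, he]
      rfl
    · rintro ⟨y, hy⟩
      refine ⟨chainEquiv X (n + 2) y, (chainEquiv_d (n + 1) _).symm.trans ?_⟩
      exact congrArg (chainEquiv X (n + 1)) hy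

lemma betti_zero : betti X 0 = Module.finrank (ZMod 2) (H0 X) := by
  let K := singularChainComplex (ZMod 2) X
  let T := K.sc' 1 0 0
  have hT : betti X 0 = Module.finrank (ZMod 2) T.homology :=
    ((ShortComplex.homologyMapIso (K.isoSc' 1 0 0 (by simp) (by simp))).toLinearEquiv).finrank_eq
  rw [hT]
  have hg : T.g = 0 := K.shape _ _ (by simp)
  refine finrank_homology_eq T ((LinearMap.range (d : Ch 2 X →ₗ[ZMod 2] Ch 1 X)).mkQ ∘ₗ
    (chainEquiv X 0).toLinearMap ∘ₗ (LinearMap.ker T.g.hom).subtype) ?_ ?_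
  · refine (Submodule.mkQ_surjective _).comp fun c => ?_
    refine ⟨⟨(chainEquiv X 0).symm c, ?_⟩, (chainEquiv X 0).apply_symm_apply _⟩
    rw [hg]
    rfl
  · intro x
    rw [LinearMap.comp_apply, Submodule.mkQ_apply, Submodule.Quotient.mk_eq_zero]
    constructor
    · rintro ⟨e, he⟩
      refine ⟨(chainEquiv X 1).symm e, (chainEquiv X 0).injective ?_⟩
      refine (chainEquiv_d 0 _).trans ?_
      rw [LinearEquiv.apply_symm_apply, he]
      rfl
    · rintro ⟨y, hy⟩
      refine ⟨chainEquiv X 1 y, (chainEquiv_d 0 _).symm.trans ?_⟩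
      exact congrArg (chainEquiv X 0) hy

end SurfT3

namespace SurfT3

/-! ### Neighbourhood retractions -/

variable {X Y W : Type} [TopologicalSpace X] [TopologicalSpace Y] [TopologicalSpace W]

/-- A partial retraction onto an embedded subspace. -/
structure PartialRetr (ι : X → Y) (K : Set Y) (F : Y → X) : Prop where
  closed : IsClosed K
  range_subset : Set.range ι ⊆ K
  cont : ContinuousOn F K
  left_inv : ∀ z, F (ι z) = z

open Topology in
lemma PartialRetr.extend [NormalSpace Y] {n : ℕ} {ι : X → Y} (hι : IsClosedEmbedding ι)
    {K : Set Y} {F : Y → X} (h : PartialRetr ι K F) {j : C(E n, X)} (hj : IsOpenEmbedding j)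
    {D : Set X} (hD : IsClosed D) (hDj : D ⊆ Set.range j) :
    ∃ P F', PartialRetr ι (K ∪ P) F' ∧ ∀ z ∈ D, P ∈ 𝓝 (ι z) := by
  classical
  obtain ⟨O, hO, hKO⟩ := (continuousOn_iff'.1 h.cont) _ hj.isOpen_range
  have hDO : ι '' D ⊆ O := by
    rintro _ ⟨z, hz, rfl⟩
    have : ι z ∈ F ⁻¹' Set.range j ∩ K :=
      ⟨by rw [Set.mem_preimage, h.left_inv]; exact hDj hz, h.range_subset ⟨z, rfl⟩⟩
    rw [hKO] at this
    exact this.1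
  obtain ⟨U, hU, hDU, hUO⟩ := normal_exists_closure_subset (hι.isClosedMap _ hD) hO hDO
  have hmaps : ∀ x : ↥(K ∩ closure U), F x ∈ Set.range j := by
    rintro ⟨x, hx, hx'⟩
    have : x ∈ O ∩ K := ⟨hUO hx', hx⟩
    rw [← hKO] at this
    exact this.1
  let e := hj.isEmbedding.toHomeomorph
  let g0 : C(↥(K ∩ closure U), E n) :=
    ⟨fun x => e.symm ⟨F x, hmaps x⟩, e.symm.continuous.comp
      ((continuousOn_iff_continuous_domRestrict.1
        (h.cont.mono Set.inter_subset_left)).subtype_mk _)⟩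
  obtain ⟨G, hG⟩ := ContinuousMap.exists_restrict_eq (h.closed.inter isClosed_closure) g0
  have hjG : ∀ x ∈ K, x ∈ closure U → j (G x) = F x := by
    intro x hx hx'
    have h1 : G x = g0 ⟨x, hx, hx'⟩ := by rw [← hG]; rfl
    rw [h1]
    exact congrArg Subtype.val (e.apply_symm_apply ⟨F x, hmaps ⟨x, hx, hx'⟩⟩)
  refine ⟨closure U, fun x => if x ∈ K then F x else j (G x), ⟨h.closed.union isClosed_closure,
    h.range_subset.trans Set.subset_union_left, ContinuousOn.union_of_isClosed ?_ ?_ h.closed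
      isClosed_closure, fun z => ?_⟩, fun z hz => ?_⟩
  · exact h.cont.congr fun x hx => if_pos hx
  · refine (j.continuous.comp G.continuous).continuousOn.congr fun x hx => ?_
    by_cases hxK : x ∈ K
    · exact (if_pos hxK).trans (hjG x hxK hx).symm
    · exact if_neg hxK
  · rw [if_pos (h.range_subset ⟨z, rfl⟩), h.left_inv]
  · exact Filter.mem_of_superset (hU.mem_nhds (hDU ⟨z, hz, rfl⟩)) subset_closure

open Topology in
/-- A compact manifold embedded in a normal space is a neighbourhood retract. -/
theorem LocEuc.exists_retraction [NormalSpace Y] [CompactSpace X] [T2Space X] {n : ℕ}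
    (hX : LocEuc n X) {ι : X → Y} (hι : IsClosedEmbedding ι) :
    ∃ (N : Set Y) (r : C(N, X)), IsOpen N ∧ Set.range ι ⊆ N ∧
      ∀ z (h : ι z ∈ N), r ⟨ι z, h⟩ = z := by
  classical
  rcases isEmpty_or_nonempty X with hE | hE
  · refine ⟨∅, ⟨fun x => x.2.elim, continuous_of_const fun x => x.2.elim⟩, isOpen_empty, ?_,
      fun z => isEmptyElim z⟩
    rintro _ ⟨z, rfl⟩
    exact isEmptyElim z
  choose j hj hjx using hX
  choose a ha using hjx
  let D : X → Set X := fun x => j x '' Metric.closedBall (a x) 1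
  have hDc : ∀ x, IsClosed (D x) := fun x =>
    ((isCompact_closedBall _ _).image (j x).continuous).isClosed
  have hDn : ∀ x, D x ∈ 𝓝 x := fun x => by
    have := (hj x).isOpenMap.image_mem_nhds (Metric.closedBall_mem_nhds (a x) one_pos)
    rwa [ha] at this
  obtain ⟨s, hs⟩ := isCompact_univ.elim_nhds_subcover D fun x _ => hDn x
  have key : ∀ s : Finset X, ∃ K F, PartialRetr ι K F ∧ ∀ x ∈ s, ∀ z ∈ D x, K ∈ 𝓝 (ι z) := by
    intro s
    induction s using Finset.induction_on with
    | empty =>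
      refine ⟨Set.range ι, Function.invFun ι, ⟨hι.isClosed_range, subset_rfl, ?_,
        Function.leftInverse_invFun hι.injective⟩, by simp⟩
      rw [continuousOn_iff_continuous_domRestrict,
        ← hι.isEmbedding.toHomeomorph.comp_continuous_iff']
      refine continuous_id.congr fun z => ?_
      exact (Function.leftInverse_invFun hι.injective z).symm
    | insert x s _ ih =>
      obtain ⟨K, F, h, hK⟩ := ih
      obtain ⟨P, F', h', hP⟩ := h.extend hι (hj x) (hDc x) (Set.image_subset_range _ _)
      refine ⟨K ∪ P, F', h', fun y hy z hz => ?_⟩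
      rcases Finset.mem_insert.1 hy with rfl | hy
      · exact Filter.mem_of_superset (hP z hz) Set.subset_union_right
      · exact Filter.mem_of_superset (hK y hy z hz) Set.subset_union_left
  obtain ⟨K, F, h, hK⟩ := key s
  refine ⟨interior K, ⟨(interior K).domRestrict F, continuousOn_iff_continuous_domRestrict.1
    (h.cont.mono interior_subset)⟩, isOpen_interior, ?_, fun z _ => h.left_inv z⟩
  rintro _ ⟨z, rfl⟩
  obtain ⟨x, hx, hz⟩ := Set.mem_iUnion₂.1 (hs.2 (Set.mem_univ z))
  exact mem_interior_iff_mem_nhds.2 (hK x hx z hz)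

end SurfT3

namespace SurfT3

/-! ### Cap products -/

variable {X Y W : Type} [TopologicalSpace X] [TopologicalSpace Y] [TopologicalSpace W]

/-- The linear map determined by its values on generators. -/
noncomputable def linC {n : ℕ} {M : Type} [AddCommMonoid M] [Module (ZMod 2) M]
    (f : Sing n X → M) : Ch n X →ₗ[ZMod 2] M :=
  Finsupp.linearCombination (ZMod 2) f

@[simp] lemma linC_gen {n : ℕ} {M : Type} [AddCommMonoid M] [Module (ZMod 2) M]
    (f : Sing n X → M) (σ : Sing n X) : linC f (gen σ) = f σ := by
  simp [linC]

lemma mem_of_support {n : ℕ} {M : Type} [AddCommMonoid M] [Module (ZMod 2) M]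
    {f : Ch n X →ₗ[ZMod 2] M} {N : Submodule (ZMod 2) M} {c : Ch n X}
    (h : ∀ σ ∈ c.support, f (gen σ) ∈ N) : f c ∈ N :=
  SP_le_comap (P := (c.support : Set (Sing n X))) h ((Finsupp.mem_supported _ _).2 (subset_refl _))

/-- Evaluation of a function on chains of points. -/
noncomputable def ev (h : X → ZMod 2) : Ch 1 X →ₗ[ZMod 2] ZMod 2 := linC fun τ => h (vtx τ 0)

@[simp] lemma ev_pnt (h : X → ZMod 2) (x : X) : ev h (pnt x) = h x := by
  rw [ev, pnt, linC_gen]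
  rfl

/-- Multiplication of chains by a function of the initial vertex. -/
noncomputable def capf {n : ℕ} (h : X → ZMod 2) : Ch (n + 1) X →ₗ[ZMod 2] Ch (n + 1) X :=
  linC fun σ => h (vtx σ 0) • gen σ

/-- The cap product of a cochain with a chain. -/
noncomputable def cap (x : Ch 2 X →ₗ[ZMod 2] ZMod 2) : Ch 3 X →ₗ[ZMod 2] Ch 2 X :=
  linC fun σ => x (gen (σ.comp (face 2))) • gen (σ.comp (face 0))

/-- The cap product of a cochain with a chain of paths. -/
noncomputable def capOne (x : Ch 2 X →ₗ[ZMod 2] ZMod 2) : Ch 2 X →ₗ[ZMod 2] Ch 1 X :=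
  linC fun τ => x (gen τ) • pnt (vtx τ 1)

/-- The product of two cochains. -/
noncomputable def cupOne (x y : Ch 2 X →ₗ[ZMod 2] ZMod 2) : Ch 2 X →ₗ[ZMod 2] ZMod 2 :=
  linC fun τ => x (gen τ) * y (gen τ)

/-- Cocycles on paths. -/
def IsCoc (x : Ch 2 X →ₗ[ZMod 2] ZMod 2) : Prop := ∀ c : Ch 3 X, x (d c) = 0

lemma IsCoc.eq {x : Ch 2 X →ₗ[ZMod 2] ZMod 2} (hx : IsCoc x) (σ : Sing 3 X) :
    x (gen (σ.comp (face 0))) + x (gen (σ.comp (face 1))) + x (gen (σ.comp (face 2))) = 0 := by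
  have := hx (gen σ)
  rwa [d_gen, Fin.sum_univ_three, map_add, map_add] at this

lemma d_cap {x : Ch 2 X →ₗ[ZMod 2] ZMod 2} (hx : IsCoc x) (c : Ch 3 X) :
    d (cap x c) = capOne x (d c) := by
  refine LinearMap.congr_fun (f := d ∘ₗ cap x) (g := capOne x ∘ₗ d) (ch_hom_ext fun σ => ?_) c
  have h := hx.eq σ
  rw [LinearMap.comp_apply, LinearMap.comp_apply, cap, linC_gen, map_smul, d_gen_two, d_gen,
    Fin.sum_univ_three, map_add, map_add, capOne, linC_gen, linC_gen, linC_gen]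
  simp only [vtx_face]
  have h0 : (0 : Fin 3).succAbove (0 : Fin 2) = 1 := rfl
  have h1 : (0 : Fin 3).succAbove (1 : Fin 2) = 2 := rfl
  have h2 : (1 : Fin 3).succAbove (1 : Fin 2) = 2 := rfl
  have h3 : (2 : Fin 3).succAbove (1 : Fin 2) = 1 := rfl
  rw [h0, h1, h2, h3, ← add_smul, smul_add, add_comm]
  congr 2
  revert h
  generalize x (gen (σ.comp (face 0))) = a
  generalize x (gen (σ.comp (face 1))) = b
  generalize x (gen (σ.comp (face 2))) = e
  revert a b e
  decide

lemma cap_comm {x y : Ch 2 X →ₗ[ZMod 2] ZMod 2} (hx : IsCoc x) (hy : IsCoc y) (c : Ch 3 X) :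
    y (cap x c) + x (cap y c) = cupOne x y (d c) := by
  refine LinearMap.congr_fun (f := y ∘ₗ cap x + x ∘ₗ cap y) (g := cupOne x y ∘ₗ d)
    (ch_hom_ext fun σ => ?_) c
  have h := hx.eq σ
  have h' := hy.eq σ
  rw [LinearMap.add_apply, LinearMap.comp_apply, LinearMap.comp_apply, LinearMap.comp_apply, cap,
    cap, linC_gen, linC_gen, map_smul, map_smul, d_gen, Fin.sum_univ_three, map_add, map_add,
    cupOne, linC_gen, linC_gen, linC_gen, smul_eq_mul, smul_eq_mul]
  revert h h'
  generalize x (gen (σ.comp (face 0))) = a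
  generalize x (gen (σ.comp (face 1))) = b
  generalize x (gen (σ.comp (face 2))) = e
  generalize y (gen (σ.comp (face 0))) = a'
  generalize y (gen (σ.comp (face 1))) = b'
  generalize y (gen (σ.comp (face 2))) = e'
  revert a b e a' b' e'
  decide

lemma d_capf_gen (h : X → ZMod 2) (σ : Sing 3 X) :
    d (capf h (gen σ)) + capf h (d (gen σ)) =
      (h (vtx σ 0) + h (vtx σ 1)) • gen (σ.comp (face 0)) := by
  rw [capf, capf, linC_gen, map_smul, d_gen, Fin.sum_univ_three, map_add, map_add, linC_gen,
    linC_gen, linC_gen]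
  simp only [vtx_face]
  have h0 : (0 : Fin 3).succAbove (0 : Fin 2) = 1 := rfl
  have h1 : (1 : Fin 3).succAbove (0 : Fin 2) = 0 := rfl
  have h2 : (2 : Fin 3).succAbove (0 : Fin 2) = 0 := rfl
  rw [h0, h1, h2, add_smul, smul_add, smul_add]
  generalize h (vtx σ 0) • gen (σ.comp (face 1)) = a
  generalize h (vtx σ 0) • gen (σ.comp (face 2)) = b
  have ha := add_self_eq a
  have hb := add_self_eq b
  calc _ = h (vtx σ 0) • gen (σ.comp (face 0)) + h (vtx σ 1) • gen (σ.comp (face 0))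
      + (a + a) + (b + b) := by abel
    _ = _ := by rw [ha, hb, add_zero, add_zero]

/-- On a Euclidean chart a cocycle is a coboundary. -/
lemma IsCoc.exists_primitive {x : Ch 2 X →ₗ[ZMod 2] ZMod 2} (hx : IsCoc x) {n : ℕ}
    {j : C(E n, X)} (hj : Topology.IsEmbedding j) :
    ∃ h : X → ZMod 2, ∀ c ∈ S 2 (Set.range j), x c = ev h (d c) := by
  refine ⟨fun p => x (push j (cone (vecContr 0) (pnt (Function.invFun j p)))), fun c hc => ?_⟩
  rw [← Set.image_univ] at hc
  obtain ⟨c, -, rfl⟩ := exists_push_eq hj hc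
  have h1 : x (push j c) = x (push j (cone (vecContr 0) (d c))) := by
    have := hx (push j (cone (vecContr 0) c))
    rw [d_push, d_cone, map_add, map_add] at this
    exact eq_of_add_eq_zero this
  rw [h1, d_push]
  generalize d c = b
  set h : X → ZMod 2 := fun p => x (push j (cone (vecContr 0) (pnt (Function.invFun j p)))) with hh
  refine LinearMap.congr_fun (f := x ∘ₗ push j ∘ₗ cone (vecContr 0)) (g := ev h ∘ₗ push j)
    (ch_hom_ext fun τ => ?_) b
  simp only [LinearMap.comp_apply]
  rw [gen_one_eq_vtx, push_pnt, ev_pnt, hh]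
  simp only
  rw [Function.leftInverse_invFun hj.injective]

/-- Two points in the image of a simplex are joined by a path in it. -/
lemma exists_path_in {n : ℕ} (σ : Sing (n + 1) X) (s t : Simp (n + 1)) :
    ∃ c ∈ S 2 (Set.range σ), d c = pnt (σ s) + pnt (σ t) := by
  refine ⟨push σ (cone (simpContr n) (pnt s) + cone (simpContr n) (pnt t)), ?_, ?_⟩
  · exact push_mem_S (U := Set.univ) (fun x _ => Set.mem_range_self x) (S_univ _)
  · have h : ∀ s : Simp (n + 1), d (pnt s) = d (pnt t) := fun s => by
      rw [pnt, pnt, d_gen, d_gen]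
      refine Finset.sum_congr rfl fun i _ => ?_
      congr 1
      exact Subsingleton.elim _ _
    rw [d_push, map_add, d_cone, d_cone, h s, add_add_add_comm, add_self_eq, add_zero, map_add,
      push_pnt, push_pnt]

end SurfT3

namespace SurfT3

/-! ### Nondegeneracy of the intersection pairing -/

variable {X Y W : Type} [TopologicalSpace X] [TopologicalSpace Y] [TopologicalSpace W]

/-- A cocycle with a locally defined primitive kills all cycles. -/
lemma IsCoc.kills_of_primitive {x : Ch 2 X →ₗ[ZMod 2] ZMod 2} (hx : IsCoc x) {u : X → ZMod 2}
    (hu : ∀ z, ∃ O, IsOpen O ∧ z ∈ O ∧ ∀ c ∈ S 2 O, x c = ev u (d c)) {c : Ch 2 X}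
    (hc : d c = 0) : x c = 0 := by
  choose O hO hz h using hu
  obtain ⟨m, hm⟩ := exists_iter_Sd_small (n := 1) hO (fun z (_ : z ∈ Set.univ) => ⟨z, hz z⟩)
    (S_univ c)
  have h1 : x (Sd^[m] c) = ev u (d (Sd^[m] c)) := by
    refine SP_induction (p := fun c => x c = ev u (d c)) (hm m le_rfl) (by simp) ?_ ?_
    · rintro σ ⟨z, hσ⟩
      exact h z _ (gen_mem_S hσ)
    · intro a b ha hb
      rw [map_add, map_add, map_add, ha, hb]
  rw [d_iter_Sd, hc, iter_Sd_zero, map_zero] at h1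
  have h2 := hx (ThI m c)
  rw [d_ThI, hc, map_add, map_add, h1] at h2
  have h3 : (ThI m (0 : Ch 1 X)) = 0 := by
    refine Submodule.mem_bot (ZMod 2) |>.1 ?_
    have := ThI_mem_S (U := (∅ : Set X)) m (Submodule.zero_mem (S 1 (∅ : Set X)))
    rw [S_empty this]
    exact Submodule.zero_mem _
  rwa [h3, map_zero, add_zero, add_zero] at h2

section nondeg

variable [T2Space X] (hX : LocEuc 2 X) {ζ : Ch 3 X} (hd : d ζ = 0) (hval : ∀ z, val z ζ = 1)
  {x : Ch 2 X →ₗ[ZMod 2] ZMod 2} (hx : IsCoc x) {e : Ch 3 X} (he : d e = cap x ζ)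
include hX hd hval hx he

omit [T2Space X] hX hval hx in
lemma rel_capf {z : X} {U : Set X} (hs : ∀ σ ∈ ζ.support, z ∈ Set.range σ → Set.range σ ⊆ U)
    {h : X → ZMod 2} (hh : ∀ c ∈ S 2 U, x c = ev h (d c)) : Rel {z} (e + capf h ζ) := by
  have key : (cap x + d ∘ₗ capf h + capf h ∘ₗ d : Ch 3 X →ₗ[ZMod 2] Ch 2 X) ζ ∈
      S 2 ({z}ᶜ : Set X) := by
    refine mem_of_support fun σ hσ => ?_
    have h1 : (cap x + d ∘ₗ capf h + capf h ∘ₗ d : Ch 3 X →ₗ[ZMod 2] Ch 2 X) (gen σ) =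
        (x (gen (σ.comp (face 2))) + (h (vtx σ 0) + h (vtx σ 1))) • gen (σ.comp (face 0)) := by
      rw [add_smul, ← d_capf_gen, LinearMap.add_apply, LinearMap.add_apply, add_assoc, cap,
        linC_gen]
      rfl
    rw [h1]
    by_cases hz : z ∈ Set.range σ
    · have hU := hs σ hσ hz
      have h2 := hh (gen (σ.comp (face 2))) (gen_mem_S fun t => hU ⟨_, rfl⟩)
      rw [d_gen_two, map_add, ev_pnt, ev_pnt, vtx_face, vtx_face] at h2
      rw [h2]
      have : h (vtx σ ((2 : Fin 3).succAbove (0 : Fin 2))) +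
          h (vtx σ ((2 : Fin 3).succAbove (1 : Fin 2))) + (h (vtx σ 0) + h (vtx σ 1)) = 0 :=
        add_self_eq _
      rw [this, zero_smul]
      exact Submodule.zero_mem _
    · refine Submodule.smul_mem _ _ (gen_mem_S fun t ht => hz ⟨face 0 t, ht⟩)
  rw [Rel, map_add, he]
  simp only [LinearMap.add_apply, LinearMap.comp_apply, hd, map_zero, add_zero] at key
  exact key

omit hx in
lemma val_capf {z : X} {U V : Set X} (hs : ∀ σ ∈ ζ.support, z ∈ Set.range σ → Set.range σ ⊆ U)
    (hs' : ∀ σ ∈ ζ.support, z ∈ Set.range σ → Set.range σ ⊆ V)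
    {h k : X → ZMod 2} (hh : ∀ c ∈ S 2 U, x c = ev h (d c)) (hk : ∀ c ∈ S 2 V, x c = ev k (d c)) :
    val z (e + capf k ζ) + k z = val z (e + capf h ζ) + h z := by
  have h1 : Null {z} (e + capf k ζ + (e + capf h ζ + (h z + k z) • ζ)) := by
    refine null_of_mem ?_
    have key : (capf k + capf h + (h z + k z) • LinearMap.id : Ch 3 X →ₗ[ZMod 2] Ch 3 X) ζ ∈
        S 3 ({z}ᶜ : Set X) := by
      refine mem_of_support fun σ hσ => ?_
      have h1 : (capf k + capf h + (h z + k z) • LinearMap.id : Ch 3 X →ₗ[ZMod 2] Ch 3 X) (gen σ) =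
          (k (vtx σ 0) + h (vtx σ 0) + (h z + k z)) • gen σ := by
        rw [add_smul _ _ (gen σ), add_smul _ _ (gen σ), LinearMap.add_apply, LinearMap.add_apply,
          capf, capf, linC_gen, linC_gen, LinearMap.smul_apply, LinearMap.id_apply]
      rw [h1]
      by_cases hz : z ∈ Set.range σ
      · obtain ⟨t, ht⟩ := hz
        obtain ⟨c, hc, hdc⟩ := exists_path_in σ (stdSimplex.vertex 0) t
        have e1 := hh c (S_mono (hs σ hσ ⟨t, ht⟩) hc)
        have e2 := hk c (S_mono (hs' σ hσ ⟨t, ht⟩) hc)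
        rw [e1, hdc, map_add, map_add, ev_pnt, ev_pnt, ev_pnt, ev_pnt, ht] at e2
        change h (vtx σ 0) + h z = k (vtx σ 0) + k z at e2
        have : k (vtx σ 0) + h (vtx σ 0) + (h z + k z) = 0 := by
          calc _ = k (vtx σ 0) + k z + (h (vtx σ 0) + h z) := by ring
            _ = 0 := by rw [e2, add_self_eq]
        rw [this, zero_smul]
        exact Submodule.zero_mem _
      · exact Submodule.smul_mem _ _ (gen_mem_S fun t ht => hz ⟨t, ht⟩)
    convert key using 1
    simp only [LinearMap.add_apply, LinearMap.smul_apply, LinearMap.id_apply]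
    have := add_self_eq e
    calc _ = e + e + (capf k ζ + capf h ζ + (h z + k z) • ζ) := by abel
      _ = _ := by rw [this, zero_add]
  rw [val_congr h1, val_add hX.uniqPt (rel_capf hd he hs hh)
    (rel_of_d_eq_zero (by rw [map_smul, hd, smul_zero]) _)]
  have h2 : val z ((h z + k z) • ζ) = h z + k z := by
    generalize h z + k z = r
    have : r = 0 ∨ r = 1 := by revert r; decide
    rcases this with rfl | rfl
    · rw [zero_smul]
      exact val_eq_zero.2 null_zero
    · rw [one_smul, hval]
  rw [h2]
  have := add_self_eq (k z)
  linear_combination this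

/-- Nondegeneracy of the intersection pairing. -/
theorem nondeg
    (hs : ∀ z, ∃ j : C(E 2, X), Topology.IsOpenEmbedding j ∧ z ∈ Set.range j ∧
      ∀ σ ∈ ζ.support, z ∈ Set.range σ → Set.range σ ⊆ Set.range j)
    {c : Ch 2 X} (hc : d c = 0) : x c = 0 := by
  choose j hj hz hs using hs
  choose h hh using fun z => hx.exists_primitive (hj z).isEmbedding
  refine hx.kills_of_primitive (u := fun z => val z (e + capf (h z) ζ) + h z z) (fun z => ?_) hc
  have hcl : ∀ᶠ z' in nhds z, ∀ σ ∈ ζ.support, z' ∈ Set.range σ → z ∈ Set.range σ := by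
    refine (Filter.eventually_all_finset _).2 fun σ _ => ?_
    by_cases hzσ : z ∈ Set.range σ
    · exact Filter.Eventually.of_forall fun _ _ => hzσ
    · have : IsClosed (Set.range σ) := (isCompact_range σ.continuous).isClosed
      filter_upwards [this.isOpen_compl.mem_nhds hzσ] with z' h1 h2
      exact absurd h2 h1
  have hev := hX.eventually_val (rel_capf hd he (hs z) (hh z))
  obtain ⟨O, hO, hOo, hzO⟩ := mem_nhds_iff.1
    (hcl.and (hev.and ((hj z).isOpen_range.mem_nhds (hz z))))
  refine ⟨O, hOo, hzO, fun c hc => ?_⟩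
  rw [hh z c (S_mono (fun y hy => (hO hy).2.2) hc)]
  refine S_induction (p := fun c => ev (h z) (d c) =
    ev (fun z => val z (e + capf (h z) ζ) + h z z) (d c)) hc (by simp)
    (fun τ hτ => ?_) (fun a b ha hb => by
    rw [map_add, map_add, map_add, ha, hb])
  have key : ∀ y ∈ O, val y (e + capf (h y) ζ) + h y y =
      val z (e + capf (h z) ζ) + h z y := fun y hy => by
    obtain ⟨h1, h2, h3⟩ := hO hy
    rw [val_capf hX hd hval he (fun σ hσ hyσ => hs z σ hσ (h1 σ hσ hyσ)) (hs y) (hh z) (hh y),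
      h2.2]
  rw [d_gen_two, map_add, map_add, ev_pnt, ev_pnt, ev_pnt, ev_pnt, key (vtx τ 0) (hτ _),
    key (vtx τ 1) (hτ _)]
  have := add_self_eq (val z (e + capf (h z) ζ))
  linear_combination - this

end nondeg

end SurfT3

namespace SurfT3

/-! ### A criterion for the parity of the first Betti number -/

variable {X Y W : Type} [TopologicalSpace X] [TopologicalSpace Y] [TopologicalSpace W]

/-- A space carrying a nondegenerate alternating form has even dimension. -/
lemma even_finrank_of_alt {K : Type*} [Field K] (n : ℕ) :
    ∀ {V : Type} [AddCommGroup V] [Module K V] (β : V →ₗ[K] V →ₗ[K] K), (∀ v, β v v = 0) →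
      (∀ v, (∀ w, β v w = 0) → v = 0) → Module.finrank K V = n → Even n := by
  induction n using Nat.strong_induction_on with
  | _ n ih =>
  intro V _ _ β halt hnd hn
  rcases Nat.eq_zero_or_pos n with rfl | hpos
  · exact Even.zero
  have hfin : FiniteDimensional K V := Module.finite_of_finrank_pos (by omega)
  have hnt : Nontrivial V := Module.nontrivial_of_finrank_pos (R := K) (by omega)
  have hskew : ∀ v w, β v w = - β w v := fun v w => by
    have := halt (v + w)
    simp only [map_add, LinearMap.add_apply, halt, zero_add, add_zero] at this
    exact eq_neg_of_add_eq_zero_right this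
  obtain ⟨x, hx⟩ := exists_ne (0 : V)
  obtain ⟨y, hy⟩ : ∃ y, β x y = 1 := by
    by_contra! h
    refine hx (hnd x fun w => ?_)
    by_contra hw
    refine h ((β x w)⁻¹ • w) ?_
    rw [map_smul, smul_eq_mul, inv_mul_cancel₀ hw]
  have hyx : β y x = -1 := by rw [hskew, hy]
  set f : V →ₗ[K] K × K := (β x).prod (β y) with hf
  have hsurj : LinearMap.range f = ⊤ := by
    rw [LinearMap.range_eq_top]
    rintro ⟨a, b⟩
    refine ⟨a • y - b • x, ?_⟩
    simp [hf, hy, hyx, halt]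
  have hdim := LinearMap.finrank_range_add_finrank_ker f
  rw [hsurj, finrank_top, Module.finrank_prod, Module.finrank_self, hn] at hdim
  have := ih (n - 2) (by omega) (V := LinearMap.ker f)
    ((β.compl₁₂ (LinearMap.ker f).subtype (LinearMap.ker f).subtype))
    (fun v => halt _) (fun v hv => ?_) (by omega)
  · obtain ⟨m, hm⟩ := this
    exact ⟨m + 1, by omega⟩
  · refine Subtype.ext (hnd v.1 fun w => ?_)
    have hvx : β x v = 0 := congrArg Prod.fst v.2
    have hvy : β y v = 0 := congrArg Prod.snd v.2
    have hw : w - β x w • y + β y w • x ∈ LinearMap.ker f := by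
      simp [hf, hy, hyx, halt]
    have := hv ⟨_, hw⟩
    change β v (w - β x w • y + β y w • x) = 0 at this
    simp only [map_add, map_sub, map_smul, hskew v.1 y, hskew v.1 x, hvx, hvy] at this
    simpa using this

lemma cap_add (x y : Ch 2 X →ₗ[ZMod 2] ZMod 2) (c : Ch 3 X) :
    cap (x + y) c = cap x c + cap y c := by
  refine LinearMap.congr_fun (f := cap (x + y)) (g := cap x + cap y) (ch_hom_ext fun σ => ?_) c
  rw [LinearMap.add_apply, cap, cap, cap, linC_gen, linC_gen, linC_gen, LinearMap.add_apply,
    add_smul]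

lemma cap_smul (r : ZMod 2) (x : Ch 2 X →ₗ[ZMod 2] ZMod 2) (c : Ch 3 X) :
    cap (r • x) c = r • cap x c := by
  refine LinearMap.congr_fun (f := cap (r • x)) (g := r • cap x) (ch_hom_ext fun σ => ?_) c
  rw [LinearMap.smul_apply, cap, cap, linC_gen, linC_gen, LinearMap.smul_apply, smul_smul,
    smul_eq_mul]

/-- The pairing of cochains defined by a chain. -/
noncomputable def capPair (ζ : Ch 3 X) : (Ch 2 X →ₗ[ZMod 2] ZMod 2) →ₗ[ZMod 2]
    (Ch 2 X →ₗ[ZMod 2] ZMod 2) →ₗ[ZMod 2] ZMod 2 :=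
  LinearMap.mk₂ (ZMod 2) (fun x y => y (cap x ζ))
    (fun x x' y => by rw [cap_add, map_add]) (fun r x y => by rw [cap_smul, map_smul])
    (fun x y y' => rfl) (fun r x y => rfl)

lemma capPair_apply (ζ : Ch 3 X) (x y : Ch 2 X →ₗ[ZMod 2] ZMod 2) :
    capPair ζ x y = y (cap x ζ) := rfl

lemma capPair_comm {ζ : Ch 3 X} (hd : d ζ = 0) {x y : Ch 2 X →ₗ[ZMod 2] ZMod 2} (hx : IsCoc x)
    (hy : IsCoc y) : capPair ζ x y = capPair ζ y x := by
  have := cap_comm hx hy ζ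
  rw [hd, map_zero] at this
  exact eq_of_add_eq_zero this

lemma exists_d_eq_of_kills {b : Ch 2 X} (h : ∀ y, IsCoc y → y b = 0) : ∃ e : Ch 3 X, d e = b := by
  by_contra hb
  obtain ⟨f, hf, hr⟩ := Submodule.exists_le_ker_of_notMem (K := ZMod 2)
    (p := LinearMap.range (d : Ch 3 X →ₗ[ZMod 2] Ch 2 X)) (v := b) (by simpa using hb)
  exact hf (h f fun c => hr ⟨c, rfl⟩)

/-- If the self-intersection form is represented by an isotropic class, then the first Betti
number is even. -/
theorem even_finrank_HH_one [T2Space X] (hX : LocEuc 2 X) {ζ : Ch 3 X} (hd : d ζ = 0)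
    (hval : ∀ z, val z ζ = 1)
    (hs : ∀ z, ∃ j : C(E 2, X), Topology.IsOpenEmbedding j ∧ z ∈ Set.range j ∧
      ∀ σ ∈ ζ.support, z ∈ Set.range σ → Set.range σ ⊆ Set.range j)
    {w : Ch 2 X →ₗ[ZMod 2] ZMod 2} (hw : IsCoc w) (hww : capPair ζ w w = 0)
    (hxx : ∀ x, IsCoc x → capPair ζ x x = capPair ζ x w) :
    Even (Module.finrank (ZMod 2) (HH 1 X)) := by
  obtain ⟨P, hP⟩ : ∃ P : Ch 2 X →ₗ[ZMod 2] Zc 1 X, P ∘ₗ (Zc 1 X).subtype = LinearMap.id :=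
    LinearMap.exists_leftInverse_of_injective _ (Submodule.ker_subtype _)
  have hPz : ∀ z : Zc 1 X, P z.1 = z := fun z => LinearMap.congr_fun hP z
  set s : Module.Dual (ZMod 2) (HH 1 X) →ₗ[ZMod 2] Ch 2 X →ₗ[ZMod 2] ZMod 2 :=
    ((Bc 1 X).mkQ ∘ₗ P).dualMap with hs_def
  have hsz : ∀ f (z : Zc 1 X), s f z.1 = f ((Bc 1 X).mkQ z) := fun f z => by
    change f ((Bc 1 X).mkQ (P z.1)) = _
    rw [hPz]
  have hsc : ∀ f, IsCoc (s f) := fun f c => by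
    have h1 : (Bc 1 X).mkQ ⟨d c, d_d c⟩ = 0 := by
      rw [Submodule.mkQ_apply, Submodule.Quotient.mk_eq_zero]
      exact ⟨c, rfl⟩
    have := hsz f ⟨d c, d_d c⟩
    rw [h1, map_zero] at this
    exact this
  have hcyc : ∀ x, IsCoc x → d (cap x ζ) = 0 := fun x hx => by rw [d_cap hx, hd, map_zero]
  set β : Module.Dual (ZMod 2) (HH 1 X) →ₗ[ZMod 2] Module.Dual (ZMod 2) (HH 1 X) →ₗ[ZMod 2]
      ZMod 2 := LinearMap.mk₂ (ZMod 2) (fun f g =>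
        capPair ζ (s f) (s g) + capPair ζ (s f) w * capPair ζ (s g) w)
      (fun f f' g => by simp only [map_add, LinearMap.add_apply]; ring)
      (fun r f g => by simp only [map_smul, LinearMap.smul_apply, smul_eq_mul]; ring)
      (fun f g g' => by simp only [map_add, LinearMap.add_apply]; ring)
      (fun r f g => by simp only [map_smul, LinearMap.smul_apply, smul_eq_mul]; ring) with hβ
  have hβa : ∀ f g, β f g = capPair ζ (s f) (s g) + capPair ζ (s f) w * capPair ζ (s g) w :=
    fun _ _ => rfl
  rw [← Subspace.dual_finrank_eq]
  refine even_finrank_of_alt _ β (fun f => ?_) (fun f hf => ?_) rfl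
  · rw [hβa, hxx _ (hsc f)]
    generalize capPair ζ (s f) w = a
    revert a
    decide
  · have hall : ∀ y, IsCoc y →
        capPair ζ (s f) y + capPair ζ (s f) w * capPair ζ y w = 0 := fun y hy => by
      obtain ⟨g, hg⟩ : ∃ g : Module.Dual (ZMod 2) (HH 1 X), ∀ z : Zc 1 X,
          g ((Bc 1 X).mkQ z) = y z.1 := by
        refine ⟨(Bc 1 X).liftQ (y ∘ₗ (Zc 1 X).subtype) ?_, fun z => rfl⟩
        rintro z ⟨c, hc⟩
        change y z.1 = 0
        change d c = z.1 at hc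
        rw [← hc]
        exact hy c
      have hk : ∀ x, IsCoc x → capPair ζ x y = capPair ζ x (s g) := fun x hx => by
        rw [capPair_apply, capPair_apply]
        have := hsz g ⟨cap x ζ, hcyc x hx⟩
        rw [hg] at this
        exact this.symm
      have := hf g
      rw [hβa] at this
      rw [hk _ (hsc f), capPair_comm hd hy hw, hk _ hw, capPair_comm hd hw (hsc g)]
      exact this
    have h0 : capPair ζ (s f) w = 0 := by
      have := hall w hw
      rwa [hww, mul_zero, add_zero] at this
    obtain ⟨e, he⟩ := exists_d_eq_of_kills (b := cap (s f) ζ) fun y hy => by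
      have := hall y hy
      rwa [h0, zero_mul, add_zero] at this
    refine LinearMap.ext fun q => ?_
    obtain ⟨z, rfl⟩ := (Bc 1 X).mkQ_surjective q
    rw [← hsz]
    exact nondeg hX hd hval (hsc f) he hs z.2

end SurfT3

namespace SurfT3

/-! ### Sums over the cells of a periodic grid -/

/-- The integer lattice. -/
abbrev Lat : Type := Fin 3 → ℤ

/-- The standard basis vectors of the lattice. -/
def ee (a : Fin 3) : Lat := Pi.single a 1

variable {M : Type} [AddCommGroup M]

/-- The alternating sum over the six simplices of the standard triangulation of a cube. -/
def cubeSum (ψ : Lat → Lat → Lat → Lat → M) (g : Lat) : M :=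
  ∑ a : Fin 3, (ψ g (g + ee a) (g + ee a + ee (a + 1)) (g + ee a + ee (a + 1) + ee (a + 2)) -
    ψ g (g + ee a) (g + ee a + ee (a + 2)) (g + ee a + ee (a + 2) + ee (a + 1)))

/-- The sum over all simplices of the triangulated torus. -/
def gridSum {m : ℕ} [NeZero m] (s : (Fin 3 → ZMod m) → Lat) (ψ : Lat → Lat → Lat → Lat → M) : M :=
  ∑ k, cubeSum ψ (s k)

/-- The simplicial coboundary. -/
def delta (χ : Lat → Lat → Lat → M) (u v w x : Lat) : M :=
  χ v w x - χ u w x + χ u v x - χ u v w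

lemma cubeSum_delta (χ : Lat → Lat → Lat → M) (g : Lat) :
    cubeSum (delta χ) g = ∑ a : Fin 3,
      ((χ (g + ee a) (g + ee a + ee (a + 1)) (g + ee a + ee (a + 1) + ee (a + 2)) -
        χ g (g + ee (a + 1)) (g + ee (a + 1) + ee (a + 2))) -
      (χ (g + ee a) (g + ee a + ee (a + 2)) (g + ee a + ee (a + 2) + ee (a + 1)) -
        χ g (g + ee (a + 2)) (g + ee (a + 2) + ee (a + 1)))) := by
  have e1 : ((0 : Fin 3) + 1) = 1 := rfl
  have e2 : ((0 : Fin 3) + 2) = 2 := rfl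
  have e3 : ((1 : Fin 3) + 1) = 2 := rfl
  have e4 : ((1 : Fin 3) + 2) = 0 := rfl
  have e5 : ((2 : Fin 3) + 1) = 0 := rfl
  have e6 : ((2 : Fin 3) + 2) = 1 := rfl
  simp only [cubeSum, delta, Fin.sum_univ_three, e1, e2, e3, e4, e5, e6]
  have h021 : g + ee 0 + ee 2 + ee 1 = g + ee 0 + ee 1 + ee 2 := by abel
  have h102 : g + ee 1 + ee 0 + ee 2 = g + ee 0 + ee 1 + ee 2 := by abel
  have h120 : g + ee 1 + ee 2 + ee 0 = g + ee 0 + ee 1 + ee 2 := by abel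
  have h201 : g + ee 2 + ee 0 + ee 1 = g + ee 0 + ee 1 + ee 2 := by abel
  have h210 : g + ee 2 + ee 1 + ee 0 = g + ee 0 + ee 1 + ee 2 := by abel
  have h10 : g + ee 1 + ee 0 = g + ee 0 + ee 1 := by abel
  have h20 : g + ee 2 + ee 0 = g + ee 0 + ee 2 := by abel
  have h21 : g + ee 2 + ee 1 = g + ee 1 + ee 2 := by abel
  simp only [h021, h102, h120, h201, h210]
  simp only [h10, h20, h21]
  abel

/-- Summation by parts on the torus, up to boundary terms. -/
lemma gridSum_delta_mem {m : ℕ} [NeZero m] (s : (Fin 3 → ZMod m) → Lat) (P : AddSubgroup M)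
    {χ : Lat → Lat → Lat → M}
    (h : ∀ k a b c, a ≠ b → a ≠ c →
      χ (s k + ee a) (s k + ee a + ee b) (s k + ee a + ee b + ee c) -
        χ (s (k + Pi.single a 1)) (s (k + Pi.single a 1) + ee b)
          (s (k + Pi.single a 1) + ee b + ee c) ∈ P) :
    gridSum s (delta χ) ∈ P := by
  have key : ∀ a b c : Fin 3, a ≠ b → a ≠ c → ∑ k, (χ (s k + ee a) (s k + ee a + ee b)
      (s k + ee a + ee b + ee c) - χ (s k) (s k + ee b) (s k + ee b + ee c)) ∈ P := by
    intro a b c hab hac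
    rw [Finset.sum_sub_distrib, ← Equiv.sum_comp (Equiv.addRight (Pi.single a (1 : ZMod m)))
      (fun k => χ (s k) (s k + ee b) (s k + ee b + ee c)), ← Finset.sum_sub_distrib]
    exact AddSubgroup.sum_mem _ fun k _ => h k a b c hab hac
  rw [gridSum, Finset.sum_congr rfl fun k _ => cubeSum_delta χ (s k), Finset.sum_comm]
  refine AddSubgroup.sum_mem _ fun a _ => ?_
  rw [Finset.sum_sub_distrib]
  have h1 : a ≠ a + 1 := by revert a; decide
  have h2 : a ≠ a + 2 := by revert a; decide
  exact P.sub_mem (key _ _ _ h1 h2) (key _ _ _ h2 h1)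

/-- A section of the reduction modulo `m`. -/
def IsSec {m : ℕ} (s : (Fin 3 → ZMod m) → Lat) : Prop := ∀ k i, ((s k i : ℤ) : ZMod m) = k i

lemma ee_cast (m : ℕ) (a i : Fin 3) :
    ((ee a i : ℤ) : ZMod m) = (Pi.single a 1 : Fin 3 → ZMod m) i := by
  rcases eq_or_ne i a with rfl | h
  · simp [ee]
  · simp [ee, h]

lemma exists_eq_of_cast {m : ℕ} {u v : Lat} (h : ∀ i, ((u i : ℤ) : ZMod m) = (v i : ℤ)) :
    ∃ n : Lat, u = v + (m : ℤ) • n := by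
  have : ∀ i, ∃ n : ℤ, u i = v i + m * n := fun i => by
    obtain ⟨n, hn⟩ := (ZMod.intCast_eq_intCast_iff_dvd_sub _ _ _).1 (h i).symm
    exact ⟨n, by linarith⟩
  choose n hn using this
  exact ⟨n, funext fun i => by simp [hn]⟩

lemma IsSec.exists_shift {m : ℕ} {s : (Fin 3 → ZMod m) → Lat} (hs : IsSec s) (k a) :
    ∃ n : Lat, s k + ee a = s (k + Pi.single a 1) + (m : ℤ) • n :=
  exists_eq_of_cast fun i => by
    rw [hs, Pi.add_apply, Int.cast_add, hs, ee_cast, Pi.add_apply]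

lemma gridSum_delta {m : ℕ} [NeZero m] {s : (Fin 3 → ZMod m) → Lat} (hs : IsSec s)
    {χ : Lat → Lat → Lat → M}
    (h : ∀ u v w (n : Lat), χ (u + (m : ℤ) • n) (v + (m : ℤ) • n) (w + (m : ℤ) • n) = χ u v w) :
    gridSum s (delta χ) = 0 := by
  refine AddSubgroup.mem_bot.1 (gridSum_delta_mem s ⊥ fun k a b c _ _ => ?_)
  obtain ⟨n, hn⟩ := hs.exists_shift k a
  rw [AddSubgroup.mem_bot, hn, add_right_comm _ _ (ee b), add_right_comm _ _ (ee c), h, sub_self]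

/-- Invariance of a function on simplices under translations by the period. -/
def Periodic4 (m : ℕ) (ψ : Lat → Lat → Lat → Lat → M) : Prop :=
  ∀ u v w x (n : Lat), ψ (u + (m : ℤ) • n) (v + (m : ℤ) • n) (w + (m : ℤ) • n)
    (x + (m : ℤ) • n) = ψ u v w x

lemma gridSum_sec {m : ℕ} [NeZero m] {s s' : (Fin 3 → ZMod m) → Lat} (hs : IsSec s)
    (hs' : IsSec s') {ψ : Lat → Lat → Lat → Lat → M} (h : Periodic4 m ψ) :
    gridSum s ψ = gridSum s' ψ := by
  refine Finset.sum_congr rfl fun k _ => ?_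
  obtain ⟨n, hn⟩ := exists_eq_of_cast (m := m) (u := s k) (v := s' k) fun i => by rw [hs, hs']
  have h' : ∀ v b : Lat, v + (m : ℤ) • n + b = v + b + (m : ℤ) • n := fun v b => by abel
  simp only [cubeSum, hn, h', h _ _ _ _ n]

/-- The condition that four lattice points lie in a common unit cube. -/
def Cell (u v w x : Lat) : Prop :=
  ∀ i, (u i ≤ v i ∧ v i ≤ w i ∧ w i ≤ x i) ∧ x i ≤ u i + 1

lemma cell_add (g : Lat) {a b c : Fin 3} (hab : a ≠ b) (hac : a ≠ c) (hbc : b ≠ c) :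
    Cell g (g + ee a) (g + ee a + ee b) (g + ee a + ee b + ee c) := by
  intro i
  have h : ∀ a i, 0 ≤ ee a i := fun a i => by
    rcases eq_or_ne i a with rfl | h
    · simp [ee]
    · simp [ee, h]
  have h1 : ee a i + ee b i + ee c i ≤ 1 := by
    by_cases ha : i = a
    · subst ha; simp [ee, hab, hac]
    · by_cases hb : i = b
      · subst hb; simp [ee, hab.symm, hbc]
      · by_cases hc : i = c
        · subst hc; simp [ee, hac.symm, hbc.symm]
        · simp [ee, ha, hb, hc]
  simp only [Pi.add_apply]
  have := h a i
  have := h b i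
  have := h c i
  omega

lemma cubeSum_congr {ψ ψ' : Lat → Lat → Lat → Lat → M} {g : Lat}
    (h : ∀ v w x, Cell g v w x → ψ g v w x = ψ' g v w x) : cubeSum ψ g = cubeSum ψ' g := by
  refine Finset.sum_congr rfl fun a _ => ?_
  have h1 : a ≠ a + 1 := by revert a; decide
  have h2 : a ≠ a + 2 := by revert a; decide
  have h3 : a + 1 ≠ a + 2 := by revert a; decide
  rw [h _ _ _ (cell_add g h1 h2 h3), h _ _ _ (cell_add g h2 h1 h3.symm)]

lemma gridSum_congr {m : ℕ} [NeZero m] {s : (Fin 3 → ZMod m) → Lat}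
    {ψ ψ' : Lat → Lat → Lat → Lat → M} (h : ∀ u v w x, Cell u v w x → ψ u v w x = ψ' u v w x) :
    gridSum s ψ = gridSum s ψ' :=
  Finset.sum_congr rfl fun _ _ => cubeSum_congr (h _)

lemma cubeSum_map {M' : Type} [AddCommGroup M'] (f : M →+ M') (ψ : Lat → Lat → Lat → Lat → M)
    (g : Lat) : f (cubeSum ψ g) = cubeSum (fun u v w x => f (ψ u v w x)) g := by
  simp only [cubeSum, map_sum, map_sub]

lemma gridSum_map {m : ℕ} [NeZero m] {M' : Type} [AddCommGroup M'] (f : M →+ M')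
    (s : (Fin 3 → ZMod m) → Lat) (ψ : Lat → Lat → Lat → Lat → M) :
    f (gridSum s ψ) = gridSum s (fun u v w x => f (ψ u v w x)) := by
  simp only [gridSum, map_sum, cubeSum_map]

lemma cubeSum_add (ψ ψ' : Lat → Lat → Lat → Lat → M) (g : Lat) :
    cubeSum (fun u v w x => ψ u v w x + ψ' u v w x) g = cubeSum ψ g + cubeSum ψ' g := by
  simp only [cubeSum]
  rw [← Finset.sum_add_distrib]
  exact Finset.sum_congr rfl fun _ _ => by abel

lemma gridSum_add {m : ℕ} [NeZero m] (s : (Fin 3 → ZMod m) → Lat)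
    (ψ ψ' : Lat → Lat → Lat → Lat → M) :
    gridSum s (fun u v w x => ψ u v w x + ψ' u v w x) = gridSum s ψ + gridSum s ψ' := by
  simp only [gridSum, cubeSum_add, Finset.sum_add_distrib]

lemma cubeSum_mem (P : AddSubgroup M) {ψ : Lat → Lat → Lat → Lat → M} {g : Lat}
    (h : ∀ v w x, Cell g v w x → ψ g v w x ∈ P) : cubeSum ψ g ∈ P := by
  refine P.sum_mem fun a _ => ?_
  have h1 : a ≠ a + 1 := by revert a; decide
  have h2 : a ≠ a + 2 := by revert a; decide
  have h3 : a + 1 ≠ a + 2 := by revert a; decide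
  exact P.sub_mem (h _ _ _ (cell_add g h1 h2 h3)) (h _ _ _ (cell_add g h2 h1 h3.symm))

lemma gridSum_mem {m : ℕ} [NeZero m] {s : (Fin 3 → ZMod m) → Lat} (P : AddSubgroup M)
    {ψ : Lat → Lat → Lat → Lat → M} (h : ∀ k v w x, Cell (s k) v w x → ψ (s k) v w x ∈ P) :
    gridSum s ψ ∈ P :=
  P.sum_mem fun k _ => cubeSum_mem P (h k)

end SurfT3

namespace SurfT3

/-! ### Twisted sums over the grid -/

variable {m : ℕ} [NeZero m] {s : (Fin 3 → ZMod m) → Lat} {x : Lat → Lat → ZMod 2}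
  {k : Lat → ZMod 2} {τ : Lat → Lat → ℤ}

/-- Periodicity of a function of two lattice points. -/
def Periodic2 {A : Type} (m : ℕ) (ψ : Lat → Lat → A) : Prop :=
  ∀ u v (n : Lat), ψ (u + (m : ℤ) • n) (v + (m : ℤ) • n) = ψ u v

lemma gridSum_eq_of_delta (hs : IsSec s) {χ : Lat → Lat → Lat → ZMod 2}
    (hχ : ∀ u v w (n : Lat), χ (u + (m : ℤ) • n) (v + (m : ℤ) • n) (w + (m : ℤ) • n) = χ u v w)
    {ψ ψ' : Lat → Lat → Lat → Lat → ZMod 2}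
    (h : ∀ u v w z, Cell u v w z → delta χ u v w z = ψ u v w z + ψ' u v w z) :
    gridSum s ψ = gridSum s ψ' := by
  have h1 := gridSum_delta hs hχ
  rw [gridSum_congr h, gridSum_add] at h1
  exact CharTwo.add_eq_zero.1 h1

lemma gridSum_square (hs : IsSec s) (hx : Periodic2 m x) (hτ : Periodic2 m τ)
    (hadd : ∀ u v w, τ u w = τ u v + τ v w)
    (hc : ∀ u v w z, Cell u v w z → (τ w z : ZMod 2) ≠ 0 → x u w = x u v + x v w) :
    gridSum s (fun u v w z => x u v * x v w * (τ w z : ZMod 2)) =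
      gridSum s (fun u v w z => x u v * (τ v w : ZMod 2) * (τ w z : ZMod 2)) := by
  set y : ZMod 2 → ℤ := fun a => if a = 0 then 0 else 1 with hy
  have hycast : ∀ a : ZMod 2, ((y a : ℤ) : ZMod 2) = a := by
    intro a; simp only [hy]; revert a; decide
  have yadd : ∀ a b : ZMod 2, y (a + b) = y a + y b - 2 * (y a * y b) := by decide
  have h1 := gridSum_delta (M := ℤ) hs (χ := fun a b c => y (x a b) * y (τ b c))
    fun u v w n => by rw [hx, hτ]
  set D : Lat → Lat → Lat → Lat → ℤ := fun u v w z =>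
    y (x u v) * y (x v w) * y (τ w z) - y (x u v) * y (τ v w) * y (τ w z) with hD
  have h2 : gridSum s (fun u v w z => D u v w z + D u v w z) = 0 := by
    rw [← h1]
    refine gridSum_congr fun u v w z hcell => ?_
    simp only [hD, delta]
    have h3 : y (τ v z) = y (τ v w) + y (τ w z) - 2 * (y (τ v w) * y (τ w z)) := by
      rw [← yadd, hadd v w z, Int.cast_add]
    by_cases h0 : (τ w z : ZMod 2) = 0
    · have : y (τ w z) = 0 := by simp [hy, h0]
      rw [h3, this]; ring
    · have : y (τ w z) = 1 := by simp [hy, h0]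
      rw [h3, this, hc u v w z hcell h0, yadd]; ring
  rw [gridSum_add] at h2
  have h3 : gridSum s D = 0 := by omega
  have h4 := congrArg (Int.castAddHom (ZMod 2)) h3
  rw [gridSum_map, map_zero] at h4
  have h5 : ∀ u v w z, Int.castAddHom (ZMod 2) (D u v w z) = x u v * x v w * (τ w z : ZMod 2) +
      x u v * (τ v w : ZMod 2) * (τ w z : ZMod 2) := fun u v w z => by
    simp only [hD, Int.coe_castAddHom, Int.cast_sub, Int.cast_mul, hycast, CharTwo.sub_eq_add]
  rw [gridSum_congr fun u v w z _ => h5 u v w z, gridSum_add] at h4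
  exact CharTwo.add_eq_zero.1 h4

lemma gridSum_twist (hs : IsSec s) (hx : Periodic2 m x) (hτ : Periodic2 m τ)
    (hk : ∀ u (n : Lat), k (u + (m : ℤ) • n) = k u) (hadd : ∀ u v w, τ u w = τ u v + τ v w)
    (hc : ∀ u v w z, Cell u v w z → (τ w z : ZMod 2) ≠ 0 → x u w = x u v + x v w) :
    gridSum s (fun u v w z => x u v * (τ v w + k v + k w) * (τ w z : ZMod 2)) =
      gridSum s (fun u v w z => x u v * (τ v w : ZMod 2) * (τ w z : ZMod 2)) := by
  refine gridSum_eq_of_delta hs (χ := fun a b c => x a b * k b * (τ b c : ZMod 2))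
    (fun u v w n => by rw [hx, hτ, hk]) fun u v w z hcell => ?_
  simp only [delta]
  rw [hadd v w z, Int.cast_add]
  by_cases h0 : (τ w z : ZMod 2) = 0
  · rw [h0]; ring
  · rw [hc u v w z hcell h0]
    generalize (τ w z : ZMod 2) = a, (τ v w : ZMod 2) = b, x u v = c, x v w = e, k v = f, k w = g
    revert a b c e f g; decide

lemma gridSum_cube (hs : IsSec s) (hτ : Periodic2 m τ) (hadd : ∀ u v w, τ u w = τ u v + τ v w)
    (hk : ∀ u (n : Lat), k (u + (m : ℤ) • n) = k u) :
    gridSum s (fun u v w z => (τ u v + k u + k v) * (τ v w : ZMod 2) * (τ w z : ZMod 2)) = 0 := by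
  have h1 : gridSum s (fun u v w z => (τ u v + k u + k v) * (τ v w : ZMod 2) * (τ w z : ZMod 2)) =
      gridSum s (fun u v w z => (τ u v : ZMod 2) * (τ v w : ZMod 2) * (τ w z : ZMod 2)) := by
    refine gridSum_eq_of_delta hs
      (χ := fun a b c => k a * (τ a b : ZMod 2) * (τ b c : ZMod 2))
      (fun u v w n => by rw [hτ, hτ, hk]) fun u v w z _ => ?_
    simp only [delta]
    rw [hadd v w z, hadd u v w, Int.cast_add, Int.cast_add]
    generalize (τ w z : ZMod 2) = a, (τ v w : ZMod 2) = b, (τ u v : ZMod 2) = c, k v = f, k u = g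
    revert a b c f g; decide
  have h0 : gridSum s (fun _ _ _ _ => (0 : ZMod 2)) = 0 := by simp [gridSum, cubeSum]
  rw [h1, ← h0]
  set q : ℤ → ℤ := fun a => a * (a - 1) / 2 with hq
  have hq2 : ∀ a, 2 * q a = a * (a - 1) := fun a =>
    Int.mul_ediv_cancel' (Int.even_mul_pred_self a).two_dvd
  have qadd : ∀ a b, q (a + b) = q a + q b + a * b := fun a b => by
    have := hq2 (a + b); have := hq2 a; have := hq2 b
    nlinarith
  refine gridSum_eq_of_delta hs (χ := fun a b c => (q (τ a b) : ZMod 2) * (τ b c : ZMod 2))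
    (fun u v w n => by rw [hτ, hτ]) fun u v w z _ => ?_
  simp only [delta]
  rw [hadd v w z, hadd u v w, qadd]
  push_cast
  generalize (τ w z : ZMod 2) = a, (τ v w : ZMod 2) = b, (τ u v : ZMod 2) = c,
    (q (τ u v) : ZMod 2) = f, (q (τ v w) : ZMod 2) = g
  revert a b c f g; decide

end SurfT3

namespace SurfT3

/-! ### The real projective line, and charts of locally Euclidean spaces -/

variable {X Y W : Type} [TopologicalSpace X] [TopologicalSpace Y] [TopologicalSpace W]

lemma exists_small_chart {n : ℕ} {j : C(E n, X)} (hj : Topology.IsOpenEmbedding j) (a : E n)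
    {U : Set X}
    (hU : U ∈ nhds (j a)) :
    ∃ j' : C(E n, X), Topology.IsOpenEmbedding j' ∧ j a ∈ Set.range j' ∧ Set.range j' ⊆ U := by
  obtain ⟨r, hr, hrU⟩ := Metric.mem_nhds_iff.1 (j.continuous.continuousAt.preimage_mem_nhds hU)
  have ho := (OpenPartialHomeomorph.univBall a r).isOpenEmbedding
    (OpenPartialHomeomorph.univBall_source a r)
  refine ⟨j.comp ⟨_, ho.continuous⟩, hj.comp ho,
    ⟨0, by simp [OpenPartialHomeomorph.univBall_apply_zero]⟩, ?_⟩
  rintro _ ⟨t, rfl⟩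
  refine hrU ?_
  rw [← OpenPartialHomeomorph.univBall_target a hr]
  exact (OpenPartialHomeomorph.univBall a r).map_source (by simp)

lemma LocEuc.exists_small {n : ℕ} (hX : LocEuc n X) {x : X} {U : Set X} (hU : U ∈ nhds x) :
    ∃ j : C(E n, X), Topology.IsOpenEmbedding j ∧ x ∈ Set.range j ∧ Set.range j ⊆ U := by
  obtain ⟨j, hj, a, rfl⟩ := hX x
  exact exists_small_chart hj a hU

lemma isOpenEmbedding_restrict {f : W → X} (hf : Continuous f) (ho : IsOpenMap f) {B : Set W}
    (hB : IsOpen B) (hi : Set.InjOn f B) : Topology.IsOpenEmbedding (fun b : B => f b) :=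
  .of_continuous_injective_isOpenMap (hf.comp continuous_subtype_val)
    (fun a b h => Subtype.ext (hi a.2 b.2 h)) (ho.comp hB.isOpenMap_subtype_val)

lemma exists_lift_chart {n : ℕ} {f : W → X} (hf : Continuous f) (ho : IsOpenMap f) {B : Set W}
    (hB : IsOpen B) (hi : Set.InjOn f B) {j : C(E n, X)} (hj : Topology.IsOpenEmbedding j)
    (hjB : Set.range j ⊆ f '' B) :
    ∃ j' : C(E n, W), Topology.IsOpenEmbedding j' ∧ Set.range j' ⊆ B ∧ ∀ t, f (j' t) = j t := by
  have he := isOpenEmbedding_restrict hf ho hB hi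
  have hr : ∀ t, j t ∈ Set.range (fun b : B => f b) := fun t => by
    obtain ⟨b, hb, h⟩ := hjB ⟨t, rfl⟩
    exact ⟨⟨b, hb⟩, h⟩
  choose g hg using hr
  have hgj : (fun b : B => f b) ∘ g = j := funext hg
  have hgo : Topology.IsOpenEmbedding g := by
    rw [← Topology.IsOpenEmbedding.of_comp_iff g he, hgj]
    exact hj
  refine ⟨⟨fun t => g t, continuous_subtype_val.comp hgo.continuous⟩,
    hB.isOpenEmbedding_subtypeVal.comp hgo, ?_, hg⟩
  rintro _ ⟨t, rfl⟩
  exact (g t).2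

lemma LocEuc.lift {n : ℕ} (hX : LocEuc n X) {f : W → X} (hf : Continuous f) (ho : IsOpenMap f)
    (hi : ∀ w, ∃ B, IsOpen B ∧ w ∈ B ∧ Set.InjOn f B) : LocEuc n W := by
  intro w
  obtain ⟨B, hB, hw, hinj⟩ := hi w
  obtain ⟨j, hj, ⟨t, ht⟩, hjB⟩ := hX.exists_small ((ho B hB).mem_nhds ⟨w, hw, rfl⟩)
  obtain ⟨j', hj', hr, h⟩ := exists_lift_chart hf ho hB hinj hj hjB
  exact ⟨j', hj', t, hinj (hr ⟨t, rfl⟩) hw (by rw [h, ht])⟩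

lemma locEuc_of_chartedSpace {n : ℕ} (h : ChartedSpace (EuclideanSpace ℝ (Fin n)) X) :
    LocEuc n X := by
  intro x
  set c := chartAt (EuclideanSpace ℝ (Fin n)) x
  have hx : x ∈ c.source := mem_chart_source _ x
  obtain ⟨r, hr, hrU⟩ := Metric.isOpen_iff.1 c.open_target _ (c.map_source hx)
  have hB := OpenPartialHomeomorph.univBall_source (c x) r
  have ht := OpenPartialHomeomorph.univBall_target (c x) hr
  set b := OpenPartialHomeomorph.univBall (c x) r
  have hs : (b.trans c.symm).source = Set.univ := by
    refine Set.eq_univ_of_forall fun t => ?_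
    rw [OpenPartialHomeomorph.trans_source]
    refine ⟨hB ▸ Set.mem_univ _, hrU ?_⟩
    rw [← ht]
    exact b.map_source (hB ▸ Set.mem_univ _)
  have ho := (b.trans c.symm).isOpenEmbedding hs
  let e : E n ≃ₜ EuclideanSpace ℝ (Fin n) := (EuclideanSpace.equiv (Fin n) ℝ).symm.toHomeomorph
  refine ⟨⟨fun t => (b.trans c.symm) (e t), ho.continuous.comp e.continuous⟩,
    ho.comp e.isOpenEmbedding, e.symm 0, ?_⟩
  have : b 0 = c x := OpenPartialHomeomorph.univBall_apply_zero _ _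
  simp [this, c.left_inv hx]

lemma exists_circle_injection : ∃ f : RP1 → UnitAddCircle, Continuous f ∧ Function.Injective f := by
  let z : (Fin 2 → ℝ) → ℂ := fun v => ⟨v 0, v 1⟩
  have hz : Continuous z := by
    have : z = fun v => (v 0 : ℂ) + (v 1 : ℂ) * Complex.I := by
      funext v; exact Complex.ext (by simp [z]) (by simp [z])
    rw [this]; fun_prop
  have hz0 : ∀ v, v ≠ 0 → z v ≠ 0 := fun v hv h => hv (by
    funext i
    have h0 := congrArg Complex.re h
    have h1 := congrArg Complex.im h
    fin_cases i
    · exact h0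
    · exact h1)
  let g : {v : Fin 2 → ℝ // v ≠ 0} → Circle := fun v =>
    Circle.ofConjDivSelf (z v) (hz0 v v.2)
  have hgc : Continuous g := by
    refine Continuous.subtype_mk ?_ _
    exact ((Complex.continuous_conj.comp (hz.comp continuous_subtype_val))).div
      (hz.comp continuous_subtype_val) fun v => hz0 v v.2
  have key : ∀ a b : {v : Fin 2 → ℝ // v ≠ 0}, g a = g b ↔ a.1 0 * b.1 1 = a.1 1 * b.1 0 := by
    intro a b
    rw [← Circle.coe_inj]
    change (starRingEnd ℂ) (z a) / z a = (starRingEnd ℂ) (z b) / z b ↔ _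
    rw [div_eq_div_iff (hz0 a a.2) (hz0 b b.2), Complex.ext_iff]
    simp only [z, Complex.mul_re, Complex.mul_im, Complex.conj_re, Complex.conj_im]
    constructor
    · rintro ⟨-, h⟩; linarith
    · intro h; constructor <;> linarith
  have hlift : ∀ a b : {v : Fin 2 → ℝ // v ≠ 0}, ∀ t : ℝ, a.1 = t • b.1 → g a = g b := by
    intro a b t h
    rw [key, h]
    simp only [Pi.smul_apply, smul_eq_mul]; ring
  let F : RP1 → Circle := Projectivization.lift g hlift
  have hF : Continuous F := continuous_quot_lift _ hgc
  have hFi : Function.Injective F := by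
    intro x y
    induction x using Projectivization.ind with | h v hv =>
    induction y using Projectivization.ind with | h w hw =>
    intro h
    have h' : g ⟨v, hv⟩ = g ⟨w, hw⟩ := h
    rw [key] at h'
    rw [Projectivization.mk_eq_mk_iff']
    change v 0 * w 1 = v 1 * w 0 at h'
    by_cases h0 : w 0 = 0
    · have h1 : w 1 ≠ 0 := fun h1 => hw (by funext i; fin_cases i <;> assumption)
      refine ⟨v 1 / w 1, ?_⟩
      funext i
      fin_cases i
      · simp only [Fin.zero_eta, Pi.smul_apply, smul_eq_mul, h0] at h' ⊢
        simpa [h1, eq_comm] using h'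
      · simp [h1]
    · refine ⟨v 0 / w 0, ?_⟩
      funext i
      fin_cases i
      · simp [h0]
      · simp only [Fin.mk_one, Pi.smul_apply, smul_eq_mul]
        field_simp
        linarith
  let e := AddCircle.homeomorphCircle (T := (1 : ℝ)) one_ne_zero
  exact ⟨fun x => e.symm (F x), e.symm.continuous.comp hF, e.symm.injective.comp hFi⟩

end SurfT3

namespace SurfT3

/-! ### The torus and a neighbourhood of an embedded surface -/

/-- The three-dimensional torus. -/
abbrev Tor : Type := Fin 3 → UnitAddCircle

/-- The universal covering of the torus. -/
def tp : C(E 3, Tor) :=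
  ⟨fun v i => (v i : UnitAddCircle), continuous_pi fun i =>
    (AddCircle.continuous_mk' 1).comp (continuous_apply i)⟩

/-- A lattice point as a point of Euclidean space. -/
def toE (n : Lat) : E 3 := fun i => (n i : ℝ)

lemma toE_add (n k : Lat) : toE (n + k) = toE n + toE k := by
  funext i; simp [toE]

lemma toE_neg (n : Lat) : toE (-n) = -toE n := by
  funext i; simp [toE]

lemma tp_add (v w : E 3) : tp (v + w) = tp v + tp w := rfl

lemma tp_sub (v w : E 3) : tp (v - w) = tp v - tp w := rfl

lemma tp_toE (n : Lat) : tp (toE n) = 0 := by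
  funext i
  exact (AddCircle.coe_eq_zero_iff (1 : ℝ)).2 ⟨n i, by simp [toE]⟩

lemma tp_add_toE (v : E 3) (n : Lat) : tp (v + toE n) = tp v := by rw [tp_add, tp_toE, add_zero]

lemma tp_eq_zero_iff {v : E 3} : tp v = 0 ↔ ∃ n : Lat, v = toE n := by
  refine ⟨fun h => ?_, ?_⟩
  · have : ∀ i, ∃ n : ℤ, n • (1 : ℝ) = v i := fun i =>
      (AddCircle.coe_eq_zero_iff (1 : ℝ)).1 (congrFun h i)
    choose n hn using this
    exact ⟨n, funext fun i => by simp [toE, ← hn]⟩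
  · rintro ⟨n, rfl⟩
    exact tp_toE n

lemma tp_eq_iff {v w : E 3} : tp v = tp w ↔ ∃ n : Lat, v = w + toE n := by
  rw [← sub_eq_zero, ← tp_sub, tp_eq_zero_iff]
  simp only [sub_eq_iff_eq_add']

lemma eq_of_tp_eq {v w : E 3} (h : tp v = tp w) (hn : ‖v - w‖ < 1) : v = w := by
  obtain ⟨n, rfl⟩ := tp_eq_iff.1 h
  rw [add_sub_cancel_left, pi_norm_lt_iff one_pos] at hn
  have : n = 0 := by
    funext i
    have := hn i
    rw [toE, Real.norm_eq_abs] at this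
    exact Int.abs_lt_one_iff.1 (by exact_mod_cast this)
  rw [this]
  simp [toE, funext_iff]

lemma isOpenMap_tp : IsOpenMap tp :=
  IsOpenMap.piMap (f := fun _ : Fin 3 => ((↑) : ℝ → UnitAddCircle))
    (fun _ => QuotientAddGroup.isOpenMap_coe) (by simp)

lemma tp_surjective : Function.Surjective tp := fun x => by
  choose v hv using fun i => QuotientAddGroup.mk_surjective (x i)
  exact ⟨v, funext hv⟩

lemma norm_tp_le (v : E 3) : ‖tp v‖ ≤ ‖v‖ := by
  refine (pi_norm_le_iff_of_nonneg (norm_nonneg _)).2 fun i => ?_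
  refine le_trans ?_ (norm_le_pi_norm v i)
  refine (UnitAddCircle.norm_eq (x := v i)).trans_le ?_
  simpa using round_le (v i) 0

/-- The section of the covering with values in the cube `[-1/2, 1/2)`. -/
noncomputable def lam (x : Tor) : E 3 := fun i => (AddCircle.equivIco (1 : ℝ) (-1 / 2) (x i) : ℝ)

lemma tp_lam (x : Tor) : tp (lam x) = x :=
  funext fun i => AddCircle.coe_equivIco (p := (1 : ℝ)) (a := -1 / 2) (y := x i)

lemma norm_lam_le (x : Tor) : ‖lam x‖ ≤ ‖x‖ := by
  refine (pi_norm_le_iff_of_nonneg (norm_nonneg _)).2 fun i => ?_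
  refine le_trans (le_of_eq ?_) (norm_le_pi_norm x i)
  have h := (AddCircle.equivIco (1 : ℝ) (-1 / 2) (x i)).2
  have h2 : |lam x i| ≤ |(1 : ℝ)| / 2 := by
    rw [abs_one, abs_le]
    exact ⟨by have := h.1; simp only [lam]; linarith, by have := h.2; simp only [lam]; linarith⟩
  have h3 := (AddCircle.norm_coe_eq_abs_iff (1 : ℝ) one_ne_zero).2 h2
  rw [Real.norm_eq_abs, ← h3]
  exact congrArg norm (congrFun (tp_lam x) i)

lemma continuousAt_lam {x : Tor} (hx : ‖x‖ < 1 / 2) : ContinuousAt lam x := by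
  refine continuousAt_pi.2 fun i => ?_
  have h : x i ≠ ((-1 / 2 : ℝ) : UnitAddCircle) := by
    intro h
    have h1 := norm_le_pi_norm x i
    have h2 := (AddCircle.norm_coe_eq_abs_iff (x := -1 / 2) (1 : ℝ) one_ne_zero).2
      (by norm_num [abs_of_neg])
    rw [h, show ‖((-1 / 2 : ℝ) : UnitAddCircle)‖ = |(-1 / 2 : ℝ)| from h2] at h1
    norm_num [abs_of_neg] at h1
    linarith
  have h1 := continuousAt_subtype_val.comp (AddCircle.continuousAt_equivIco (1 : ℝ) (-1 / 2) h)
  exact ContinuousAt.comp (f := fun x : Tor => x i) h1 (continuous_apply i).continuousAt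

/-- A compact surface in the torus with a retraction of a tubular neighbourhood. -/
structure Tube (Z : Type) [TopologicalSpace Z] where
  /-- The embedding. -/
  ι : C(Z, Tor)
  emb : Topology.IsClosedEmbedding ι
  /-- The neighbourhood. -/
  N : Set Tor
  isOpen_N : IsOpen N
  range_le : Set.range ι ⊆ N
  /-- The retraction. -/
  r : C(N, Z)
  retract : ∀ z (h : ι z ∈ N), r ⟨ι z, h⟩ = z
  close : ∀ x : N, ‖ι (r x) - x‖ < 1 / 8

theorem exists_tube {Z : Type} [TopologicalSpace Z] [CompactSpace Z] [T2Space Z]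
    (hZ : LocEuc 2 Z) {ι : Z → Tor} (hι : Topology.IsClosedEmbedding ι) : Nonempty (Tube Z) := by
  obtain ⟨N, r, hN, hr, h⟩ := hZ.exists_retraction hι
  let g : N → ℝ := fun x => ‖ι (r x) - x‖
  have hg : Continuous g := ((hι.continuous.comp r.continuous).sub continuous_subtype_val).norm
  let N' : Set Tor := Subtype.val '' (g ⁻¹' Set.Iio (1 / 8))
  have hN' : N' ⊆ N := by rintro _ ⟨x, -, rfl⟩; exact x.2
  refine ⟨⟨⟨ι, hι.continuous⟩, hι, N', hN.isOpenMap_subtype_val _ (isOpen_Iio.preimage hg), ?_,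
    r.comp ⟨Set.inclusion hN', continuous_inclusion hN'⟩, fun z hz => h z (hN' hz), ?_⟩⟩
  · rintro _ ⟨z, rfl⟩
    refine ⟨⟨ι z, hr ⟨z, rfl⟩⟩, ?_, rfl⟩
    simp [g, h]
  · rintro ⟨_, x, hx, rfl⟩
    exact hx

namespace Tube

variable {Z : Type} [TopologicalSpace Z] (D : Tube Z)

/-- The preimage of the surface in Euclidean space. -/
def Zt : Set (E 3) := tp ⁻¹' Set.range D.ι

/-- The preimage of the tubular neighbourhood. -/
def Nt : Set (E 3) := tp ⁻¹' D.N

lemma isClosed_Zt : IsClosed D.Zt := D.emb.isClosed_range.preimage tp.continuous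

lemma Zt_subset : D.Zt ⊆ D.Nt := fun _ h => D.range_le h

lemma add_toE_mem_Zt {v : E 3} (n : Lat) : v + toE n ∈ D.Zt ↔ v ∈ D.Zt := by
  simp only [Zt, Set.mem_preimage, tp_add_toE]

lemma add_toE_mem_Nt {v : E 3} (n : Lat) : v + toE n ∈ D.Nt ↔ v ∈ D.Nt := by
  simp only [Nt, Set.mem_preimage, tp_add_toE]

/-- The covering of the surface. -/
noncomputable def pz : C(D.Zt, Z) :=
  ⟨fun v => D.emb.isEmbedding.toHomeomorph.symm ⟨tp v, v.2⟩,
    D.emb.isEmbedding.toHomeomorph.symm.continuous.comp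
      ((tp.continuous.comp continuous_subtype_val).subtype_mk _)⟩

lemma ι_pz (v : D.Zt) : D.ι (D.pz v) = tp v :=
  congrArg Subtype.val (D.emb.isEmbedding.toHomeomorph.apply_symm_apply ⟨tp v, v.2⟩)

lemma ι_injective : Function.Injective D.ι := D.emb.injective

lemma isOpenMap_pz : IsOpenMap D.pz := by
  rintro _ ⟨O, hO, rfl⟩
  have : D.pz '' (Subtype.val ⁻¹' O) = D.ι ⁻¹' (tp '' O) := by
    ext z
    constructor
    · rintro ⟨v, hv, rfl⟩
      exact ⟨v, hv, (D.ι_pz v).symm⟩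
    · rintro ⟨v, hv, h⟩
      refine ⟨⟨v, z, h.symm⟩, hv, D.ι_injective ?_⟩
      rw [D.ι_pz, h]
  rw [this]
  exact (isOpenMap_tp O hO).preimage D.ι.continuous

lemma pz_surjective : Function.Surjective D.pz := fun z => by
  obtain ⟨v, hv⟩ := tp_surjective (D.ι z)
  exact ⟨⟨v, z, hv.symm⟩, D.ι_injective (by rw [D.ι_pz, hv])⟩

lemma eq_of_pz_eq {v w : D.Zt} (h : D.pz v = D.pz w) (hn : ‖(v : E 3) - w‖ < 1) : v = w :=
  Subtype.ext (eq_of_tp_eq (by rw [← ι_pz, h, ι_pz]) hn)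

lemma pz_injOn (v : E 3) : Set.InjOn D.pz (Subtype.val ⁻¹' Metric.ball v (1 / 2)) := by
  intro a ha b hb h
  refine D.eq_of_pz_eq h ?_
  rw [← dist_eq_norm]
  have := dist_triangle_right (a : E 3) b v
  have h1 : dist (a : E 3) v < 1 / 2 := ha
  have h2 : dist (b : E 3) v < 1 / 2 := hb
  linarith

lemma locEuc_Zt (hZ : LocEuc 2 Z) : LocEuc 2 D.Zt :=
  hZ.lift D.pz.continuous D.isOpenMap_pz fun w =>
    ⟨_, Metric.isOpen_ball.preimage continuous_subtype_val,
      Metric.mem_ball_self (by norm_num), D.pz_injOn w⟩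

/-- The retraction of the preimage of the tubular neighbourhood onto the surface. -/
def rt : C(D.Nt, Z) :=
  ⟨fun v => D.r ⟨tp v, v.2⟩,
    D.r.continuous.comp ((tp.continuous.comp continuous_subtype_val).subtype_mk _)⟩

lemma close_rt (v : D.Nt) : ‖D.ι (D.rt v) - tp v‖ < 1 / 8 := D.close _

lemma rt_of_mem {v : E 3} (h : v ∈ D.Zt) : D.rt ⟨v, D.Zt_subset h⟩ = D.pz ⟨v, h⟩ := by
  have h1 := D.ι_pz ⟨v, h⟩
  have h2 := D.retract (D.pz ⟨v, h⟩) (D.range_le ⟨_, rfl⟩)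
  exact (congrArg D.r (Subtype.ext h1.symm)).trans h2

lemma rt_congr {v w : D.Nt} (h : tp v = tp w) : D.rt v = D.rt w :=
  congrArg D.r (Subtype.ext h)

/-- The lifted retraction. -/
noncomputable def Rt : C(D.Nt, D.Zt) where
  toFun v := ⟨v + lam (D.ι (D.rt v) - tp v), D.rt v, by
    rw [tp_add, tp_lam]; abel⟩
  continuous_toFun := by
    refine Continuous.subtype_mk (continuous_subtype_val.add ?_) _
    refine continuous_iff_continuousAt.2 fun v => ?_
    refine ContinuousAt.comp (g := lam) (f := fun v : D.Nt => D.ι (D.rt v) - tp v)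
      (continuousAt_lam ((D.close_rt v).trans (by norm_num))) (Continuous.continuousAt ?_)
    fun_prop

lemma coe_Rt (v : D.Nt) : (D.Rt v : E 3) = v + lam (D.ι (D.rt v) - tp v) := rfl

lemma pz_Rt (v : D.Nt) : D.pz (D.Rt v) = D.rt v :=
  D.ι_injective (by rw [ι_pz, coe_Rt, tp_add, tp_lam]; abel)

lemma norm_Rt_sub (v : D.Nt) : ‖(D.Rt v : E 3) - v‖ < 1 / 8 := by
  rw [coe_Rt, add_sub_cancel_left]
  exact (norm_lam_le _).trans_lt (D.close_rt v)

lemma Rt_of_mem {v : E 3} (h : v ∈ D.Zt) : D.Rt ⟨v, D.Zt_subset h⟩ = ⟨v, h⟩ := by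
  refine D.eq_of_pz_eq ?_ ((D.norm_Rt_sub _).trans (by norm_num))
  rw [pz_Rt, rt_of_mem]

lemma Rt_add_toE {v : E 3} (hv : v ∈ D.Nt) (n : Lat) :
    (D.Rt ⟨v + toE n, (D.add_toE_mem_Nt n).2 hv⟩ : E 3) = D.Rt ⟨v, hv⟩ + toE n := by
  rw [coe_Rt, coe_Rt, D.rt_congr (w := ⟨v, hv⟩) (tp_add_toE v n)]
  simp only [tp_add_toE]
  abel

end Tube

end SurfT3

namespace SurfT3

/-! ### A labelling criterion for nontrivial local classes -/

variable {X : Type} [TopologicalSpace X]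

/-- The first index at which one of three real functions is positive. -/
noncomputable def label (h : Fin 3 → C(X, ℝ)) (x : X) : Fin 4 :=
  if 0 < h 0 x then 0 else if 0 < h 1 x then 1 else if 0 < h 2 x then 2 else 3

lemma mem_closure_label {h : Fin 3 → C(X, ℝ)} {x : X}
    (hx : ∀ i, x ∈ closure {y | label h y = i}) (i : Fin 3) : h i x = 0 := by
  have hcl : ∀ {l : Fin 4} {F : Set X}, IsClosed F → {y | label h y = l} ⊆ F → x ∈ F :=
    fun hF hs => closure_minimal hs hF (hx _)
  have hle : ∀ {l : Fin 4} {i : Fin 3}, (∀ y, label h y = l → h i y ≤ 0) → h i x ≤ 0 :=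
    fun {l i} H => hcl (l := l) (F := {y | h i y ≤ 0})
      (isClosed_le (h i).continuous continuous_const) H
  have hge : ∀ {l : Fin 4} {i : Fin 3}, (∀ y, label h y = l → 0 ≤ h i y) → 0 ≤ h i x :=
    fun {l i} H => hcl (l := l) (F := {y | 0 ≤ h i y})
      (isClosed_le continuous_const (h i).continuous) H
  refine le_antisymm (hle (l := 3) fun y hy => ?_) ?_
  · simp only [label] at hy
    split_ifs at hy with h0 h1 h2
    · exact absurd hy (by decide)
    · exact absurd hy (by decide)
    · exact absurd hy (by decide)
    · fin_cases i
      · exact not_lt.1 h0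
      · exact not_lt.1 h1
      · exact not_lt.1 h2
  · refine hge (l := i.castSucc) fun y hy => ?_
    simp only [label] at hy
    split_ifs at hy with h0 h1 h2
    · rw [show i = 0 from Fin.castSucc_injective 3 hy.symm]
      exact h0.le
    · rw [show i = 1 from Fin.castSucc_injective 3 hy.symm]
      exact h1.le
    · rw [show i = 2 from Fin.castSucc_injective 3 hy.symm]
      exact h2.le
    · exact absurd hy.symm (Fin.castSucc_lt_last i).ne

/-- The indicator of the labelling of a triangle being onto `{0, 1, 2}`. -/
def rainbow (a b c : Fin 4) : ZMod 2 :=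
  if (a ≠ 3 ∧ b ≠ 3 ∧ c ≠ 3) ∧ a ≠ b ∧ a ≠ c ∧ b ≠ c then 1 else 0

lemma rainbow_sum {i : Fin 4} (l : Fin 4 → Fin 4) (h : ∀ j, l j ≠ i) :
    rainbow (l 1) (l 2) (l 3) + rainbow (l 0) (l 2) (l 3) + rainbow (l 0) (l 1) (l 3) +
      rainbow (l 0) (l 1) (l 2) = 0 := by
  have h0 := h 0; have h1 := h 1; have h2 := h 2; have h3 := h 3
  clear h
  generalize l 0 = a, l 1 = b, l 2 = c, l 3 = e at *
  clear l
  revert a b c e i; decide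

/-- The functional counting rainbow triangles. -/
noncomputable def rainbowC (h : Fin 3 → C(X, ℝ)) : Ch 3 X →ₗ[ZMod 2] ZMod 2 :=
  linC fun σ => rainbow (label h (vtx σ 0)) (label h (vtx σ 1)) (label h (vtx σ 2))

lemma rainbowC_d (h : Fin 3 → C(X, ℝ)) (τ : Sing 4 X) :
    rainbowC h (d (gen τ)) = (fun l : Fin 4 → Fin 4 => rainbow (l 1) (l 2) (l 3) +
      rainbow (l 0) (l 2) (l 3) + rainbow (l 0) (l 1) (l 3) + rainbow (l 0) (l 1) (l 2))
        fun i => label h (vtx τ i) := by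
  rw [d_gen, map_sum, Fin.sum_univ_four]
  simp only [rainbowC, linC_gen, vtx_face]
  rfl

theorem not_null_of_label {h : Fin 3 → C(X, ℝ)} {a : X} (ha : ∀ x, (∀ i, h i x = 0) → x = a)
    {σ : Sing 4 X} (hσ : ∀ t i, t i = 0 → label h (σ t) ≠ i) : ¬ Null {a} (gen σ) := by
  rintro ⟨e, he⟩
  set g := gen σ + d e with hg
  have hdg : d g = d (gen σ) := by rw [hg, map_add, d_d, add_zero]
  obtain ⟨m, hm⟩ := exists_iter_Sd_small (n := 3) (𝒰 := fun i => (closure {y | label h y = i})ᶜ)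
    (fun i => isClosed_closure.isOpen_compl) (fun x hx => by
      by_contra! hc
      exact hx (ha x (mem_closure_label fun i => not_not.1 (hc i)))) he
  have h0 : ∀ (τ : Sing 4 X) (i : Fin 4), (∀ t, label h (τ t) ≠ i) →
      rainbowC h (d (gen τ)) = 0 := fun τ i hi => by
    rw [rainbowC_d]
    exact rainbow_sum (i := i) (fun j => label h (vtx τ j)) fun j => hi (stdSimplex.vertex j)
  have h1 : rainbowC h (d (SurfT3.Sd^[m] g)) = 0 := by
    refine SP_le_comap (f := rainbowC h ∘ₗ d) (N := ⊥) (fun τ hτ => ?_) (hm m le_rfl)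
    obtain ⟨i, hi⟩ := hτ
    exact h0 τ i fun t ht => hi t (subset_closure ht)
  have h2 : rainbowC h (d (ThI m (d (gen σ)))) = 0 := by
    rw [d_gen]
    have hsum : ThI m (∑ i, gen (σ.comp (face i))) = ∑ i, ThI m (gen (σ.comp (face i))) := by
      simp only [ThI, ← Module.End.pow_apply, map_sum]
      exact Finset.sum_comm
    rw [hsum, map_sum, map_sum]
    refine Finset.sum_eq_zero fun i _ => ?_
    have hU : gen (σ.comp (face i)) ∈ S 3 {x | label h x ≠ i} :=
      gen_mem_S fun t => hσ _ _ (face_same i t)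
    exact S_le_comap (f := rainbowC h ∘ₗ d) (N := ⊥) (fun τ hτ => h0 τ i hτ) (ThI_mem_S m hU)
  rw [d_iter_Sd, hdg] at h1
  rw [d_ThI, d_d, map_add, map_add, h1] at h2
  have hT0 : ThI m (0 : Ch 2 X) = 0 := by simp [ThI]
  rw [hT0, map_zero, add_zero, add_zero, rainbowC_d] at h2
  have hv : ∀ i, label h (vtx σ i) = i := fun i => by
    by_contra hc
    exact hσ (stdSimplex.vertex i) (label h (vtx σ i)) (Pi.single_eq_of_ne hc _) rfl
  simp only [hv] at h2
  exact absurd h2 (by decide)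

end SurfT3

namespace SurfT3

/-! ### Affine simplices on the grid -/

/-- The affine simplex with given vertices. -/
noncomputable def affS {n k : ℕ} (v : Fin n → E k) : Sing n (E k) where
  toFun t := ∑ i, t i • v i
  continuous_toFun := by
    refine continuous_finsetSum _ fun i _ => ?_
    exact ((continuous_apply i).comp continuous_subtype_val).smul continuous_const

lemma affS_apply {n k : ℕ} (v : Fin n → E k) (t : Simp n) : affS v t = ∑ i, t i • v i := rfl

lemma affS_face {n k : ℕ} (v : Fin (n + 1) → E k) (i : Fin (n + 1)) :
    (affS v).comp (face i) = affS fun j => v (i.succAbove j) := by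
  refine ContinuousMap.ext fun t => ?_
  simp [affS_apply, Fin.sum_univ_succAbove _ i]

lemma affS_vertex {n k : ℕ} (v : Fin n → E k) (i : Fin n) :
    affS v (stdSimplex.vertex i) = v i := by
  rw [affS_apply, Finset.sum_eq_single i]
  · rw [show (stdSimplex.vertex i : Simp n) i = (1 : ℝ) from Pi.single_eq_same _ _, one_smul]
  · intro j _ hj
    rw [show (stdSimplex.vertex i : Simp n) j = (0 : ℝ) from Pi.single_eq_of_ne hj _, zero_smul]
  · simp

lemma affS_mem {n k : ℕ} {v : Fin n → E k} {K : Set (E k)} (hK : Convex ℝ K) (hv : ∀ i, v i ∈ K)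
    (t : Simp n) : affS v t ∈ K :=
  hK.sum_mem (fun i _ => stdSimplex.zero_le t i) (stdSimplex.sum_eq_one t) fun i _ => hv i

lemma affS_add {n k : ℕ} (v : Fin n → E k) (c : E k) (t : Simp n) :
    affS (fun i => v i + c) t = affS v t + c := by
  simp only [affS_apply, smul_add, Finset.sum_add_distrib, ← Finset.sum_smul]
  rw [show ∑ i, t i = 1 from stdSimplex.sum_eq_one t, one_smul]

/-- The rescaled lattice points. -/
noncomputable def pt (m : ℕ) (u : Lat) : E 3 := (m : ℝ)⁻¹ • toE u

lemma pt_apply (m : ℕ) (u : Lat) (i : Fin 3) : pt m u i = (m : ℝ)⁻¹ * u i := rfl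

lemma pt_add_smul (m : ℕ) [NeZero m] (u n : Lat) : pt m (u + (m : ℤ) • n) = pt m u + toE n := by
  funext i
  have : (m : ℝ) ≠ 0 := NeZero.ne _
  simp only [pt_apply, Pi.add_apply, Pi.smul_apply, toE]
  push_cast
  field_simp
  simp

/-- The affine tetrahedron on four rescaled lattice points. -/
noncomputable def tet (m : ℕ) (u v w x : Lat) : Sing 4 (E 3) :=
  affS ![pt m u, pt m v, pt m w, pt m x]

/-- The affine triangle on three rescaled lattice points. -/
noncomputable def tri (m : ℕ) (u v w : Lat) : Sing 3 (E 3) := affS ![pt m u, pt m v, pt m w]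

/-- The affine segment on two rescaled lattice points. -/
noncomputable def edg (m : ℕ) (u v : Lat) : Sing 2 (E 3) := affS ![pt m u, pt m v]

lemma d_tet (m : ℕ) (u v w x : Lat) :
    d (gen (tet m u v w x)) = delta (fun u v w => gen (tri m u v w)) u v w x := by
  rw [d_gen, Fin.sum_univ_four]
  simp only [tet, affS_face, delta, sub_eq_add_neg, neg_eq_self', tri]
  congr 3
  all_goals funext i; fin_cases i <;> rfl

lemma tri_face (m : ℕ) (u v w : Lat) : (tri m u v w).comp (face 0) = edg m v w ∧
    (tri m u v w).comp (face 1) = edg m u w ∧ (tri m u v w).comp (face 2) = edg m u v := by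
  refine ⟨?_, ?_, ?_⟩ <;> rw [tri, affS_face, edg] <;> congr 1 <;> funext i <;>
    fin_cases i <;> rfl

lemma d_tri (m : ℕ) (u v w : Lat) :
    d (gen (tri m u v w)) = gen (edg m v w) + gen (edg m u w) + gen (edg m u v) := by
  obtain ⟨h0, h1, h2⟩ := tri_face m u v w
  rw [d_gen, Fin.sum_univ_three, h0, h1, h2]

end SurfT3

namespace SurfT3

/-! ### The triangulated box -/

/-- The section of `ℤ³ → (ℤ/m)³` with values in a box with lower corner `c`. -/
def boxSec (m : ℕ) (c : Lat) (k : Fin 3 → ZMod m) : Lat := fun i => c i + (k i - c i).val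

variable {m : ℕ} [NeZero m] {c : Lat}

lemma isSec_boxSec : IsSec (boxSec m c) := fun k i => by simp [boxSec]

lemma boxSec_bounds (k : Fin 3 → ZMod m) (i : Fin 3) :
    c i ≤ boxSec m c k i ∧ boxSec m c k i < c i + m := by
  have := ZMod.val_lt (k i - (c i : ZMod m))
  simp only [boxSec]
  omega

lemma boxSec_eq {k : Fin 3 → ZMod m} {u : Lat} (h : ∀ i, ((u i : ℤ) : ZMod m) = k i)
    (hu : ∀ i, c i ≤ u i ∧ u i < c i + m) : boxSec m c k = u := by
  obtain ⟨n, hn⟩ := exists_eq_of_cast (m := m) (u := boxSec m c k) (v := u) fun i => by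
    rw [isSec_boxSec, h]
  have : n = 0 := by
    funext i
    have h1 := boxSec_bounds (c := c) k i
    have h2 := hu i
    rw [hn] at h1
    simp only [Pi.add_apply, Pi.smul_apply, smul_eq_mul] at h1
    have h3 : (m : ℤ) * n i < m := by linarith
    have h4 : -(m : ℤ) < (m : ℤ) * n i := by linarith
    have hm : 0 < (m : ℤ) := by exact_mod_cast NeZero.pos m
    have h5 : n i < 1 := by nlinarith
    have h6 : -1 < n i := by nlinarith
    simp only [Pi.zero_apply]
    omega
  rw [hn, this, smul_zero, add_zero]

/-- The open box of side one with lower corner `c / m`. -/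
def box (m : ℕ) (c : Lat) : Set (E 3) := {y | ∀ i, pt m c i < y i ∧ y i < pt m c i + 1}

omit [NeZero m] in
lemma convex_box : Convex ℝ (box m c) := by
  have : box m c = Set.univ.pi fun i => Set.Ioo (pt m c i) (pt m c i + 1) := by
    ext y; simp [box]
  rw [this]
  exact convex_pi fun i _ => convex_Ioo _ _

omit [NeZero m] in
lemma isBounded_box : Bornology.IsBounded (box m c) := by
  refine (Bornology.IsBounded.pi (S := fun i => Set.Ioo (pt m c i) (pt m c i + 1))
    fun i => Metric.isBounded_Ioo _ _).subset fun y hy i _ => hy i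

/-- The sum of all tetrahedra of the triangulated box. -/
noncomputable def boxChain (m : ℕ) [NeZero m] (c : Lat) : Ch 4 (E 3) :=
  gridSum (boxSec m c) fun u v w x => gen (tet m u v w x)

lemma d_boxChain : d (boxChain m c) =
    gridSum (boxSec m c) (delta fun u v w => gen (tri m u v w)) := by
  have := gridSum_map (d : Ch 4 (E 3) →ₗ[ZMod 2] Ch 3 (E 3)).toAddMonoidHom (boxSec m c)
    fun u v w x => gen (tet m u v w x)
  refine this.trans ?_
  exact congrArg (gridSum _) (by funext u v w x; exact d_tet m u v w x)

/-- The faces of the box. -/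
def boxFace (m : ℕ) (c : Lat) (a : Fin 3) (r : ℤ) : Set (E 3) :=
  {y | y a = pt m c a + r}

lemma gen_tri_mem {a b b' : Fin 3} (hb : a ≠ b) (hb' : a ≠ b') {g : Lat} {r : ℤ}
    (hg : g a = c a + m * r) :
    gen (tri m g (g + ee b) (g + ee b + ee b')) ∈ S 3 (boxFace m c a r) := by
  have hm : (m : ℝ) ≠ 0 := NeZero.ne _
  have h0 : ∀ {u : Lat}, u a = g a → pt m u ∈ boxFace m c a r := fun {u} hu => by
    change pt m u a = pt m c a + r
    rw [pt_apply, pt_apply, hu, hg]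
    push_cast
    field_simp
  have he : ∀ {b : Fin 3}, a ≠ b → ee b a = 0 := fun h => by simp [ee, h]
  refine gen_mem_S fun t => affS_mem (K := boxFace m c a r) ?_ ?_ t
  · have hl : IsLinearMap ℝ fun y : E 3 => y a := ⟨fun _ _ => rfl, fun _ _ => rfl⟩
    exact convex_hyperplane hl _
  · intro i
    fin_cases i
    · exact h0 rfl
    · exact h0 (by simp [he hb])
    · exact h0 (by simp [he hb, he hb'])

omit [NeZero m] in
lemma boxFace_subset {a : Fin 3} {r : ℤ} (hr : r = 0 ∨ r = 1) : boxFace m c a r ⊆ (box m c)ᶜ := by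
  intro y hy hyb
  have h1 : y a = pt m c a + r := hy
  have h2 := hyb a
  rcases hr with rfl | rfl
  · push_cast at h1; linarith
  · push_cast at h1; linarith

lemma gridSum_delta_box {M : Type} [AddCommGroup M] (P : AddSubgroup M) {χ : Lat → Lat → Lat → M}
    (h : ∀ g a b b' r, a ≠ b → a ≠ b' → (r = 0 ∨ r = 1) → g a = c a + m * r →
      χ g (g + ee b) (g + ee b + ee b') ∈ P) : gridSum (boxSec m c) (delta χ) ∈ P := by
  refine gridSum_delta_mem _ P fun k a b b' hb hb' => ?_
  set g := boxSec m c k + ee a with hg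
  set g' := boxSec m c (k + Pi.single a 1) with hg'
  have hm : 0 < (m : ℤ) := by exact_mod_cast NeZero.pos m
  have hga : g a = boxSec m c k a + 1 := by simp [hg, ee]
  have hgi : ∀ i, i ≠ a → g i = boxSec m c k i := fun i hi => by simp [hg, ee, hi]
  have hcast : ∀ i, ((g i : ℤ) : ZMod m) = (k + Pi.single a 1 : Fin 3 → ZMod m) i := fun i => by
    rw [hg, Pi.add_apply, Int.cast_add, isSec_boxSec, ee_cast, Pi.add_apply]
  by_cases hlt : g a < c a + m
  · have : g' = g := boxSec_eq hcast fun i => by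
      have := boxSec_bounds (c := c) k i
      rcases eq_or_ne i a with rfl | hi
      · rw [hga] at hlt ⊢; omega
      · rw [hgi i hi]; exact this
    rw [this, sub_self]
    exact P.zero_mem
  · have h1 : g a = c a + m := by
      have := boxSec_bounds (c := c) k a
      omega
    have h2 : g' = g - (m : ℤ) • ee a := boxSec_eq (fun i => by
      rw [Pi.sub_apply, Pi.smul_apply, Int.cast_sub, hcast]; simp) fun i => by
        have := boxSec_bounds (c := c) k i
        rcases eq_or_ne i a with rfl | hi
        · simp [h1, ee, NeZero.pos m]
        · simp only [Pi.sub_apply, Pi.smul_apply, hgi i hi, ee, Pi.single_eq_of_ne hi]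
          simpa using this
    refine P.sub_mem (h g a b b' 1 hb hb' (Or.inr rfl) (by rw [h1]; ring))
      (h g' a b b' 0 hb hb' (Or.inl rfl) ?_)
    rw [h2]
    simp [h1, ee]

lemma rel_boxChain : Rel (box m c) (boxChain m c) := by
  have := gridSum_delta_box (c := c) (m := m) (S 3 (box m c)ᶜ).toAddSubgroup
    (χ := fun u v w => gen (tri m u v w)) fun g a b b' r hb hb' hr hg =>
      S_mono (boxFace_subset hr) (gen_tri_mem hb hb' hg)
  rw [← d_boxChain] at this
  exact this

end SurfT3

namespace SurfT3

/-! ### The local degree of the triangulated box -/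

variable {m : ℕ} [NeZero m] {c : Lat}

/-- The scaled coordinates relative to a lattice point. -/
def relc (m : ℕ) (g : Lat) (i : Fin 3) : C(E 3, ℝ) :=
  ⟨fun y => m * y i - g i, by fun_prop⟩

lemma relc_apply (m : ℕ) (g : Lat) (i : Fin 3) (y : E 3) : relc m g i y = m * y i - g i := rfl

lemma relc_tet (g u v w x : Lat) (i : Fin 3) (t : Simp 4) :
    relc m g i (tet m u v w x t) =
      t 0 * (u i - g i) + t 1 * (v i - g i) + t 2 * (w i - g i) + t 3 * (x i - g i) := by
  have ht : t 0 + t 1 + t 2 + t 3 = 1 := by rw [← Fin.sum_univ_four]; exact stdSimplex.sum_eq_one t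
  have h1 : (tet m u v w x t) i = t 0 * pt m u i + t 1 * pt m v i + t 2 * pt m w i +
      t 3 * pt m x i := by
    change (∑ j, t j • (![pt m u, pt m v, pt m w, pt m x] : Fin 4 → E 3) j) i = _
    rw [Fin.sum_univ_four]
    rfl
  have hm : (m : ℝ) ≠ 0 := NeZero.ne _
  rw [relc_apply, h1]
  simp only [pt_apply]
  field_simp
  linear_combination (g i : ℝ) * ht

/-- An interior point of the first tetrahedron of the box. -/
noncomputable def testPt (m : ℕ) (c : Lat) : E 3 :=
  fun i => (m : ℝ)⁻¹ * (c i + (![3 / 4, 1 / 2, 1 / 4] : Fin 3 → ℝ) i)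

lemma relc_testPt (g : Lat) (i : Fin 3) :
    relc m g i (testPt m c) = c i - g i + (![3 / 4, 1 / 2, 1 / 4] : Fin 3 → ℝ) i := by
  have hm : (m : ℝ) ≠ 0 := NeZero.ne _
  rw [relc_apply, testPt, mul_inv_cancel_left₀ hm]
  ring

lemma testPt_bounds (i : Fin 3) : 0 < (![3 / 4, 1 / 2, 1 / 4] : Fin 3 → ℝ) i ∧
    (![3 / 4, 1 / 2, 1 / 4] : Fin 3 → ℝ) i < 1 := by
  fin_cases i <;> norm_num

lemma testPt_mem : testPt m c ∈ box m c := by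
  intro i
  obtain ⟨h0, h1⟩ := testPt_bounds i
  have hm : (0 : ℝ) < m := by exact_mod_cast NeZero.pos m
  have hm1 : (1 : ℝ) ≤ m := by exact_mod_cast NeZero.pos m
  rw [testPt, pt_apply]
  constructor
  · gcongr; linarith
  · rw [mul_add]
    have : (m : ℝ)⁻¹ * (![3 / 4, 1 / 2, 1 / 4] : Fin 3 → ℝ) i < 1 := by
      rw [inv_mul_lt_iff₀ hm]; linarith
    linarith

lemma not_null_first : ¬ Null {testPt m c}
    (gen (tet m c (c + ee 0) (c + ee 0 + ee 1) (c + ee 0 + ee 1 + ee 2))) := by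
  have hm : (m : ℝ) ≠ 0 := NeZero.ne _
  let h : Fin 3 → C(E 3, ℝ) := ![⟨fun y => 3 / 4 - relc m c 0 y, by fun_prop⟩,
    ⟨fun y => relc m c 0 y - relc m c 1 y - 1 / 4, by fun_prop⟩,
    ⟨fun y => relc m c 1 y - relc m c 2 y - 1 / 4, by fun_prop⟩]
  refine not_null_of_label (h := h) (fun x hx => ?_) fun t i ht => ?_
  · have h0 : 3 / 4 - relc m c 0 x = 0 := hx 0
    have h1 : relc m c 0 x - relc m c 1 x - 1 / 4 = 0 := hx 1
    have h2 : relc m c 1 x - relc m c 2 x - 1 / 4 = 0 := hx 2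
    funext i
    rw [testPt, eq_inv_mul_iff_mul_eq₀ hm]
    simp only [relc_apply] at h0 h1 h2
    fin_cases i
    · change m * x 0 = c 0 + 3 / 4; linarith
    · change m * x 1 = c 1 + 1 / 2; linarith
    · change m * x 2 = c 2 + 1 / 4; linarith
  · set y := tet m c (c + ee 0) (c + ee 0 + ee 1) (c + ee 0 + ee 1 + ee 2) t with hy
    have hs : t 0 + t 1 + t 2 + t 3 = 1 := by
      rw [← Fin.sum_univ_four]; exact stdSimplex.sum_eq_one t
    have e0 : relc m c 0 y = t 1 + t 2 + t 3 := by rw [hy, relc_tet]; simp [ee]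
    have e1 : relc m c 1 y = t 2 + t 3 := by rw [hy, relc_tet]; simp [ee]
    have e2 : relc m c 2 y = t 3 := by rw [hy, relc_tet]; simp [ee]
    have h0 : h 0 y = 3 / 4 - relc m c 0 y := rfl
    have h1 : h 1 y = relc m c 0 y - relc m c 1 y - 1 / 4 := rfl
    have h2 : h 2 y = relc m c 1 y - relc m c 2 y - 1 / 4 := rfl
    rw [e0] at h0
    rw [e0, e1] at h1
    rw [e1, e2] at h2
    intro hl
    rw [label] at hl
    split_ifs at hl with c0 c1 c2
    · subst hl; linarith
    · subst hl; linarith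
    · subst hl; linarith
    · subst hl; linarith

lemma tet_order {g : Lat} {α β γ : Fin 3} (hab : α ≠ β) (hac : α ≠ γ) (hbc : β ≠ γ) (t : Simp 4) :
    relc m g β (tet m g (g + ee α) (g + ee α + ee β) (g + ee α + ee β + ee γ) t) ≤
      relc m g α (tet m g (g + ee α) (g + ee α + ee β) (g + ee α + ee β + ee γ) t) ∧
    relc m g γ (tet m g (g + ee α) (g + ee α + ee β) (g + ee α + ee β + ee γ) t) ≤
      relc m g β (tet m g (g + ee α) (g + ee α + ee β) (g + ee α + ee β + ee γ) t) := by
  have := stdSimplex.zero_le t 1; have := stdSimplex.zero_le t 2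
  simp only [relc_tet]
  constructor
  · simp [ee, hab, hac, hbc, hab.symm]
  · simp [ee, hbc, hab.symm, hac.symm, hbc.symm]

lemma tet_cell {u v w x : Lat} (h : Cell u v w x) (t : Simp 4) (i : Fin 3) :
    0 ≤ relc m u i (tet m u v w x t) ∧ relc m u i (tet m u v w x t) ≤ 1 := by
  have := stdSimplex.zero_le t 0; have h1 := stdSimplex.zero_le t 1
  have h2 := stdSimplex.zero_le t 2; have h3 := stdSimplex.zero_le t 3
  have hs : t 0 + t 1 + t 2 + t 3 = 1 := by
    rw [← Fin.sum_univ_four]; exact stdSimplex.sum_eq_one t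
  obtain ⟨⟨ha, hb, hc⟩, hd⟩ := h i
  have hv0 : (0 : ℝ) ≤ v i - u i := by exact_mod_cast (by omega : (0 : ℤ) ≤ v i - u i)
  have hw0 : (0 : ℝ) ≤ w i - u i := by exact_mod_cast (by omega : (0 : ℤ) ≤ w i - u i)
  have hx0 : (0 : ℝ) ≤ x i - u i := by exact_mod_cast (by omega : (0 : ℤ) ≤ x i - u i)
  have hv1 : (v i - u i : ℝ) ≤ 1 := by exact_mod_cast (by omega : v i - u i ≤ (1 : ℤ))
  have hw1 : (w i - u i : ℝ) ≤ 1 := by exact_mod_cast (by omega : w i - u i ≤ (1 : ℤ))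
  have hx1 : (x i - u i : ℝ) ≤ 1 := by exact_mod_cast (by omega : x i - u i ≤ (1 : ℤ))
  rw [relc_tet, sub_self, mul_zero, zero_add]
  exact ⟨by positivity, by nlinarith⟩

theorem val_boxChain {a : E 3} (ha : a ∈ box m c) : val a (boxChain m c) = 1 := by
  rw [val_const_E convex_box isBounded_box rel_boxChain ha testPt_mem]
  set b := testPt m c
  set P : Submodule (ZMod 2) (Ch 4 (E 3)) := S 4 {b}ᶜ
  have hcell : ∀ k, boxSec m c k ≠ c → cubeSum (fun u v w x => gen (tet m u v w x)) (boxSec m c k) ∈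
      P.toAddSubgroup := by
    intro k hk
    refine cubeSum_mem _ fun v w x hx => gen_mem_S fun t ht => hk (funext fun i => ?_)
    have h1 := tet_cell (m := m) hx t i
    rw [show tet m (boxSec m c k) v w x t = b from ht, relc_testPt] at h1
    obtain ⟨h2, h3⟩ := testPt_bounds i
    have h4 : boxSec m c k i - c i < 1 := by
      have : ((boxSec m c k i : ℝ) - c i) < 1 := by linarith
      exact_mod_cast this
    have h5 : -1 < boxSec m c k i - c i := by
      have : (-1 : ℝ) < ((boxSec m c k i : ℝ) - c i) := by linarith
      exact_mod_cast this
    omega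
  have hord : ∀ {α β γ : Fin 3}, α ≠ β → α ≠ γ → β ≠ γ → (β < α ∨ γ < β) →
      gen (tet m c (c + ee α) (c + ee α + ee β) (c + ee α + ee β + ee γ)) ∈ P := by
    intro α β γ h1 h2 h3 h4
    refine gen_mem_S fun t ht => ?_
    have h5 := tet_order (m := m) (g := c) h1 h2 h3 t
    rw [show tet m c (c + ee α) (c + ee α + ee β) (c + ee α + ee β + ee γ) t = b from ht] at h5
    simp only [b, relc_testPt, sub_self, zero_add] at h5
    have hmono : ∀ i j : Fin 3, i < j → (![3 / 4, 1 / 2, 1 / 4] : Fin 3 → ℝ) j <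
        (![3 / 4, 1 / 2, 1 / 4] : Fin 3 → ℝ) i := by
      intro i j hij
      fin_cases i <;> fin_cases j <;> first | (exact absurd hij (by decide)) | norm_num
    rcases h4 with h4 | h4
    · exact absurd h5.1 (not_le.2 (hmono _ _ h4))
    · exact absurd h5.2 (not_le.2 (hmono _ _ h4))
  set k₀ : Fin 3 → ZMod m := fun i => (c i : ZMod m) with hk₀
  have hm : 0 < (m : ℤ) := by exact_mod_cast NeZero.pos m
  have hs : boxSec m c k₀ = c := boxSec_eq (fun i => rfl) fun i => ⟨le_rfl, by omega⟩
  set τ := gen (tet m c (c + ee 0) (c + ee 0 + ee 1) (c + ee 0 + ee 1 + ee 2)) with hτ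
  have hsum : boxChain m c + τ ∈ P := by
    rw [boxChain, gridSum, ← Finset.add_sum_erase _ _ (Finset.mem_univ k₀), add_right_comm]
    refine P.add_mem ?_ (P.sum_mem fun k hk => hcell k fun h => Finset.ne_of_mem_erase hk ?_)
    · rw [hs, cubeSum, Fin.sum_univ_three]
      simp only [sub_eq_add_neg, neg_eq_self']
      have e : ∀ x y z u v w : Ch 4 (E 3), x + y + (z + u) + (v + w) + x = y + z + u + v + w :=
        fun x y z u v w => by
          refine of_one_smul ?_
          match_scalars <;> decide
      change τ + _ + (_ + _) + (_ + _) + τ ∈ P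
      rw [e]
      refine P.add_mem (P.add_mem (P.add_mem (P.add_mem ?_ ?_) ?_) ?_) ?_
      all_goals exact hord (by decide) (by decide) (by decide) (by decide)
    · funext i
      rw [← isSec_boxSec (c := c) k i, h]
  have hne : val b (boxChain m c) ≠ 0 := fun h0 =>
    not_null_first ((null_of_mem hsum).iff.1 (val_eq_zero.1 h0))
  generalize val b (boxChain m c) = x at hne
  revert x; decide

end SurfT3

namespace SurfT3

/-! ### A fundamental chain of the periodic surface -/

/-- A translation of Euclidean space. -/
def trE {k : ℕ} (a : E k) : C(E k, E k) := ⟨fun v => v + a, by fun_prop⟩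

lemma isOpenEmbedding_trE {k : ℕ} (a : E k) : Topology.IsOpenEmbedding (trE a) :=
  (Homeomorph.addRight a).isOpenEmbedding

lemma norm_toE_ee (a : Fin 3) : ‖toE (ee a)‖ ≤ 1 := by
  refine (pi_norm_le_iff_of_nonneg zero_le_one).2 fun i => ?_
  rcases eq_or_ne i a with rfl | h
  · simp [toE, ee]
  · simp [toE, ee, h]

lemma val_eq_one_iff {X : Type} [TopologicalSpace X] {n : ℕ} {a : X} {c : Ch (n + 1) X} :
    val a c = 1 ↔ ¬ Null {a} c := by
  by_cases h : Null {a} c <;> simp [val, h]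

namespace Tube

variable {Z : Type} [TopologicalSpace Z] (D : Tube Z)

/-- The inclusion of the preimage of the surface. -/
def inc : C(D.Zt, E 3) := ⟨Subtype.val, continuous_subtype_val⟩

/-- A lattice translation of the preimage of the surface. -/
def trZ (n : Lat) : C(D.Zt, D.Zt) where
  toFun v := ⟨v + toE n, (D.add_toE_mem_Zt n).2 v.2⟩
  continuous_toFun := (continuous_subtype_val.add continuous_const).subtype_mk _

lemma isOpenEmbedding_trZ (n : Lat) : Topology.IsOpenEmbedding (D.trZ n) := by
  let h : D.Zt ≃ₜ D.Zt :=
    { toFun := D.trZ n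
      invFun := D.trZ (-n)
      left_inv := fun v => Subtype.ext (by
        change (v : E 3) + toE n + toE (-n) = v
        rw [toE_neg]; abel)
      right_inv := fun v => Subtype.ext (by
        change (v : E 3) + toE (-n) + toE n = v
        rw [toE_neg]; abel)
      continuous_toFun := (D.trZ n).continuous
      continuous_invFun := (D.trZ (-n)).continuous }
  exact h.isOpenEmbedding

lemma isCompact_ball (R : ℝ) : IsCompact {v : D.Zt | (v : E 3) ∈ Metric.closedBall 0 R} :=
  D.isClosed_Zt.isClosedEmbedding_subtypeVal.isCompact_preimage (isCompact_closedBall 0 R)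

lemma push_inc_mem {n : ℕ} {c : Ch n D.Zt} {a : E 3} (ha : a ∉ D.Zt) :
    push D.inc c ∈ S n {a}ᶜ := by
  refine push_mem_S (U := Set.univ) (fun x _ h => ?_) (S_univ c)
  exact ha (h ▸ x.2)

/-- The part of the surface upstairs in a closed ball. -/
def ZB (R : ℝ) : Set D.Zt := {v | (v : E 3) ∈ Metric.closedBall 0 R}

lemma exists_fundamental (hZ : LocEuc 2 Z) (R : ℝ) :
    ∃ μ : Ch 3 D.Zt, Rel (D.ZB R) μ ∧ ∀ a ∈ D.ZB R, val a μ = 1 := by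
  obtain ⟨μ, h1, h2⟩ := ((D.locEuc_Zt hZ).loc (D.isCompact_ball R)).exist (fun _ => 1)
    (IsLocallyConstant.const 1)
  exact ⟨μ, h1, fun a ha => val_eq_one_iff.2 fun h => one_ne_zero ((h2 a ha).1 h)⟩

lemma rel_push_inc {R : ℝ} {μ : Ch 3 D.Zt} (hμ : Rel (D.ZB R) μ) :
    Rel (Metric.closedBall (0 : E 3) R) (push D.inc μ) :=
  hμ.push fun _ hx => hx

lemma exists_filling {R : ℝ} (hR : 0 ≤ R) {μ : Ch 3 D.Zt} (hμ : Rel (D.ZB R) μ) :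
    ∃ e : Ch 4 (E 3), push D.inc μ + d e ∈ S 3 (Metric.closedBall (0 : E 3) R)ᶜ := by
  have hB := D.rel_push_inc hμ
  have h0 : (0 : E 3) ∈ Metric.closedBall (0 : E 3) R := Metric.mem_closedBall_self hR
  have h1 : Null {(0 : E 3)} (push D.inc μ) := (homSphere_point (0 : E 3)).vanish 2 (by decide) _
    (hB.mono (by simpa using h0))
  exact h1.of_point ((convex_closedBall _ _).starConvex h0) Metric.isBounded_closedBall hB

lemma rel_filling {R : ℝ} {μ : Ch 3 D.Zt} {e : Ch 4 (E 3)}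
    (he : push D.inc μ + d e ∈ S 3 (Metric.closedBall (0 : E 3) R)ᶜ) {K : Set (E 3)}
    (hK : K ⊆ Metric.closedBall 0 R) (hKZ : Disjoint K D.Zt) : Rel K e := by
  have h1 : push D.inc μ ∈ S 3 Kᶜ := by
    refine push_mem_S (U := Set.univ) (fun x _ h => ?_) (S_univ μ)
    exact Set.disjoint_left.1 hKZ h x.2
  have h2 := S_mono (Set.compl_subset_compl.2 hK) he
  exact (Submodule.add_mem_iff_right _ h1).1 h2

lemma exists_side_step (hZ : LocEuc 2 Z) {μ : Ch 3 D.Zt} (hμ : Rel (D.ZB 5) μ)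
    (hv : ∀ a ∈ D.ZB 5, val a μ = 1) {e : Ch 4 (E 3)}
    (he : push D.inc μ + d e ∈ S 3 (Metric.closedBall (0 : E 3) 5)ᶜ) {n : Lat}
    (hn : ‖toE n‖ ≤ 1) : ∃ δ : ZMod 2, ∀ a ∉ D.Zt, a ∈ Metric.closedBall (0 : E 3) 4 →
      val a e + val (a - toE n) e = δ := by
  have hsh : ∀ v : E 3, v + toE n ∈ Metric.closedBall (0 : E 3) 4 →
      v ∈ Metric.closedBall (0 : E 3) 5 := fun v hv => by
    rw [mem_closedBall_zero_iff] at *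
    have := norm_sub_le (v + toE n) (toE n)
    rw [add_sub_cancel_right] at this
    linarith
  have hμ' : Rel (D.ZB 4) (push (D.trZ n) μ) := hμ.push fun x hx h => hx (hsh _ h)
  have hμ4 : Rel (D.ZB 4) μ := hμ.mono fun x hx => Metric.closedBall_subset_closedBall
    (by norm_num) hx
  have hnull : Null (D.ZB 4) (μ + push (D.trZ n) μ) := by
    refine ((D.locEuc_Zt hZ).loc (D.isCompact_ball 4)).uniq _ (hμ4.add hμ') fun a ha => ?_
    have h1 : val a μ = 1 := hv a (Metric.closedBall_subset_closedBall (by norm_num) ha)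
    obtain ⟨b, rfl⟩ : ∃ b, D.trZ n b = a := ⟨D.trZ (-n) a, Subtype.ext (by
      change (a : E 3) + toE (-n) + toE n = a
      rw [toE_neg]; abel)⟩
    have h2 : val (D.trZ n b) (push (D.trZ n) μ) = 1 := by
      rw [val_push (D.isOpenEmbedding_trZ n)]
      exact hv b (hsh _ ha)
    exact (D.locEuc_Zt hZ).uniqPt _ _ _ (hμ4.mono (Set.singleton_subset_iff.2 ha))
      (hμ'.mono (Set.singleton_subset_iff.2 ha)) (val_eq_one_iff.1 h1) (val_eq_one_iff.1 h2)
  obtain ⟨f, hf⟩ := hnull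
  let T := trE (toE n)
  have hcomm : push T (push D.inc μ) = push D.inc (push (D.trZ n) μ) := by
    rw [push_push, push_push]; rfl
  have hTe : push T (push D.inc μ + d e) ∈ S 3 (Metric.closedBall (0 : E 3) 4)ᶜ := by
    refine push_mem_S (fun x hx h => ?_) he
    exact hx (hsh x h)
  have hsub : Metric.closedBall (0 : E 3) 4 ⊆ Metric.closedBall 0 5 :=
    Metric.closedBall_subset_closedBall (by norm_num)
  have he4 := S_mono (Set.compl_subset_compl.2 hsub) he
  have hf4 : push D.inc (μ + push (D.trZ n) μ + d f) ∈ S 3 (Metric.closedBall (0 : E 3) 4)ᶜ :=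
    push_mem_S (fun x hx => hx) hf
  have hrel : Rel (Metric.closedBall (0 : E 3) 4) (e + push T e + push D.inc f) := by
    have := Submodule.add_mem _ (Submodule.add_mem _ he4 hTe) hf4
    rw [Rel]
    convert this using 1
    simp only [map_add, d_push, hcomm]
    refine of_one_smul ?_
    match_scalars <;> decide
  refine ⟨val 0 (e + push T e + push D.inc f), fun a ha ha4 => ?_⟩
  rw [val_const_E (convex_closedBall _ _) Metric.isBounded_closedBall hrel
    (Metric.mem_closedBall_self (by norm_num)) ha4]
  have h1 : val a (e + push T e + push D.inc f) = val a (e + push T e) := by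
    refine val_congr ?_
    convert null_of_mem (D.push_inc_mem (c := f) ha) using 1
    refine of_one_smul ?_
    match_scalars <;> decide
  have h2 : T (a - toE n) = a := sub_add_cancel a (toE n)
  have hr1 : Rel {a} e := D.rel_filling he (by simpa using hsub ha4) (by simpa using ha)
  have hr2 : Rel {a} (push T e) := by
    have : Rel {a - toE n} e := by
      refine D.rel_filling he ?_ ?_
      · rw [Set.singleton_subset_iff]
        exact hsh _ (by rwa [sub_add_cancel])
      · rw [Set.disjoint_singleton_left, ← D.add_toE_mem_Zt n, sub_add_cancel]
        exact ha
    refine this.push fun x hx h => hx ?_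
    rw [Set.mem_singleton_iff] at h ⊢
    rw [← h]
    exact (add_sub_cancel_right _ _).symm
  rw [h1, val_add (uniqPt_E 3) hr1 hr2]
  congr 1
  conv_rhs => rw [← h2]
  rw [val_push (isOpenEmbedding_trE _)]

end Tube

end SurfT3

namespace SurfT3

/-! ### The side function of the complement of the periodic surface -/

namespace Tube

variable {Z : Type} [TopologicalSpace Z]

/-- A fundamental chain of the surface upstairs, a filling of it, and an integer-valued function
whose parity tells the side of the surface. -/
structure Side (D : Tube Z) where
  /-- The fundamental chain. -/
  μ : Ch 3 D.Zt
  rel_μ : Rel (D.ZB 5) μ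
  val_μ : ∀ a ∈ D.ZB 5, val a μ = 1
  /-- The filling. -/
  e : Ch 4 (E 3)
  mem_e : push D.inc μ + d e ∈ SurfT3.S 3 (Metric.closedBall (0 : E 3) 5)ᶜ
  /-- The side function. -/
  S : E 3 → ℤ
  /-- The translation character. -/
  δ : Lat → ℤ
  S_add : ∀ v n, S (v + toE n) = S v + δ n
  S_eq : ∀ v ∉ D.Zt, (∀ i, -1 ≤ v i ∧ v i < 2) → (S v : ZMod 2) = val v e

variable (D : Tube Z)

/-- The integral part of a vector. -/
noncomputable def flr (v : E 3) : Lat := fun i => ⌊v i⌋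

lemma flr_add (v : E 3) (n : Lat) : flr (v + toE n) = flr v + n := by
  funext i; simp [flr, toE]

theorem exists_side (hZ : LocEuc 2 Z) : Nonempty D.Side := by
  obtain ⟨μ, hμ, hv⟩ := D.exists_fundamental hZ 5
  obtain ⟨e, he⟩ := D.exists_filling (by norm_num) hμ
  choose δ hδ using fun k : Fin 3 => D.exists_side_step hZ hμ hv he (norm_toE_ee k)
  let dd : Lat → ℤ := fun n => ∑ k, ((δ k).val : ℤ) * n k
  have hdd : ∀ n n', dd (n + n') = dd n + dd n' := fun n n' => by
    simp only [dd, Pi.add_apply, mul_add, Finset.sum_add_distrib]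
  have hde : ∀ k, (dd (ee k) : ZMod 2) = δ k := fun k => by
    simp [dd, ee, Pi.single_apply]
  let s : E 3 → ℤ := fun v => ((val (v - toE (flr v)) e).val : ℤ) + dd (flr v)
  have hs : ∀ v n, s (v + toE n) = s v + dd n := fun v n => by
    simp only [s, flr_add, hdd, toE_add]
    rw [add_sub_add_right_eq_sub, add_assoc]
  have step : ∀ v ∉ D.Zt, v ∈ Metric.closedBall (0 : E 3) 4 → ∀ k,
      ((s v : ZMod 2) = val v e ↔ (s (v - toE (ee k)) : ZMod 2) = val (v - toE (ee k)) e) := by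
    intro v hv hv4 k
    have h1 := hδ k v hv hv4
    have h2 : (s v : ZMod 2) = ((s (v - toE (ee k)) + dd (ee k) : ℤ) : ZMod 2) := by
      rw [← hs, sub_add_cancel]
    rw [Int.cast_add (s (v - toE (ee k))), hde, ← h1] at h2
    rw [h2]
    generalize (s (v - toE (ee k)) : ZMod 2) = a
    generalize val v e = b
    generalize val (v - toE (ee k)) e = c
    clear * -
    revert a b c
    decide
  have ball : ∀ v : E 3, (∀ i, -1 ≤ v i ∧ v i < 2) → v ∈ Metric.closedBall (0 : E 3) 4 :=
    fun v hv => by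
      rw [mem_closedBall_zero_iff]
      refine (pi_norm_le_iff_of_nonneg (by norm_num)).2 fun i => ?_
      rw [Real.norm_eq_abs, abs_le]
      exact ⟨by linarith [(hv i).1], by linarith [(hv i).2]⟩
  have red : ∀ (J : Finset (Fin 3)) (v : E 3), v ∉ D.Zt → (∀ i, -1 ≤ v i ∧ v i < 2) →
      (∀ i ∉ J, 0 ≤ v i ∧ v i < 1) → (s v : ZMod 2) = val v e := by
    intro J
    induction J using Finset.induction_on with
    | empty =>
      intro v hv _ h
      have : flr v = 0 := by
        funext i
        exact Int.floor_eq_zero_iff.2 (h i (Finset.notMem_empty i))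
      have h0 : dd 0 = 0 := by simp [dd]
      have h1 : toE 0 = 0 := by funext i; simp [toE]
      simp [s, this, h0, h1]
    | insert k J hk ih =>
      intro v hv hb h
      have coord : ∀ i, i ≠ k → toE (ee k) i = 0 := fun i hi => by simp [toE, ee, hi]
      have coordk : toE (ee k) k = 1 := by simp [toE, ee]
      rcases lt_or_ge (v k) 0 with h0 | h0
      · have hv' : v + toE (ee k) ∉ D.Zt := by rwa [D.add_toE_mem_Zt]
        have hb' : ∀ i, -1 ≤ (v + toE (ee k)) i ∧ (v + toE (ee k)) i < 2 := by
          intro i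
          have := hb i
          rcases eq_or_ne i k with rfl | hi
          · rw [Pi.add_apply, coordk]; constructor <;> linarith
          · rwa [Pi.add_apply, coord i hi, add_zero]
        have := (step _ hv' (ball _ hb') k).1 (ih _ hv' hb' fun i hi => by
          rcases eq_or_ne i k with rfl | hik
          · rw [Pi.add_apply, coordk]; constructor <;> linarith [hb i]
          · rw [Pi.add_apply, coord i hik, add_zero]
            exact h i (by simp [hik, hi]))
        rwa [add_sub_cancel_right] at this
      · rcases lt_or_ge (v k) 1 with h1 | h1
        · refine ih v hv hb fun i hi => ?_
          rcases eq_or_ne i k with rfl | hik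
          · exact ⟨h0, h1⟩
          · exact h i (by simp [hik, hi])
        · refine (step v hv (ball v hb) k).2 (ih _ ?_ ?_ ?_)
          · rwa [← D.add_toE_mem_Zt (ee k), sub_add_cancel]
          · intro i
            have := hb i
            rcases eq_or_ne i k with rfl | hi
            · rw [Pi.sub_apply, coordk]; constructor <;> linarith
            · rwa [Pi.sub_apply, coord i hi, sub_zero]
          · intro i hi
            rcases eq_or_ne i k with rfl | hik
            · rw [Pi.sub_apply, coordk]; constructor <;> linarith [hb i]
            · rw [Pi.sub_apply, coord i hik, sub_zero]
              exact h i (by simp [hik, hi])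
  exact ⟨⟨μ, hμ, hv, e, he, s, dd, hs, fun v hv hb => red Finset.univ v hv hb (by simp)⟩⟩

variable {D} (A : D.Side)

lemma Side.val_segment {v w : E 3} (hb : ∀ i, -1 ≤ v i ∧ v i < 2) (hb' : ∀ i, -1 ≤ w i ∧ w i < 2)
    (h : Disjoint (segment ℝ v w) D.Zt) : (A.S v : ZMod 2) = A.S w := by
  have hc : segment ℝ v w ⊆ Metric.closedBall (0 : E 3) 5 := by
    refine (convex_closedBall (0 : E 3) 5).segment_subset ?_ ?_ <;>
    · rw [mem_closedBall_zero_iff]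
      refine (pi_norm_le_iff_of_nonneg (by norm_num)).2 fun i => ?_
      have := hb i; have := hb' i
      rw [Real.norm_eq_abs, abs_le]
      constructor <;> linarith
  rw [A.S_eq v (Set.disjoint_left.1 h (left_mem_segment ℝ v w)) hb,
    A.S_eq w (Set.disjoint_left.1 h (right_mem_segment ℝ v w)) hb']
  exact val_const_E (convex_segment v w) (Metric.isBounded_closedBall.subset hc)
    (D.rel_filling A.mem_e hc h) (left_mem_segment ℝ v w) (right_mem_segment ℝ v w)

/-- The side function has constant parity along short segments off the surface. -/
lemma Side.S_segment {v w : E 3} (hvw : ‖w - v‖ ≤ 1 / 2)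
    (h : Disjoint (segment ℝ v w) D.Zt) : (A.S v : ZMod 2) = A.S w := by
  have hf : ∀ i, 0 ≤ (v + toE (-flr v)) i ∧ (v + toE (-flr v)) i < 1 := fun i => by
    have h1 := Int.floor_le (v i)
    have h2 := Int.lt_floor_add_one (v i)
    simp only [toE, flr, Pi.add_apply, Pi.neg_apply, Int.cast_neg]
    constructor <;> linarith
  have key := A.val_segment (v := v + toE (-flr v)) (w := w + toE (-flr v))
    (fun i => ⟨by linarith [hf i], by linarith [hf i]⟩) (fun i => by
      have h1 := (norm_le_pi_norm (w - v) i).trans hvw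
      rw [Real.norm_eq_abs, abs_le, Pi.sub_apply] at h1
      have h2 := hf i
      rw [Pi.add_apply] at h2 ⊢
      constructor <;> linarith) (by
      rw [Set.disjoint_left]
      rintro _ ⟨a, b, ha, hb, hab, rfl⟩ hx
      have hm : a • v + b • w ∈ segment ℝ v w := ⟨a, b, ha, hb, hab, rfl⟩
      refine Set.disjoint_left.1 h hm ?_
      rw [← D.add_toE_mem_Zt (-flr v)]
      convert hx using 1
      rw [smul_add, smul_add, add_add_add_comm, ← add_smul, hab, one_smul])
  rw [A.S_add, A.S_add, Int.cast_add, Int.cast_add] at key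
  exact add_right_cancel key

end Tube

end SurfT3

namespace SurfT3

/-! ### Fine scales -/

namespace Tube

variable {Z : Type} [TopologicalSpace Z] (D : Tube Z)

/-- `δ` is small compared with the tube and with charts of the surface. -/
structure Fine (δ : ℝ) : Prop where
  pos : 0 < δ
  mem_Nt : ∀ v ∈ D.Zt, ∀ x : E 3, ‖x - v‖ < δ → x ∈ D.Nt
  chart : ∀ z : Z, ∃ j : C(E 2, Z), Topology.IsOpenEmbedding j ∧ z ∈ Set.range j ∧
    ∀ x y : D.Nt, (∃ v ∈ D.Zt, ‖(x : E 3) - v‖ < δ) → ‖(y : E 3) - x‖ < δ → D.rt x = z →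
      D.rt y ∈ Set.range j

lemma exists_fine [CompactSpace Z] (hZ : LocEuc 2 Z) : ∃ δ, D.Fine δ := by
  choose j hj hzj using hZ
  let U : Z → Set Tor := fun z => Subtype.val '' (D.r ⁻¹' Set.range (j z))
  have hU : ∀ z, IsOpen (U z) := fun z =>
    D.isOpen_N.isOpenMap_subtype_val _ ((hj z).isOpen_range.preimage D.r.continuous)
  have hK : IsCompact (Set.range D.ι) := isCompact_range D.ι.continuous
  have hmem : ∀ z i, D.ι z ∈ U i → z ∈ Set.range (j i) := by
    rintro z i ⟨⟨x, hx⟩, h, rfl⟩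
    have h2 : D.r ⟨D.ι z, hx⟩ ∈ Set.range (j i) := h
    rwa [D.retract] at h2
  have hcov : Set.range D.ι ⊆ ⋃ z, U z := by
    rintro _ ⟨z, rfl⟩
    refine Set.mem_iUnion.2 ⟨z, ⟨D.ι z, D.range_le ⟨z, rfl⟩⟩, ?_, rfl⟩
    change D.r _ ∈ Set.range (j z)
    rw [D.retract]
    exact hzj z
  obtain ⟨ε, hε, hb⟩ := lebesgue_number_lemma_of_metric hK hU hcov
  let V : Set Tor := Subtype.val '' {x : D.N | ‖D.ι (D.r x) - x‖ < ε / 2}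
  have hV : IsOpen V := by
    refine D.isOpen_N.isOpenMap_subtype_val _ (isOpen_lt ?_ continuous_const)
    exact ((D.ι.continuous.comp D.r.continuous).sub continuous_subtype_val).norm
  have hKV : Set.range D.ι ⊆ V := by
    rintro _ ⟨z, rfl⟩
    refine ⟨⟨D.ι z, D.range_le ⟨z, rfl⟩⟩, ?_, rfl⟩
    change ‖D.ι (D.r _) - _‖ < _
    rw [D.retract, sub_self, norm_zero]
    linarith
  obtain ⟨δ, hδ, ht⟩ := hK.exists_thickening_subset_open hV hKV
  have key : ∀ v ∈ D.Zt, ∀ x : E 3, ‖x - v‖ < δ → tp x ∈ V := fun v hv x hx => by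
    refine ht (Metric.mem_thickening_iff.2 ⟨tp v, hv, ?_⟩)
    rw [dist_eq_norm, ← tp_sub]
    exact (norm_tp_le _).trans_lt hx
  refine ⟨min δ (ε / 2), lt_min hδ (by linarith), fun v hv x hx => ?_, fun z => ?_⟩
  · obtain ⟨y, -, hy⟩ := key v hv x (hx.trans_le (min_le_left _ _))
    change tp x ∈ D.N
    rw [← hy]
    exact y.2
  · obtain ⟨i, hi⟩ := hb (D.ι z) ⟨z, rfl⟩
    refine ⟨j i, hj i, hmem z i (hi (Metric.mem_ball_self hε)), ?_⟩
    rintro x y ⟨v, hv, hxv⟩ hyx rfl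
    obtain ⟨x', hx', hxx⟩ := key v hv x (hxv.trans_le (min_le_left _ _))
    have hx2 : ‖D.ι (D.rt x) - tp x‖ < ε / 2 := by
      have : x' = ⟨tp x, x.2⟩ := Subtype.ext hxx
      rw [this] at hx'
      exact hx'
    have hy : tp y ∈ U i := by
      refine hi ?_
      rw [Metric.mem_ball, dist_eq_norm]
      have h1 := norm_sub_le_norm_sub_add_norm_sub (tp y) (tp x) (D.ι (D.rt x))
      rw [norm_sub_rev (tp x), ← tp_sub] at h1
      have h2 := (norm_tp_le ((y : E 3) - x)).trans_lt (hyx.trans_le (min_le_right _ _))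
      linarith
    obtain ⟨y', hy', hyy⟩ := hy
    have : y' = ⟨tp y, y.2⟩ := Subtype.ext hyy
    rw [this] at hy'
    exact hy'

end Tube

end SurfT3

namespace SurfT3

/-! ### The fundamental cycle of the surface as a grid sum -/

/-- The closed cube of side `1 / m` at a rescaled lattice point. -/
noncomputable def cub (m : ℕ) (u : Lat) : Set (E 3) :=
  Set.Icc (pt m u) (pt m u + fun _ => (m : ℝ)⁻¹)

lemma convex_cub (m : ℕ) (u : Lat) : Convex ℝ (cub m u) := convex_Icc _ _

lemma norm_sub_le_of_mem_cub {m : ℕ} {u : Lat} {x y : E 3} (hx : x ∈ cub m u)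
    (hy : y ∈ cub m u) : ‖x - y‖ ≤ (m : ℝ)⁻¹ := by
  refine (pi_norm_le_iff_of_nonneg (by positivity)).2 fun i => ?_
  have h1 := hx.1 i; have h2 := hx.2 i; have h3 := hy.1 i; have h4 := hy.2 i
  rw [Pi.add_apply] at h2 h4
  rw [Real.norm_eq_abs, abs_le, Pi.sub_apply]
  constructor <;> linarith

lemma pt_mem_cub {m : ℕ} {u v : Lat} (h : ∀ i, u i ≤ v i ∧ v i ≤ u i + 1) :
    pt m v ∈ cub m u := by
  have hm : (0 : ℝ) ≤ (m : ℝ)⁻¹ := by positivity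
  refine ⟨fun i => ?_, fun i => ?_⟩
  · rw [pt_apply, pt_apply]
    have : (u i : ℝ) ≤ v i := by exact_mod_cast (h i).1
    gcongr
  · rw [Pi.add_apply, pt_apply, pt_apply]
    have : (v i : ℝ) ≤ u i + 1 := by exact_mod_cast (h i).2
    calc (m : ℝ)⁻¹ * v i ≤ (m : ℝ)⁻¹ * (u i + 1) := by gcongr
      _ = _ := by ring

lemma Cell.mem_cub {m : ℕ} {u v w x : Lat} (h : Cell u v w x) :
    pt m u ∈ cub m u ∧ pt m v ∈ cub m u ∧ pt m w ∈ cub m u ∧ pt m x ∈ cub m u := by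
  refine ⟨?_, ?_, ?_, ?_⟩ <;> refine pt_mem_cub fun i => ?_ <;> have := h i <;> omega

lemma edg_mem_cub {m : ℕ} {u v w : Lat} (hv : pt m v ∈ cub m u) (hw : pt m w ∈ cub m u) (t) :
    edg m v w t ∈ cub m u :=
  affS_mem (convex_cub m u) (fun i => by fin_cases i <;> assumption) t

lemma tri_mem_cub {m : ℕ} {u v w x : Lat} (hv : pt m v ∈ cub m u) (hw : pt m w ∈ cub m u)
    (hx : pt m x ∈ cub m u) (t) : tri m v w x t ∈ cub m u :=
  affS_mem (convex_cub m u) (fun i => by fin_cases i <;> assumption) t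

lemma tet_mem_cub {m : ℕ} {g u v w x : Lat} (hu : pt m u ∈ cub m g) (hv : pt m v ∈ cub m g)
    (hw : pt m w ∈ cub m g) (hx : pt m x ∈ cub m g) (t) : tet m u v w x t ∈ cub m g :=
  affS_mem (convex_cub m g) (fun i => by fin_cases i <;> assumption) t

section periodic

variable {m : ℕ} [NeZero m]

lemma edg_add_smul (u v n : Lat) (t) :
    edg m (u + (m : ℤ) • n) (v + (m : ℤ) • n) t = edg m u v t + toE n := by
  rw [edg, edg, ← affS_add]
  congr 2
  funext i
  fin_cases i <;> exact pt_add_smul m _ n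

lemma tri_add_smul (u v w n : Lat) (t) :
    tri m (u + (m : ℤ) • n) (v + (m : ℤ) • n) (w + (m : ℤ) • n) t = tri m u v w t + toE n := by
  rw [tri, tri, ← affS_add]
  congr 2
  funext i
  fin_cases i <;> exact pt_add_smul m _ n

end periodic

namespace Tube

variable {Z : Type} [TopologicalSpace Z] (D : Tube Z)

/-- The inclusion of the neighbourhood upstairs. -/
def inN : C(D.Nt, E 3) := ⟨Subtype.val, continuous_subtype_val⟩

lemma isEmbedding_inN : Topology.IsEmbedding D.inN := Topology.IsEmbedding.subtypeVal

/-- A simplex in the neighbourhood. -/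
def liftN {n : ℕ} (σ : Sing n (E 3)) (h : ∀ t, σ t ∈ D.Nt) : Sing n D.Nt :=
  ⟨fun t => ⟨σ t, h t⟩, σ.continuous.subtype_mk _⟩

open Classical in
/-- The retraction on chains, discarding the simplices outside the neighbourhood. -/
noncomputable def rtC {n : ℕ} : Ch n (E 3) →ₗ[ZMod 2] Ch n Z :=
  linC fun σ => if h : ∀ t, σ t ∈ D.Nt then gen (D.rt.comp (D.liftN σ h)) else 0

lemma rtC_gen {n : ℕ} {σ : Sing n (E 3)} (h : ∀ t, σ t ∈ D.Nt) :
    D.rtC (gen σ) = gen (D.rt.comp (D.liftN σ h)) := by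
  rw [rtC, linC_gen, dif_pos h]

lemma rtC_push {n : ℕ} (c : Ch n D.Nt) : D.rtC (push D.inN c) = push D.rt c := by
  refine LinearMap.congr_fun (f := D.rtC ∘ₗ push D.inN) (g := push D.rt)
    (ch_hom_ext fun σ => ?_) c
  rw [LinearMap.comp_apply, push_gen, push_gen, D.rtC_gen (σ := D.inN.comp σ) fun t => (σ t).2]
  rfl

lemma exists_push_inN {n : ℕ} {c : Ch n (E 3)} (h : c ∈ S n D.Nt) : ∃ c', push D.inN c' = c := by
  obtain ⟨c', -, h⟩ := exists_push_eq D.isEmbedding_inN (c := c) (U := Set.univ) (by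
    convert h
    rw [Set.image_univ]
    exact Subtype.range_val)
  exact ⟨c', h⟩

lemma d_rtC {n : ℕ} {c : Ch (n + 1) (E 3)} (h : c ∈ S (n + 1) D.Nt) :
    d (D.rtC c) = D.rtC (d c) := by
  obtain ⟨c, rfl⟩ := D.exists_push_inN h
  rw [rtC_push, d_push, d_push, rtC_push]

lemma rtC_add_toE {n : ℕ} {σ τ : Sing n (E 3)} (k : Lat) (h : ∀ t, σ t = τ t + toE k) :
    D.rtC (gen σ) = D.rtC (gen τ) := by
  have hiff : (∀ t, σ t ∈ D.Nt) ↔ ∀ t, τ t ∈ D.Nt := by simp only [h, D.add_toE_mem_Nt]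
  by_cases hσ : ∀ t, σ t ∈ D.Nt
  · rw [D.rtC_gen hσ, D.rtC_gen (hiff.1 hσ)]
    congr 1
    ext t
    refine D.rt_congr ?_
    change tp (σ t) = tp (τ t)
    rw [h, tp_add_toE]
  · rw [rtC, linC_gen, linC_gen, dif_neg hσ, dif_neg (hiff.not.1 hσ)]

variable {D} (A : D.Side) {m : ℕ} [NeZero m]

/-- The change of side between rescaled lattice points. -/
noncomputable def Side.τ (m : ℕ) (u v : Lat) : ℤ := A.S (pt m v) - A.S (pt m u)

omit [NeZero m] in
lemma Side.τ_add (u v w : Lat) : A.τ m u w = A.τ m u v + A.τ m v w := by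
  simp only [τ]; ring

lemma Side.τ_periodic : Periodic2 m (A.τ m) := fun u v n => by
  simp only [τ, pt_add_smul, A.S_add]; ring

omit [NeZero m] in
/-- A cube across which the side changes is close to the surface. -/
lemma Side.near {δ : ℝ} (hδ : (m : ℝ)⁻¹ < δ) (hm : 2 ≤ m) {g v w : Lat} (hv : pt m v ∈ cub m g)
    (hw : pt m w ∈ cub m g) (h : (A.τ m v w : ZMod 2) ≠ 0) :
    ∃ p ∈ D.Zt, ∀ x ∈ cub m g, ‖x - p‖ < δ := by
  by_contra! hcon
  refine h ?_
  rw [τ, Int.cast_sub, sub_eq_zero]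
  refine (A.S_segment ?_ ?_).symm
  · refine (norm_sub_le_of_mem_cub hw hv).trans ?_
    rw [one_div]
    exact inv_anti₀ (by norm_num) (by exact_mod_cast hm)
  · rw [Set.disjoint_left]
    intro p hp hpZ
    obtain ⟨x, hx, hxp⟩ := hcon p hpZ
    exact absurd (norm_sub_le_of_mem_cub hx ((convex_cub m g).segment_subset hv hw hp))
      (not_le.2 (hδ.trans_le hxp))

omit [NeZero m] in
lemma Side.cub_subset {δ : ℝ} (hF : D.Fine δ) (hδ : (m : ℝ)⁻¹ < δ) (hm : 2 ≤ m) {g v w : Lat}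
    (hv : pt m v ∈ cub m g) (hw : pt m w ∈ cub m g) (h : (A.τ m v w : ZMod 2) ≠ 0) :
    cub m g ⊆ D.Nt := fun x hx => by
  obtain ⟨p, hp, hx'⟩ := A.near hδ hm hv hw h
  exact hF.mem_Nt p hp x (hx' x hx)

/-- The sum of the triangles dual to the edges crossing the surface. -/
noncomputable def Side.eta (m : ℕ) [NeZero m] (s : (Fin 3 → ZMod m) → Lat) : Ch 3 (E 3) :=
  gridSum s fun u v w x => (A.τ m w x : ZMod 2) • gen (tri m u v w)

/-- The simplicial fundamental cycle of the surface. -/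
noncomputable def Side.zeta (m : ℕ) [NeZero m] (s : (Fin 3 → ZMod m) → Lat) : Ch 3 Z :=
  D.rtC (A.eta m s)

lemma Side.zeta_eq (s : (Fin 3 → ZMod m) → Lat) : A.zeta m s =
    gridSum s fun u v w x => (A.τ m w x : ZMod 2) • D.rtC (gen (tri m u v w)) := by
  have := gridSum_map (D.rtC : Ch 3 (E 3) →ₗ[ZMod 2] Ch 3 Z).toAddMonoidHom s
    fun u v w x => (A.τ m w x : ZMod 2) • gen (tri m u v w)
  refine this.trans (congrArg (gridSum s) ?_)
  funext u v w x
  exact map_smul D.rtC _ _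

lemma Side.zeta_sec {s s' : (Fin 3 → ZMod m) → Lat} (hs : IsSec s) (hs' : IsSec s') :
    A.zeta m s = A.zeta m s' := by
  rw [zeta_eq, zeta_eq]
  refine gridSum_sec hs hs' fun u v w x n => ?_
  rw [A.τ_periodic w x n, D.rtC_add_toE n (tri_add_smul u v w n)]

lemma Side.eta_mem {δ : ℝ} (hF : D.Fine δ) (hδ : (m : ℝ)⁻¹ < δ) (hm : 2 ≤ m)
    (s : (Fin 3 → ZMod m) → Lat) : A.eta m s ∈ SurfT3.S 3 D.Nt := by
  refine gridSum_mem (SurfT3.S 3 D.Nt).toAddSubgroup fun k v w x h => ?_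
  obtain ⟨h0, h1, h2, h3⟩ := h.mem_cub (m := m)
  by_cases ht : (A.τ m w x : ZMod 2) = 0
  · rw [ht, zero_smul]
    exact Submodule.zero_mem _
  · exact Submodule.smul_mem _ _ (gen_mem_S fun t =>
      A.cub_subset hF hδ hm h2 h3 ht (tri_mem_cub h0 h1 h2 t))

lemma Side.d_zeta {δ : ℝ} (hF : D.Fine δ) (hδ : (m : ℝ)⁻¹ < δ) (hm : 2 ≤ m)
    {s : (Fin 3 → ZMod m) → Lat} (hs : IsSec s) : d (A.zeta m s) = 0 := by
  rw [zeta, D.d_rtC (A.eta_mem hF hδ hm s), eta]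
  have := gridSum_map ((D.rtC ∘ₗ d : Ch 3 (E 3) →ₗ[ZMod 2] Ch 2 Z)).toAddMonoidHom s
    fun u v w x => (A.τ m w x : ZMod 2) • gen (tri m u v w)
  refine this.trans (Eq.trans ?_ (gridSum_delta hs
    (χ := fun u v w => (A.τ m v w : ZMod 2) • D.rtC (gen (edg m u v))) ?_))
  · refine congrArg (gridSum s) ?_
    funext u v w x
    change D.rtC (d (_ • _)) = _
    rw [map_smul, map_smul, d_tri, map_add, map_add, delta, A.τ_add v w x, Int.cast_add]
    simp only [sub_eq_add_neg, neg_eq_self']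
    generalize (A.τ m w x : ZMod 2) = a
    generalize (A.τ m v w : ZMod 2) = b
    rw [smul_add, smul_add, add_smul]
    refine of_one_smul ?_
    match_scalars <;> clear * - a b <;> revert a b <;> decide
  · intro u v w n
    rw [A.τ_periodic v w n, D.rtC_add_toE n (edg_add_smul u v n)]

lemma Side.zeta_chart {δ : ℝ} (hF : D.Fine δ) (hδ : (m : ℝ)⁻¹ < δ) (hm : 2 ≤ m)
    (s : (Fin 3 → ZMod m) → Lat) (z : Z) :
    ∃ j : C(E 2, Z), Topology.IsOpenEmbedding j ∧ z ∈ Set.range j ∧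
      ∀ σ ∈ (A.zeta m s).support, z ∈ Set.range σ → Set.range σ ⊆ Set.range j := by
  obtain ⟨j, hj, hz, h⟩ := hF.chart z
  refine ⟨j, hj, hz, ?_⟩
  have : A.zeta m s ∈ SP 3 {σ | z ∈ Set.range σ → Set.range σ ⊆ Set.range j} := by
    rw [zeta_eq]
    refine gridSum_mem (SP 3 _).toAddSubgroup fun k v w x hc => ?_
    obtain ⟨h0, h1, h2, h3⟩ := hc.mem_cub (m := m)
    by_cases ht : (A.τ m w x : ZMod 2) = 0
    · rw [ht, zero_smul]
      exact Submodule.zero_mem _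
    · rw [D.rtC_gen fun t => A.cub_subset hF hδ hm h2 h3 ht (tri_mem_cub h0 h1 h2 t)]
      refine Submodule.smul_mem _ _ (gen_mem_SP ?_)
      rintro ⟨t, ht'⟩ _ ⟨t', rfl⟩
      obtain ⟨p, hp, hx'⟩ := A.near hδ hm h2 h3 ht
      refine h _ _ ⟨p, hp, hx' _ (tri_mem_cub h0 h1 h2 t)⟩ ?_ ht'
      exact (norm_sub_le_of_mem_cub (tri_mem_cub h0 h1 h2 t') (tri_mem_cub h0 h1 h2 t)).trans_lt hδ
  exact (Finsupp.mem_supported _ _).1 this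

end Tube

end SurfT3

namespace SurfT3

/-! ### The fundamental cycle in a box -/

lemma val_push_of_injOn {X Y : Type} [TopologicalSpace X] [TopologicalSpace Y] [T1Space X]
    [T1Space Y] {n : ℕ} {f : C(X, Y)} (ho : IsOpenMap f) {O V : Set X} (hO : IsOpen O)
    (hV : IsOpen V) (hi : Set.InjOn f O) {x : X} (hx : x ∈ O) (hVx : ∀ y ∈ V, f y = f x → y = x)
    {c : Ch (n + 1) X} (hc : c ∈ S (n + 1) V) (hr : Rel {x} c) :
    val (f x) (push f c) = val x c := by
  have hcov : V ⊆ (O ∩ V) ∪ ({x}ᶜ ∩ V) := fun y hy => by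
    by_cases h : y = x
    · exact Or.inl ⟨h ▸ hx, hy⟩
    · exact Or.inr ⟨h, hy⟩
  obtain ⟨m, hm⟩ := exists_iter_Sd_split (hO.inter hV) (isOpen_compl_singleton.inter hV)
    (S_mono hcov hc)
  obtain ⟨a, b, hab, ha, hb⟩ := hm m le_rfl
  have hfx : ∀ y ∈ ({x}ᶜ ∩ V : Set X), f y ∈ ({f x}ᶜ : Set Y) := fun y hy h =>
    hy.1 (hVx y hy.2 h)
  have hfr : Rel {f x} (push f c) := by
    change d (push f c) ∈ S n _
    rw [d_push]
    refine push_mem_S hfx ?_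
    exact S_inter hr (d_mem_S hc)
  have key : ∀ {W : Type} [TopologicalSpace W] [T1Space W] {y : W} {c a b : Ch (n + 1) W},
      Rel {y} c → SurfT3.Sd^[m] c = a + b → b ∈ S (n + 1) {y}ᶜ → val y c = val y a := by
    intro W _ _ y c a b hr hab hb
    refine val_congr ((Null.congr ?_ (null_of_mem hb) : Null {y} (c + a)))
    have := hr.null_Sd m
    rw [hab, ← add_assoc] at this
    exact this
  rw [key hfr (a := push f a) (b := push f b) (by rw [← push_iter_Sd, hab, map_add])
      (push_mem_S hfx hb),
    key hr hab (S_mono Set.inter_subset_left hb)]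
  have hj : Topology.IsOpenEmbedding (⟨Subtype.val, continuous_subtype_val⟩ : C(O, X)) :=
    hO.isOpenEmbedding_subtypeVal
  obtain ⟨a, -, rfl⟩ := exists_push_eq hj.isEmbedding (c := a) (U := Set.univ) (by
    refine S_mono (fun y hy => ?_) ha
    exact ⟨⟨y, hy.1⟩, trivial, rfl⟩)
  have h1 := val_push hj ⟨x, hx⟩ a
  have h2 := val_push (j := f.comp ⟨Subtype.val, continuous_subtype_val⟩)
    (isOpenEmbedding_restrict f.continuous ho hO hi) ⟨x, hx⟩ a
  rw [push_push]
  exact h2.trans h1.symm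

end SurfT3

namespace SurfT3

/-! ### The bulk chain -/

lemma gridSum_smul {m : ℕ} [NeZero m] {M : Type} [AddCommGroup M] [Module (ZMod 2) M] (a : ZMod 2)
    (s : (Fin 3 → ZMod m) → Lat) (ψ : Lat → Lat → Lat → Lat → M) :
    a • gridSum s ψ = gridSum s fun u v w x => a • ψ u v w x :=
  gridSum_map (DistribSMul.toAddMonoidHom M a) s ψ

namespace Tube

variable {Z : Type} [TopologicalSpace Z] (D : Tube Z)

/-- The `δ`-neighbourhood of the surface upstairs. -/
def nbd (δ : ℝ) : Set (E 3) := {x | ∃ p ∈ D.Zt, ‖x - p‖ < δ}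

lemma isOpen_nbd (δ : ℝ) : IsOpen (D.nbd δ) := by
  have : D.nbd δ = ⋃ p ∈ D.Zt, Metric.ball p δ := by
    ext x
    simp only [Set.mem_iUnion, mem_ball_iff_norm, exists_prop]
    rfl
  rw [this]
  exact isOpen_biUnion fun _ _ => Metric.isOpen_ball

variable {D} (A : D.Side) {m : ℕ} [NeZero m] {c : Lat}

/-- The simplicial version, in a box, of the side chain. -/
noncomputable def Side.bulk (m : ℕ) [NeZero m] (c : Lat) : Ch 4 (E 3) :=
  gridSum (boxSec m c) fun u v w x => (A.S (pt m x) : ZMod 2) • gen (tet m u v w x)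

lemma Side.d_bulk :
    d (A.bulk m c) + A.eta m (boxSec m c) ∈ SurfT3.S 3 (SurfT3.box m c)ᶜ := by
  have h1 := gridSum_delta_box (c := c) (m := m) (SurfT3.S 3 (SurfT3.box m c)ᶜ).toAddSubgroup
    (χ := fun u v w => (A.S (pt m w) : ZMod 2) • gen (tri m u v w)) fun g a b b' r hb hb' hr hg =>
      Submodule.smul_mem _ _ (S_mono (boxFace_subset hr) (gen_tri_mem hb hb' hg))
  refine (congrArg (· ∈ SurfT3.S 3 (SurfT3.box m c)ᶜ) ?_).mpr h1
  have := gridSum_map (d : Ch 4 (E 3) →ₗ[ZMod 2] Ch 3 (E 3)).toAddMonoidHom (boxSec m c)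
    fun u v w x => (A.S (pt m x) : ZMod 2) • gen (tet m u v w x)
  have h2 : d (A.bulk m c) = _ := this
  rw [h2, eta]
  refine (gridSum_add (m := m) (boxSec m c) _ _).symm.trans ?_
  refine congrArg (gridSum _) ?_
  funext u v w x
  change d (_ • _) + _ = _
  rw [map_smul, d_tet, delta, delta, τ, Int.cast_sub]
  simp only [sub_eq_add_neg, neg_eq_self']
  generalize (A.S (pt m x) : ZMod 2) = a
  generalize (A.S (pt m w) : ZMod 2) = b
  refine of_one_smul ?_
  match_scalars <;> clear * - a b <;> revert a b <;> decide

lemma Side.null_bulk {δ : ℝ} (hδ : (m : ℝ)⁻¹ < δ) (hm : 2 ≤ m) {a : E 3} (ha : a ∉ D.nbd δ) :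
    SurfT3.Null {a} (A.bulk m c + (A.S a : ZMod 2) • boxChain m c) := by
  refine null_of_mem ?_
  rw [boxChain, gridSum_smul, bulk, ← gridSum_add (m := m)]
  refine gridSum_mem (SurfT3.S 4 _).toAddSubgroup fun k v w x h => ?_
  obtain ⟨h0, h1, h2, h3⟩ := h.mem_cub (m := m)
  change (_ • gen (tet m (boxSec m c k) v w x) + _ • gen (tet m (boxSec m c k) v w x) :
    Ch 4 (E 3)) ∈ SurfT3.S 4 _
  by_cases hac : a ∈ cub m (boxSec m c k)
  · rw [A.S_segment (v := pt m x) (w := a), add_self_eq]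
    · exact Submodule.zero_mem _
    · refine (norm_sub_le_of_mem_cub hac h3).trans ?_
      rw [one_div]
      exact inv_anti₀ (by norm_num) (by exact_mod_cast hm)
    · rw [Set.disjoint_left]
      exact fun p hp hpZ => ha ⟨p, hpZ, (norm_sub_le_of_mem_cub hac
        ((convex_cub m _).segment_subset h3 hac hp)).trans_lt hδ⟩
  · have hg : gen (tet m (boxSec m c k) v w x) ∈ SurfT3.S 4 ({a}ᶜ : Set (E 3)) :=
      gen_mem_S fun t ht => hac (ht ▸ tet_mem_cub h0 h1 h2 h3 t)
    exact Submodule.add_mem _ (Submodule.smul_mem _ _ hg) (Submodule.smul_mem _ _ hg)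

lemma Side.null_e_add_bulk {δ : ℝ} (h0 : 0 < δ) (hδ : (m : ℝ)⁻¹ < δ) (hm : 2 ≤ m) {a : E 3}
    (ha : a ∉ D.nbd δ) (hb : a ∈ SurfT3.box m c) (hb' : ∀ i, -1 ≤ a i ∧ a i < 2) :
    SurfT3.Null {a} (A.e + A.bulk m c) := by
  have haZ : a ∉ D.Zt := fun h => ha ⟨a, h, by rwa [sub_self, norm_zero]⟩
  have hS := A.S_eq a haZ hb'
  have h1 := A.null_bulk (c := c) hδ hm ha
  have hrel : SurfT3.Rel {a} A.e := by
    refine D.rel_filling A.mem_e ?_ (Set.disjoint_singleton_left.2 haZ)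
    rw [Set.singleton_subset_iff, mem_closedBall_zero_iff]
    refine (pi_norm_le_iff_of_nonneg (by norm_num)).2 fun i => ?_
    have := hb' i
    rw [Real.norm_eq_abs, abs_le]
    constructor <;> linarith
  have h01 : ∀ x : ZMod 2, x = 0 ∨ x = 1 := by decide
  rcases h01 (A.S a) with h | h
  · rw [h, zero_smul, add_zero] at h1
    rw [h, eq_comm, val_eq_zero] at hS
    exact hS.add h1
  · rw [h, one_smul] at h1
    rw [h, eq_comm, val_eq_one_iff] at hS
    have h2 := val_eq_one_iff.1 (val_boxChain hb)
    have h3 := uniqPt_E 3 a _ _ hrel (rel_boxChain.mono (Set.singleton_subset_iff.2 hb)) hS h2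
    have h4 := h3.add h1
    rwa [show A.e + boxChain m c + (A.bulk m c + boxChain m c) = A.e + A.bulk m c by
      refine of_one_smul ?_
      match_scalars <;> decide] at h4

end Tube

end SurfT3

namespace SurfT3

/-! ### Pushing chains to the surface -/

namespace Tube

variable {Z : Type} [TopologicalSpace Z] {D : Tube Z} (A : D.Side) {m : ℕ} [NeZero m] {c : Lat}

lemma Side.eta_mem_nbd {δ : ℝ} (hδ : (m : ℝ)⁻¹ < δ) (hm : 2 ≤ m)
    (s : (Fin 3 → ZMod m) → Lat) : A.eta m s ∈ SurfT3.S 3 (D.nbd δ) := by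
  refine gridSum_mem (SurfT3.S 3 (D.nbd δ)).toAddSubgroup fun k v w x h => ?_
  obtain ⟨h0, h1, h2, h3⟩ := h.mem_cub (m := m)
  by_cases ht : (A.τ m w x : ZMod 2) = 0
  · rw [ht, zero_smul]
    exact Submodule.zero_mem _
  · obtain ⟨p, hp, hp'⟩ := A.near hδ hm h2 h3 ht
    exact Submodule.smul_mem _ _ (gen_mem_S fun t => ⟨p, hp, hp' _ (tri_mem_cub h0 h1 h2 t)⟩)

lemma Side.exists_correction {δ : ℝ} (hF : D.Fine δ) (hδ : (m : ℝ)⁻¹ < δ) (hm : 2 ≤ m)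
    {B : Set (E 3)} (hB : IsCompact B) (hBbox : B ⊆ SurfT3.box m c)
    (hB' : ∀ a ∈ B, ∀ i, -1 ≤ a i ∧ a i < 2) :
    ∃ M, ∃ y ∈ SurfT3.S 4 (D.nbd δ),
      SurfT3.Sd^[M] (SurfT3.push D.inc A.μ + A.eta m (boxSec m c)) + d y ∈ SurfT3.S 3 Bᶜ := by
  have hB5 : B ⊆ Metric.closedBall 0 5 := fun a ha => by
    rw [mem_closedBall_zero_iff]
    refine (pi_norm_le_iff_of_nonneg (by norm_num)).2 fun i => ?_
    have := hB' a ha i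
    rw [Real.norm_eq_abs, abs_le]
    constructor <;> linarith
  have hK : IsCompact (B \ D.nbd δ) := hB.diff (D.isOpen_nbd δ)
  have hbulk := A.d_bulk (m := m) (c := c)
  have heta := A.eta_mem_nbd hδ hm (boxSec m c)
  have hrel : SurfT3.Rel (B \ D.nbd δ) (A.e + A.bulk m c) := by
    have h1 : SurfT3.Rel (B \ D.nbd δ) A.e :=
      D.rel_filling A.mem_e (Set.sdiff_subset.trans hB5) (Set.disjoint_left.2 fun a ha h =>
        ha.2 ⟨a, h, by rw [sub_self, norm_zero]; exact hF.pos⟩)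
    refine h1.add ?_
    have h2 : d (A.bulk m c) + A.eta m (boxSec m c) ∈ SurfT3.S 3 (B \ D.nbd δ)ᶜ :=
      S_mono (Set.compl_subset_compl.2 (Set.sdiff_subset.trans hBbox)) hbulk
    exact (Submodule.add_mem_iff_left _ (S_mono (fun a ha h => h.2 ha) heta)).1 h2
  obtain ⟨f, hf⟩ := (loc_compact_E hK).uniq _ hrel fun a ha =>
    A.null_e_add_bulk hF.pos hδ hm ha.2 (hBbox ha.1) (hB' a ha.1)
  obtain ⟨M, hM⟩ := exists_iter_Sd_split (D.isOpen_nbd δ) hB.isClosed.isOpen_compl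
    (S_mono (fun a ha => by
      by_cases h : a ∈ B
      · exact Or.inl (by_contra fun h' => ha ⟨h, h'⟩)
      · exact Or.inr h) hf)
  obtain ⟨y₁, y₂, h12, h1, h2⟩ := hM M le_rfl
  refine ⟨M, y₁, h1, ?_⟩
  have hd : d y₁ = SurfT3.Sd^[M] (d A.e + d (A.bulk m c)) + d y₂ := by
    have h3 := congrArg d h12
    rw [d_iter_Sd, map_add, map_add, d_d, add_zero, map_add] at h3
    rw [h3, add_assoc, add_self_eq, add_zero]
  rw [hd, ← add_assoc, ← iter_Sd_add]
  refine Submodule.add_mem _ (iter_Sd_mem_S M ?_) (d_mem_S h2)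
  have h4 := Submodule.add_mem _ (S_mono (Set.compl_subset_compl.2 hB5) A.mem_e)
    (S_mono (Set.compl_subset_compl.2 hBbox) hbulk)
  convert h4 using 1
  refine of_one_smul ?_
  match_scalars <;> decide

variable (D) in
/-- The inclusion of the surface in its neighbourhood, upstairs. -/
def incN : C(D.Zt, D.Nt) := ⟨fun v => ⟨v, D.Zt_subset v.2⟩, continuous_subtype_val.subtype_mk _⟩

lemma Side.exists_val_eq_one {δ : ℝ} (hF : D.Fine δ) (hδ : (m : ℝ)⁻¹ < δ) (hm : 2 ≤ m)
    {z : D.Zt} (hbox : Metric.closedBall (z : E 3) (1 / 8) ⊆ SurfT3.box m c)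
    (hz : ∀ i, 0 ≤ (z : E 3) i ∧ (z : E 3) i < 1) {η : Ch 3 D.Nt}
    (hη : SurfT3.push D.inN η = A.eta m (boxSec m c)) :
    SurfT3.Rel {z} (SurfT3.push D.Rt η) ∧ val z (SurfT3.push D.Rt η) = 1 := by
  have hfar : ∀ x : D.Nt, D.Rt x = z → (x : E 3) ∈ Metric.closedBall (z : E 3) (1 / 8) := by
    rintro x rfl
    rw [mem_closedBall_iff_norm']
    exact (D.norm_Rt_sub x).le
  have hz5 : z ∈ D.ZB 5 := by
    change (z : E 3) ∈ Metric.closedBall 0 5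
    rw [mem_closedBall_zero_iff]
    refine (pi_norm_le_iff_of_nonneg (by norm_num)).2 fun i => ?_
    have := hz i
    rw [Real.norm_eq_abs, abs_le]
    constructor <;> linarith
  have hrμ : SurfT3.Rel {z} A.μ := A.rel_μ.mono (Set.singleton_subset_iff.2 hz5)
  have hr : SurfT3.Rel {z} (SurfT3.push D.Rt η) := by
    have h1 : SurfT3.push D.inN (d η) ∈ SurfT3.S 2 (SurfT3.box m c)ᶜ := by
      have := d_mem_S (A.d_bulk (m := m) (c := c))
      rw [map_add, d_d, zero_add, ← hη, d_push] at this
      exact this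
    change d (SurfT3.push D.Rt η) ∈ SurfT3.S 2 _
    rw [d_push]
    refine push_mem_S (fun x hx h => ?_) (mem_S_of_push D.isEmbedding_inN.injective h1)
    exact hx (hbox (hfar x h))
  refine ⟨hr, ?_⟩
  obtain ⟨M, y, hy, hM⟩ := A.exists_correction (c := c) hF hδ hm (isCompact_closedBall _ _) hbox
    fun a ha i => by
      have h1 := (norm_le_pi_norm (a - (z : E 3)) i).trans (mem_closedBall_iff_norm.1 ha)
      rw [Real.norm_eq_abs, abs_le, Pi.sub_apply] at h1
      have := hz i
      constructor <;> linarith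
  have hnbd : D.nbd δ ⊆ D.Nt := fun x hx => by
    obtain ⟨p, hp, h⟩ := hx
    exact hF.mem_Nt p hp x h
  obtain ⟨y, rfl⟩ := D.exists_push_inN (S_mono hnbd hy)
  have hinc : SurfT3.push D.inc A.μ = SurfT3.push D.inN (SurfT3.push D.incN A.μ) := by
    rw [push_push]; rfl
  rw [hinc, ← hη, ← map_add, ← push_iter_Sd, d_push, ← map_add] at hM
  have h1 : SurfT3.push D.Rt (SurfT3.Sd^[M] (SurfT3.push D.incN A.μ + η) + d y) ∈
      SurfT3.S 3 ({z}ᶜ : Set D.Zt) := by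
    refine push_mem_S (fun x hx h => ?_) (mem_S_of_push D.isEmbedding_inN.injective hM)
    exact hx (hfar x h)
  have hid : D.Rt.comp D.incN = ContinuousMap.id _ := by
    ext v : 1
    exact D.Rt_of_mem v.2
  rw [map_add, push_iter_Sd, map_add, push_push, hid, push_id, ← d_push] at h1
  have h2 : SurfT3.Null {z} (A.μ + SurfT3.push D.Rt η) :=
    ((hrμ.add hr).null_Sd M).congr ⟨_, h1⟩
  rw [← val_congr h2]
  exact A.val_μ z hz5

end Tube

end SurfT3

namespace SurfT3

/-! ### The local degree of the fundamental cycle -/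

namespace Tube

variable {Z : Type} [TopologicalSpace Z] {D : Tube Z} (A : D.Side) {m : ℕ} [NeZero m] {c : Lat}

variable (D) in
lemma exists_pz_eq (z : Z) : ∃ v : D.Zt, D.pz v = z ∧ ∀ i, 0 ≤ (v : E 3) i ∧ (v : E 3) i < 1 := by
  obtain ⟨v, rfl⟩ := D.pz_surjective z
  refine ⟨D.trZ (-flr v) v, ?_, fun i => ?_⟩
  · refine D.ι_injective ?_
    rw [ι_pz, ι_pz]
    exact tp_add_toE _ _
  · change 0 ≤ ((v : E 3) + toE (-flr v)) i ∧ ((v : E 3) + toE (-flr v)) i < 1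
    have h1 := Int.floor_le ((v : E 3) i)
    have h2 := Int.lt_floor_add_one ((v : E 3) i)
    simp only [toE, flr, Pi.add_apply, Pi.neg_apply, Int.cast_neg]
    constructor <;> linarith

/-- A box approximately centred at a point. -/
lemma exists_centre (m : ℕ) [NeZero m] (z : E 3) : ∃ c : Lat, ∀ i,
    z i - 1 / 2 - (m : ℝ)⁻¹ < pt m c i ∧ pt m c i ≤ z i - 1 / 2 := by
  have hm : (0 : ℝ) < m := by exact_mod_cast NeZero.pos m
  refine ⟨fun i => ⌊(m : ℝ) * (z i - 1 / 2)⌋, fun i => ?_⟩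
  have h1 := Int.floor_le ((m : ℝ) * (z i - 1 / 2))
  have h2 := Int.lt_floor_add_one ((m : ℝ) * (z i - 1 / 2))
  rw [pt_apply]
  constructor
  · rw [← div_eq_inv_mul, lt_div_iff₀ hm, sub_mul, inv_mul_cancel₀ hm.ne']
    linarith
  · rw [← div_eq_inv_mul, div_le_iff₀ hm]
    linarith

lemma cub_boxSec_subset {k : Fin 3 → ZMod m} {x : E 3} (hx : x ∈ cub m (boxSec m c k)) (i : Fin 3) :
    pt m c i ≤ x i ∧ x i ≤ pt m c i + 1 := by
  have hm : (0 : ℝ) < m := by exact_mod_cast NeZero.pos m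
  have hm' : (m : ℝ)⁻¹ * m = 1 := inv_mul_cancel₀ hm.ne'
  have hb := boxSec_bounds (m := m) (c := c) k i
  have h1 : (c i : ℝ) ≤ boxSec m c k i := by exact_mod_cast hb.1
  have h2 : (boxSec m c k i : ℝ) + 1 ≤ c i + m := by exact_mod_cast hb.2
  have h3 := hx.1 i
  have h4 := hx.2 i
  rw [Pi.add_apply] at h4
  rw [pt_apply] at h3 h4 ⊢
  have h5 := mul_le_mul_of_nonneg_left h1 (inv_pos.2 hm).le
  have h6 := mul_le_mul_of_nonneg_left h2 (inv_pos.2 hm).le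
  rw [mul_add, mul_add, hm'] at h6
  constructor <;> linarith

lemma Side.val_zeta [T2Space Z] {δ : ℝ} (hF : D.Fine δ) (hδ : (m : ℝ)⁻¹ < δ)
    (hm : 9 ≤ m) {s : (Fin 3 → ZMod m) → Lat} (hs : IsSec s) (z : Z) : val z (A.zeta m s) = 1 := by
  have hm8 : (m : ℝ)⁻¹ < 1 / 8 := by
    rw [one_div]
    exact inv_strictAnti₀ (by norm_num) (by exact_mod_cast (by omega : 8 < m))
  obtain ⟨v, rfl, hv⟩ := D.exists_pz_eq z
  obtain ⟨c, hc⟩ := exists_centre m v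
  obtain ⟨η, hη⟩ := D.exists_push_inN (A.eta_mem hF hδ (by omega) (boxSec m c))
  obtain ⟨hr, h1⟩ := A.exists_val_eq_one hF hδ (by omega) (fun x hx i => by
    have h1 := (norm_le_pi_norm (x - (v : E 3)) i).trans (mem_closedBall_iff_norm.1 hx)
    rw [Real.norm_eq_abs, abs_le, Pi.sub_apply] at h1
    have := hc i
    constructor <;> linarith) hv hη
  have hnear : A.eta m (boxSec m c) ∈ SurfT3.S 3 (Metric.closedBall (v : E 3) (5 / 8)) := by
    refine gridSum_mem (SurfT3.S 3 (Metric.closedBall (v : E 3) (5 / 8))).toAddSubgroup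
      fun k u w x h => Submodule.smul_mem _ _ (gen_mem_S fun t => ?_)
    obtain ⟨h0, h1, h2, -⟩ := h.mem_cub (m := m)
    rw [mem_closedBall_iff_norm]
    refine (pi_norm_le_iff_of_nonneg (by norm_num)).2 fun i => ?_
    have h3 := cub_boxSec_subset (tri_mem_cub h0 h1 h2 t) i
    have := hc i
    rw [Real.norm_eq_abs, abs_le, Pi.sub_apply]
    constructor <;> linarith
  have hρ : SurfT3.push D.Rt η ∈ SurfT3.S 3 {x : D.Zt | (x : E 3) ∈ Metric.ball (v : E 3) 1} := by
    rw [← hη] at hnear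
    refine push_mem_S (fun x hx => ?_) (mem_S_of_push D.isEmbedding_inN.injective hnear)
    change (D.Rt x : E 3) ∈ Metric.ball (v : E 3) 1
    rw [mem_ball_iff_norm]
    have h2 : ‖(x : E 3) - v‖ ≤ 5 / 8 := mem_closedBall_iff_norm.1 hx
    calc ‖(D.Rt x : E 3) - v‖ = ‖((D.Rt x : E 3) - x) + (x - v)‖ := by rw [sub_add_sub_cancel]
      _ ≤ _ := norm_add_le _ _
      _ < 1 := by linarith [D.norm_Rt_sub x]
  have h2 := val_push_of_injOn D.isOpenMap_pz
    (Metric.isOpen_ball.preimage continuous_subtype_val) (x := v)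
    (Metric.isOpen_ball.preimage continuous_subtype_val) (D.pz_injOn v)
    (Metric.mem_ball_self (by norm_num)) (fun y hy h => D.eq_of_pz_eq h (mem_ball_iff_norm.1 hy))
    hρ hr
  rw [h1, push_push] at h2
  rw [A.zeta_sec hs isSec_boxSec, zeta, ← hη, rtC_push]
  have h3 : D.pz.comp D.Rt = D.rt := ContinuousMap.ext D.pz_Rt
  rw [← h3]
  exact h2

end Tube

end SurfT3

namespace SurfT3

/-! ### The characteristic cocycle of the surface -/

instance (n : ℕ) : PreconnectedSpace (Simp (n + 1)) :=
  Subtype.preconnectedSpace (convex_stdSimplex ℝ _).isPreconnected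

lemma exists_circle_lift {n : ℕ} (h : C(Simp (n + 1), UnitAddCircle)) :
    ∃ l : C(Simp (n + 1), ℝ), ∀ t, (l t : UnitAddCircle) = h t := by
  have cov := AddCircle.isCoveringMap_coe (1 : ℝ)
  obtain ⟨e, he⟩ := QuotientAddGroup.mk_surjective (h (simpContr n).pt)
  let H : C(unitInterval × Simp (n + 1), UnitAddCircle) :=
    h.comp ((simpContr n).H.comp
      ⟨fun p => (p.2, unitInterval.symm p.1), by fun_prop⟩)
  have hH : ∀ a, H (0, a) = ((ContinuousMap.const _ e : C(Simp (n + 1), ℝ)) a : UnitAddCircle) := by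
    intro a
    change h ((simpContr n).H (a, unitInterval.symm 0)) = _
    rw [unitInterval.symm_zero, Contr.H_one]
    exact he.symm
  refine ⟨(cov.liftHomotopy H (ContinuousMap.const _ e) hH).comp
    ⟨fun t => (1, t), by fun_prop⟩, fun t => ?_⟩
  refine (congrFun (cov.liftHomotopy_lifts H _ hH) (1, t)).trans ?_
  change h ((simpContr n).H (t, unitInterval.symm 1)) = _
  rw [unitInterval.symm_one, Contr.H_zero]

/-- Simplices of the torus lift to Euclidean space. -/
lemma exists_tp_lift {n : ℕ} (σ : Sing (n + 1) Tor) :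
    ∃ l : Sing (n + 1) (E 3), ∀ t, tp (l t) = σ t := by
  choose l hl using fun i : Fin 3 => exists_circle_lift
    (⟨fun t => σ t i, (continuous_apply i).comp σ.continuous⟩ : C(Simp (n + 1), UnitAddCircle))
  exact ⟨⟨fun t i => l i t, continuous_pi fun i => (l i).continuous⟩,
    fun t => funext fun i => hl i t⟩

lemma exists_eq_add_toE {n : ℕ} {l l' : Sing (n + 1) (E 3)} (h : ∀ t, tp (l t) = tp (l' t)) :
    ∃ k : Lat, ∀ t, l t = l' t + toE k := by
  obtain ⟨k, hk⟩ := tp_eq_iff.1 (h (stdSimplex.vertex 0))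
  refine ⟨k, fun t => funext fun i => ?_⟩
  have cov := AddCircle.isCoveringMap_coe (1 : ℝ)
  refine congrFun (cov.eq_of_comp_eq (g₁ := fun t => l t i) (g₂ := fun t => (l' t + toE k) i)
    ((continuous_apply i).comp l.continuous) ?_ ?_ (stdSimplex.vertex 0) (congrFun hk i)) t
  · exact (continuous_apply i).comp (l'.continuous.add continuous_const)
  · funext t
    have := congrFun ((h t).trans (tp_add_toE (l' t) k).symm) i
    exact this

namespace Tube

variable {Z : Type} [TopologicalSpace Z] {D : Tube Z} (A : D.Side)

/-- The change of parity of the side along the lift of a path. -/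
noncomputable def Side.cocycle : Ch 2 Z →ₗ[ZMod 2] ZMod 2 :=
  linC fun σ => (A.S (vtx (exists_tp_lift (D.ι.comp σ)).choose 0) : ZMod 2) +
    A.S (vtx (exists_tp_lift (D.ι.comp σ)).choose 1)

lemma Side.cocycle_gen {σ : Sing 2 Z} {l : Sing 2 (E 3)} (h : ∀ t, tp (l t) = D.ι (σ t)) :
    A.cocycle (gen σ) = A.S (vtx l 0) + A.S (vtx l 1) := by
  rw [cocycle, linC_gen]
  have h' := (exists_tp_lift (D.ι.comp σ)).choose_spec
  set l' := (exists_tp_lift (D.ι.comp σ)).choose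
  obtain ⟨k, hk⟩ := exists_eq_add_toE (l := l) (l' := l') fun t => (h t).trans (h' t).symm
  rw [vtx, vtx, vtx, vtx, hk, hk, A.S_add, A.S_add, Int.cast_add, Int.cast_add]
  generalize (A.δ k : ZMod 2) = a, (A.S (l' (stdSimplex.vertex 0)) : ZMod 2) = b,
    (A.S (l' (stdSimplex.vertex 1)) : ZMod 2) = c
  clear * - a b c
  revert a b c
  decide

lemma Side.isCoc_cocycle : IsCoc A.cocycle := by
  intro c
  refine LinearMap.congr_fun (f := A.cocycle ∘ₗ d) (g := 0) (ch_hom_ext fun σ => ?_) c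
  obtain ⟨l, hl⟩ := exists_tp_lift (D.ι.comp σ)
  rw [LinearMap.comp_apply, d_gen, Fin.sum_univ_three, map_add, map_add,
    A.cocycle_gen (l := l.comp (face 0)) fun t => hl _,
    A.cocycle_gen (l := l.comp (face 1)) fun t => hl _,
    A.cocycle_gen (l := l.comp (face 2)) fun t => hl _, LinearMap.zero_apply]
  simp only [vtx_face]
  have h0 : (0 : Fin 3).succAbove (0 : Fin 2) = 1 := rfl
  have h1 : (0 : Fin 3).succAbove (1 : Fin 2) = 2 := rfl
  have h2 : (1 : Fin 3).succAbove (0 : Fin 2) = 0 := rfl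
  have h3 : (1 : Fin 3).succAbove (1 : Fin 2) = 2 := rfl
  have h4 : (2 : Fin 3).succAbove (0 : Fin 2) = 0 := rfl
  have h5 : (2 : Fin 3).succAbove (1 : Fin 2) = 1 := rfl
  rw [h0, h1, h2, h3, h4, h5]
  generalize (A.S (vtx l 0) : ZMod 2) = a, (A.S (vtx l 1) : ZMod 2) = b,
    (A.S (vtx l 2) : ZMod 2) = c
  clear * - a b c
  revert a b c
  decide

variable {m : ℕ}

open Classical in
/-- The change of side under the retraction. -/
noncomputable def Side.shift (m : ℕ) (u : Lat) : ZMod 2 :=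
  if h : pt m u ∈ D.Nt then A.S (pt m u) + A.S (D.Rt ⟨pt m u, h⟩) else 0

lemma Side.shift_add_smul [NeZero m] (u n : Lat) : A.shift m (u + (m : ℤ) • n) = A.shift m u := by
  by_cases h : pt m u ∈ D.Nt
  · have h' : pt m u + toE n ∈ D.Nt := (D.add_toE_mem_Nt n).2 h
    rw [shift, shift, dif_pos h]
    simp only [pt_add_smul]
    rw [dif_pos (pt_add_smul m u n ▸ h'), D.Rt_add_toE h, A.S_add, A.S_add,
      Int.cast_add, Int.cast_add]
    generalize (A.δ n : ZMod 2) = a, (A.S (pt m u) : ZMod 2) = b,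
      (A.S (D.Rt ⟨pt m u, h⟩) : ZMod 2) = c
    clear * - a b c
    revert a b c
    decide
  · have h' : pt m u + toE n ∉ D.Nt := (D.add_toE_mem_Nt n).not.2 h
    rw [shift, shift, dif_neg h]
    simp only [pt_add_smul]
    rw [dif_neg (pt_add_smul m u n ▸ h')]

lemma Side.cocycle_edg {u v : Lat} (h : ∀ t, edg m u v t ∈ D.Nt) :
    A.cocycle (D.rtC (gen (edg m u v))) = A.τ m u v + A.shift m u + A.shift m v := by
  have hu : edg m u v (stdSimplex.vertex 0) = pt m u := affS_vertex _ _
  have hv : edg m u v (stdSimplex.vertex 1) = pt m v := affS_vertex _ _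
  have hu' : pt m u ∈ D.Nt := hu ▸ h _
  have hv' : pt m v ∈ D.Nt := hv ▸ h _
  rw [D.rtC_gen h, A.cocycle_gen (l := D.inc.comp (D.Rt.comp (D.liftN _ h))) fun t => by
    change tp (D.Rt (D.liftN _ h t) : E 3) = D.ι (D.rt (D.liftN _ h t))
    rw [← D.pz_Rt, ι_pz], shift, shift, dif_pos hu', dif_pos hv', τ, Int.cast_sub]
  have h0 : vtx (D.inc.comp (D.Rt.comp (D.liftN _ h))) 0 = D.Rt ⟨pt m u, hu'⟩ :=
    congrArg (fun x => (D.Rt x : E 3)) (Subtype.ext hu)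
  have h1 : vtx (D.inc.comp (D.Rt.comp (D.liftN _ h))) 1 = D.Rt ⟨pt m v, hv'⟩ :=
    congrArg (fun x => (D.Rt x : E 3)) (Subtype.ext hv)
  rw [h0, h1]
  generalize (A.S (pt m u) : ZMod 2) = a, (A.S (pt m v) : ZMod 2) = b,
    (A.S (D.Rt ⟨pt m u, hu'⟩) : ZMod 2) = c, (A.S (D.Rt ⟨pt m v, hv'⟩) : ZMod 2) = e
  clear * - a b c e
  revert a b c e
  decide

end Tube

end SurfT3

namespace SurfT3

/-! ### Parity of the first Betti number of a surface in the torus -/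

namespace Tube

variable {Z : Type} [TopologicalSpace Z] {D : Tube Z} (A : D.Side) {m : ℕ} [NeZero m]
  {s : (Fin 3 → ZMod m) → Lat} {δ : ℝ}

lemma Side.capPair_zeta (hF : D.Fine δ) (hδ : (m : ℝ)⁻¹ < δ) (hm : 2 ≤ m)
    (x y : Ch 2 Z →ₗ[ZMod 2] ZMod 2) : capPair (A.zeta m s) x y = gridSum s fun u v w z =>
      x (D.rtC (gen (edg m u v))) * y (D.rtC (gen (edg m v w))) * (A.τ m w z : ZMod 2) := by
  rw [capPair_apply, zeta_eq]
  have := gridSum_map (y ∘ₗ cap x : Ch 3 Z →ₗ[ZMod 2] ZMod 2).toAddMonoidHom s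
    fun u v w z => (A.τ m w z : ZMod 2) • D.rtC (gen (tri m u v w))
  refine this.trans (gridSum_congr fun u v w z h => ?_)
  obtain ⟨h0, h1, h2, h3⟩ := h.mem_cub (m := m)
  change y (cap x (_ • _)) = _
  rw [map_smul, map_smul]
  by_cases ht : (A.τ m w z : ZMod 2) = 0
  · rw [ht, zero_smul, mul_zero]
  · have hsub := A.cub_subset hF hδ hm h2 h3 ht
    obtain ⟨f0, -, f2⟩ := tri_face m u v w
    rw [D.rtC_gen fun t => hsub (tri_mem_cub h0 h1 h2 t),
      D.rtC_gen fun t => hsub (edg_mem_cub h0 h1 t),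
      D.rtC_gen fun t => hsub (edg_mem_cub h1 h2 t), cap, linC_gen, map_smul, smul_eq_mul,
      smul_eq_mul, mul_comm]
    congr 3
    · exact congrArg gen (ContinuousMap.ext fun t =>
        congrArg D.rt (Subtype.ext (DFunLike.congr_fun f2 t)))
    · exact congrArg gen (ContinuousMap.ext fun t =>
        congrArg D.rt (Subtype.ext (DFunLike.congr_fun f0 t)))

omit [NeZero m] in
lemma Side.coc_edg (hF : D.Fine δ) (hδ : (m : ℝ)⁻¹ < δ) (hm : 2 ≤ m)
    {x : Ch 2 Z →ₗ[ZMod 2] ZMod 2} (hx : IsCoc x) (u v w z : Lat) (h : Cell u v w z)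
    (ht : (A.τ m w z : ZMod 2) ≠ 0) : x (D.rtC (gen (edg m u w))) =
      x (D.rtC (gen (edg m u v))) + x (D.rtC (gen (edg m v w))) := by
  obtain ⟨h0, h1, h2, h3⟩ := h.mem_cub (m := m)
  have hsub := A.cub_subset hF hδ hm h2 h3 ht
  have h4 := hx (D.rtC (gen (tri m u v w)))
  rw [D.d_rtC (gen_mem_S fun t => hsub (tri_mem_cub h0 h1 h2 t)), d_tri, map_add, map_add, map_add,
    map_add] at h4
  generalize x (D.rtC (gen (edg m u w))) = a, x (D.rtC (gen (edg m u v))) = b,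
    x (D.rtC (gen (edg m v w))) = c at h4 ⊢
  clear * - h4
  revert a b c
  decide

lemma Side.periodic_edg (x : Ch 2 Z →ₗ[ZMod 2] ZMod 2) :
    Periodic2 m fun u v => x (D.rtC (gen (edg m u v))) := fun u v n =>
  congrArg x (D.rtC_add_toE n (edg_add_smul u v n))

lemma Side.capPair_zeta_self (hF : D.Fine δ) (hδ : (m : ℝ)⁻¹ < δ) (hm : 2 ≤ m) (hs : IsSec s)
    {x : Ch 2 Z →ₗ[ZMod 2] ZMod 2} (hx : IsCoc x) : capPair (A.zeta m s) x x =
      gridSum s fun u v w z =>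
        x (D.rtC (gen (edg m u v))) * (A.τ m v w : ZMod 2) * (A.τ m w z : ZMod 2) := by
  rw [A.capPair_zeta hF hδ hm]
  exact gridSum_square hs (periodic_edg x) A.τ_periodic A.τ_add (A.coc_edg hF hδ hm hx)

lemma Side.capPair_zeta_cocycle (hF : D.Fine δ) (hδ : (m : ℝ)⁻¹ < δ) (hm : 2 ≤ m) (hs : IsSec s)
    {x : Ch 2 Z →ₗ[ZMod 2] ZMod 2} (hx : IsCoc x) :
    capPair (A.zeta m s) x x = capPair (A.zeta m s) x A.cocycle := by
  rw [A.capPair_zeta_self hF hδ hm hs hx, A.capPair_zeta hF hδ hm,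
    ← gridSum_twist hs (periodic_edg x) A.τ_periodic A.shift_add_smul A.τ_add
      (A.coc_edg hF hδ hm hx)]
  refine gridSum_congr fun u v w z h => ?_
  obtain ⟨h0, h1, h2, h3⟩ := h.mem_cub (m := m)
  by_cases ht : (A.τ m w z : ZMod 2) = 0
  · rw [ht, mul_zero, mul_zero]
  · rw [A.cocycle_edg fun t => A.cub_subset hF hδ hm h2 h3 ht (edg_mem_cub h1 h2 t)]

lemma Side.capPair_cocycle_self (hF : D.Fine δ) (hδ : (m : ℝ)⁻¹ < δ) (hm : 2 ≤ m) (hs : IsSec s) :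
    capPair (A.zeta m s) A.cocycle A.cocycle = 0 := by
  rw [A.capPair_zeta_self hF hδ hm hs A.isCoc_cocycle,
    ← gridSum_cube hs A.τ_periodic A.τ_add A.shift_add_smul]
  refine gridSum_congr fun u v w z h => ?_
  obtain ⟨h0, h1, h2, h3⟩ := h.mem_cub (m := m)
  by_cases ht : (A.τ m w z : ZMod 2) = 0
  · rw [ht, mul_zero, mul_zero]
  · rw [A.cocycle_edg fun t => A.cub_subset hF hδ hm h2 h3 ht (edg_mem_cub h0 h1 t)]

end Tube

/-- A closed surface embedded in the three-dimensional torus has even first Betti number. -/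
theorem even_finrank_HH_one_of_torus {Z : Type} [TopologicalSpace Z] [CompactSpace Z] [T2Space Z]
    (hZ : LocEuc 2 Z) {ι : C(Z, Tor)} (hι : Topology.IsClosedEmbedding ι) :
    Even (Module.finrank (ZMod 2) (HH 1 Z)) := by
  obtain ⟨D⟩ := exists_tube hZ hι
  obtain ⟨A⟩ := D.exists_side hZ
  obtain ⟨δ, hF⟩ := D.exists_fine hZ
  obtain ⟨m₀, hm₀⟩ := exists_nat_gt δ⁻¹
  obtain ⟨m, h9, hm⟩ : ∃ m : ℕ, 9 ≤ m ∧ (m : ℝ)⁻¹ < δ := by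
    refine ⟨max 9 m₀, le_max_left _ _, inv_lt_of_inv_lt₀ hF.pos (hm₀.trans_le ?_)⟩
    exact_mod_cast le_max_right _ _
  have : NeZero m := ⟨by omega⟩
  have hs := isSec_boxSec (m := m) (c := 0)
  exact even_finrank_HH_one hZ (A.d_zeta hF hm (by omega) hs) (A.val_zeta hF hm h9 hs)
    (A.zeta_chart hF hm (by omega) _) A.isCoc_cocycle
    (A.capPair_cocycle_self hF hm (by omega) hs)
    fun x hx => A.capPair_zeta_cocycle hF hm (by omega) hs hx

end SurfT3

/-- The Euler characteristic of any closed two-dimensional submanifold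
`Z` of `(ℝP¹)³` is even. -/
theorem euler_char_even_of_closed_surface_in_T3
    (Z : Set (Fin 3 → RP1)) (hZ : IsClosedSurface Z) :
    Even (eulerCharSurface Z) := by
  obtain ⟨hc, ht, ⟨hch⟩⟩ := hZ
  have hl : SurfT3.LocEuc 2 Z := SurfT3.locEuc_of_chartedSpace hch
  obtain ⟨f, hf, hi⟩ := SurfT3.exists_circle_injection
  let ι : C(Z, SurfT3.Tor) := ⟨fun z i => f (z.1 i),
    continuous_pi fun i => hf.comp ((continuous_apply i).comp continuous_subtype_val)⟩
  have hι : Function.Injective ι := fun a b h => Subtype.ext (funext fun i => hi (congrFun h i))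
  have h1 : Even (betti Z 1) := by
    rw [SurfT3.betti_succ 0]
    exact SurfT3.even_finrank_HH_one_of_torus hl (ι.continuous.isClosedEmbedding hι)
  have h2 : betti Z 2 = betti Z 0 := by
    rw [SurfT3.betti_succ 1, SurfT3.betti_zero]
    exact SurfT3.LocEuc.finrank_HH (n := 1) hl
  rw [eulerCharSurface, h2, sub_add_eq_add_sub]
  exact (Even.add_self _).sub (Int.even_coe_nat _ |>.2 h1)
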